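/- arXiv:2603.25362 — 4 statements merged into one kernel-verified Lean document; each statement's English description precedes it below -/
import Mathlib

section
/- Let π = a + b·i ∈ ℤ[i] with 0 < a < b, gcd(a,b) = 1, a + b ≥ 5, and p = a² + b² a prime with p ≡ 1 (mod 4), and let 𝔽 = ℤ[i]/(π). Suppose C ⊆ 𝔽^n is a linear [n, n−r] code (with 1 ≤ r ≤ n) that is a 2-error-correcting perfect code for the Mannheim metric, i.e., every vector of 𝔽^n lies within Mannheim distance 2 of exactly one codeword of C. Then p^r = 8n² + 4n + 1 and r ≤ 5. -/
open scoped Classical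

noncomputable section

/-- The quotient ring `ℤ[i]/(π)`. -/
abbrev GQuot (pi : GaussianInt) : Type := GaussianInt ⧸ Ideal.span {pi}

/-- The quotient map `ℤ[i] → ℤ[i]/(π)`. -/
def gmk (pi : GaussianInt) : GaussianInt →+* GQuot pi := Ideal.Quotient.mk (Ideal.span {pi})

/-- Mannheim weight of an element of `ℤ[i]/(π)`:
the minimum of `|x| + |y|` over representatives `x + y·i`. -/
def mWt (pi : GaussianInt) (α : GQuot pi) : ℕ :=
  sInf { w : ℕ | ∃ z : GaussianInt, gmk pi z = α ∧ z.re.natAbs + z.im.natAbs = w }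

/-- Mannheim weight of a vector: the sum of the Mannheim weights of its coordinates. -/
def mWtVec (pi : GaussianInt) {n : ℕ} (v : Fin n → GQuot pi) : ℕ := ∑ i, mWt pi (v i)

/-- Hamming weight of a vector: the number of nonzero coordinates. -/
def hWtVec {n : ℕ} {F : Type*} [Zero F] (v : Fin n → F) : ℕ :=
  Set.ncard { i : Fin n | v i ≠ 0 }

/-- Minimum Mannheim distance of a linear code (minimum Mannheim weight of a
nonzero codeword). -/
def dPiCode (pi : GaussianInt) {n : ℕ} (C : Submodule (GQuot pi) (Fin n → GQuot pi)) : ℕ :=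
  sInf { w : ℕ | ∃ c ∈ C, c ≠ 0 ∧ mWtVec pi c = w }

/-- Minimum Hamming distance of a linear code. -/
def dHCode (pi : GaussianInt) {n : ℕ} (C : Submodule (GQuot pi) (Fin n → GQuot pi)) : ℕ :=
  sInf { w : ℕ | ∃ c ∈ C, c ≠ 0 ∧ hWtVec c = w }

/-- `dPiMax pi n k`: the maximum minimum Mannheim distance over all `[n,k]` codes. -/
def dPiMax (pi : GaussianInt) (n k : ℕ) : ℕ :=
  sSup { d : ℕ | ∃ C : Submodule (GQuot pi) (Fin n → GQuot pi),
    Module.finrank (GQuot pi) C = k ∧ dPiCode pi C = d }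

/-- `dHMax pi n k`: the maximum minimum Hamming distance over all `[n,k]` codes. -/
def dHMax (pi : GaussianInt) (n k : ℕ) : ℕ :=
  sSup { d : ℕ | ∃ C : Submodule (GQuot pi) (Fin n → GQuot pi),
    Module.finrank (GQuot pi) C = k ∧ dHCode pi C = d }

/-- three-term recurrence of the Pade numerators -/
def padeQ (T u0 u1 : ℝ) : ℕ → ℝ
  | 0 => u0
  | 1 => u1
  | (r+2) => ((2*(r:ℝ)+3)*2*T*padeQ T u0 u1 (r+1) + 4*(((r:ℝ)+1)^2-1/16)/((r:ℝ)+1)*padeQ T u0 u1 r)/((r:ℝ)+2)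

def padeR (r : ℕ) (T : ℝ) : ℝ := padeQ T 1 (2*T) r
def padeS (r : ℕ) (T : ℝ) : ℝ := padeQ T 0 (1/2) r

lemma padeR_zero (T) : padeR 0 T = 1 := by simp [padeR, padeQ]
lemma padeR_one (T) : padeR 1 T = 2*T := by simp [padeR, padeQ]
lemma padeS_zero (T) : padeS 0 T = 0 := by simp [padeS, padeQ]
lemma padeS_one (T) : padeS 1 T = 1/2 := by simp [padeS, padeQ]
lemma padeR_succ (r : ℕ) (T) : padeR (r+2) T = ((2*(r:ℝ)+3)*2*T*padeR (r+1) T + 4*(((r:ℝ)+1)^2-1/16)/((r:ℝ)+1)*padeR r T)/((r:ℝ)+2) := by simp [padeR, padeQ]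
lemma padeS_succ (r : ℕ) (T) : padeS (r+2) T = ((2*(r:ℝ)+3)*2*T*padeS (r+1) T + 4*(((r:ℝ)+1)^2-1/16)/((r:ℝ)+1)*padeS r T)/((r:ℝ)+2) := by simp [padeS, padeQ]

def padeR' (r : ℕ) (T : ℝ) : ℝ :=
  (-((r:ℝ)+1)*T*padeR r T + 1/4*padeS r T + ((r:ℝ)+1)/2*padeR (r+1) T)/(1+T^2)
def padeS' (r : ℕ) (T : ℝ) : ℝ :=
  (-((r:ℝ)+1)*T*padeS r T - 1/4*padeR r T + ((r:ℝ)+1)/2*padeS (r+1) T)/(1+T^2)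

lemma padeR'_low (r : ℕ) (T : ℝ) : padeR' (r+1) T =
  (((r:ℝ)+1)*T*padeR (r+1) T + 1/4*padeS (r+1) T + 2*(((r:ℝ)+1)^2-1/16)/((r:ℝ)+1)*padeR r T)/(1+T^2) := by
  have h1 : (r:ℝ)+1 ≠ 0 := by positivity
  have h2 : (r:ℝ)+2 ≠ 0 := by positivity
  have h3 : 1+T^2 ≠ 0 := by positivity
  unfold padeR'
  rw [padeR_succ]
  push_cast
  field_simp
  ring
lemma padeS'_low (r : ℕ) (T : ℝ) : padeS' (r+1) T =
  (((r:ℝ)+1)*T*padeS (r+1) T - 1/4*padeR (r+1) T + 2*(((r:ℝ)+1)^2-1/16)/((r:ℝ)+1)*padeS r T)/(1+T^2) := by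
  have h1 : (r:ℝ)+1 ≠ 0 := by positivity
  have h2 : (r:ℝ)+2 ≠ 0 := by positivity
  have h3 : 1+T^2 ≠ 0 := by positivity
  unfold padeS'
  rw [padeS_succ]
  push_cast
  field_simp
  ring

lemma pade_deriv_aux (f g : ℝ → ℝ) (f' g' T : ℝ) (r : ℕ) (hf : HasDerivAt f f' T) (hg : HasDerivAt g g' T) :
   HasDerivAt (fun T => ((2*(r:ℝ)+3)*2*T*f T + 4*(((r:ℝ)+1)^2-1/16)/((r:ℝ)+1)*g T)/((r:ℝ)+2))
    (((2*(r:ℝ)+3)*2*(f T + T*f') + 4*(((r:ℝ)+1)^2-1/16)/((r:ℝ)+1)*g')/((r:ℝ)+2)) T := by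
  have h1 := (((hasDerivAt_id T).const_mul ((2*(r:ℝ)+3)*2)).mul hf).add (hg.const_mul (4*(((r:ℝ)+1)^2-1/16)/((r:ℝ)+1)))
  have h2 := h1.div_const ((r:ℝ)+2)
  refine (h2.congr_deriv ?_)
  simp only [id]; ring

lemma pade_deriv (T : ℝ) (r : ℕ) :
    (HasDerivAt (padeR r) (padeR' r T) T ∧ HasDerivAt (padeS r) (padeS' r T) T) ∧
    (HasDerivAt (padeR (r+1)) (padeR' (r+1) T) T ∧ HasDerivAt (padeS (r+1)) (padeS' (r+1) T) T) := by
  have h3 : 1+T^2 ≠ 0 := by positivity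
  induction r with
  | zero =>
    have e0 : padeR 0 = fun _ => 1 := by funext T; exact padeR_zero T
    have e1 : padeR 1 = fun T => 2*T := by funext T; exact padeR_one T
    have e2 : padeS 0 = fun _ => 0 := by funext T; exact padeS_zero T
    have e3 : padeS 1 = fun _ => 1/2 := by funext T; exact padeS_one T
    refine ⟨⟨?_, ?_⟩, ?_, ?_⟩
    · have : padeR' 0 T = 0 := by
        simp [padeR', padeR_zero, padeR_one, padeS_zero]
      rw [this, e0]; exact hasDerivAt_const _ _
    · have : padeS' 0 T = 0 := by
        simp [padeS', padeR_zero, padeS_one, padeS_zero]; left; norm_num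
      rw [this, e2]; exact hasDerivAt_const _ _
    · have : padeR' (0+1) T = 2 := by
        rw [padeR'_low]; simp [padeR_zero, padeR_one, padeS_one]; field_simp; ring
      rw [this, zero_add, e1]; simpa using (hasDerivAt_id T).const_mul 2
    · have : padeS' (0+1) T = 0 := by
        rw [padeS'_low]; simp [padeS_zero, padeR_one, padeS_one]; left; ring
      rw [this, zero_add, e3]; exact hasDerivAt_const _ _
  | succ r ih =>
    obtain ⟨⟨a1, a2⟩, a3, a4⟩ := ih
    have h1 : (r:ℝ)+1 ≠ 0 := by positivity
    have h2 : (r:ℝ)+2 ≠ 0 := by positivity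
    refine ⟨⟨a3, a4⟩, ?_, ?_⟩
    · have e : padeR (r+1+1) = fun T => ((2*(r:ℝ)+3)*2*T*padeR (r+1) T + 4*(((r:ℝ)+1)^2-1/16)/((r:ℝ)+1)*padeR r T)/((r:ℝ)+2) := by
        funext T; exact padeR_succ r T
      rw [e]
      convert pade_deriv_aux _ _ _ _ T r a3 a1 using 1
      rw [padeR'_low, padeR'_low, padeR', padeR_succ, padeS_succ]
      push_cast
      field_simp
      ring
    · have e : padeS (r+1+1) = fun T => ((2*(r:ℝ)+3)*2*T*padeS (r+1) T + 4*(((r:ℝ)+1)^2-1/16)/((r:ℝ)+1)*padeS r T)/((r:ℝ)+2) := by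
        funext T; exact padeS_succ r T
      rw [e]
      convert pade_deriv_aux _ _ _ _ T r a4 a2 using 1
      rw [padeS'_low, padeS'_low, padeS', padeR_succ, padeS_succ]
      push_cast
      field_simp
      ring

def padeW (r : ℕ) (T : ℝ) : ℝ := padeS (r+1) T * padeR r T - padeS r T * padeR (r+1) T

lemma padeW_bound (r : ℕ) (T : ℝ) : padeW r T ≠ 0 ∧ |padeW r T| ≤ 4^r/(2*((r:ℝ)+1)) := by
  induction r with
  | zero => simp [padeW, padeR_zero, padeR_one, padeS_zero, padeS_one]
  | succ r ih =>
    have h1 : (0:ℝ) < (r:ℝ)+1 := by positivity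
    have h2 : (0:ℝ) < (r:ℝ)+2 := by positivity
    have e : padeW (r+1) T = -(4*(((r:ℝ)+1)^2-1/16)/(((r:ℝ)+1)*((r:ℝ)+2))) * padeW r T := by
      unfold padeW
      rw [padeR_succ, padeS_succ]
      field_simp
      ring
    have hpos : (0:ℝ) < ((r:ℝ)+1)^2-1/16 := by nlinarith [(Nat.cast_nonneg r : (0:ℝ) ≤ r)]
    have hc : (0:ℝ) < (4*(((r:ℝ)+1)^2-1/16)/(((r:ℝ)+1)*((r:ℝ)+2))) := by positivity
    rw [e]
    refine ⟨mul_ne_zero (neg_ne_zero.2 hc.ne') ih.1, ?_⟩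
    rw [abs_mul, abs_neg, abs_of_pos hc]
    have : (4*(((r:ℝ)+1)^2-1/16)/(((r:ℝ)+1)*((r:ℝ)+2))) ≤ 4*((r:ℝ)+1)/((r:ℝ)+2) := by
      rw [div_le_div_iff₀ (by positivity) (by positivity)]
      nlinarith
    calc _ ≤ 4*((r:ℝ)+1)/((r:ℝ)+2) * (4^r/(2*((r:ℝ)+1))) := by
          apply mul_le_mul this ih.2 (abs_nonneg _) (by positivity)
      _ = _ := by push_cast; field_simp; ring

lemma pade_pos (r : ℕ) (T : ℝ) (hT : 0 < T) :
    (0 < padeR r T ∧ 0 ≤ padeS r T ∧ T * padeS r T ≤ padeR r T) ∧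
    (0 < padeR (r+1) T ∧ 0 ≤ padeS (r+1) T ∧ T * padeS (r+1) T ≤ padeR (r+1) T) := by
  induction r with
  | zero => 
    simp only [padeR_zero, zero_add, padeR_one, padeS_zero, padeS_one]
    refine ⟨⟨by norm_num, by norm_num, by norm_num⟩, by linarith, by norm_num, by linarith⟩
  | succ r ih =>
    refine ⟨ih.2, ?_⟩
    obtain ⟨⟨a1, a2, a3⟩, b1, b2, b3⟩ := ih
    have h1 : (0:ℝ) < (r:ℝ)+1 := by positivity
    have h2 : (0:ℝ) < (r:ℝ)+2 := by positivity
    have hpos : (0:ℝ) < ((r:ℝ)+1)^2-1/16 := by nlinarith [(Nat.cast_nonneg r : (0:ℝ) ≤ r)]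
    rw [padeR_succ, padeS_succ]
    refine ⟨by positivity, by positivity, ?_⟩
    rw [mul_div_assoc']
    gcongr
    have c1 : 0 ≤ (2*(r:ℝ)+3)*2*T := by positivity
    have c2 : 0 ≤ 4*(((r:ℝ)+1)^2-1/16)/((r:ℝ)+1) := by positivity
    have := mul_le_mul_of_nonneg_left b3 c1
    have := mul_le_mul_of_nonneg_left a3 c2
    linarith

lemma padeR_lower (r : ℕ) (T : ℝ) (hT : 239 ≤ T) : 2/3*717^(r+1) ≤ padeR (r+1) T := by
  induction r with
  | zero => simp only [zero_add, padeR_one]; linarith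
  | succ r ih =>
    have h1 : (0:ℝ) < (r:ℝ)+1 := by positivity
    have h2 : (0:ℝ) < (r:ℝ)+2 := by positivity
    have hpos : (0:ℝ) < ((r:ℝ)+1)^2-1/16 := by nlinarith [(Nat.cast_nonneg r : (0:ℝ) ≤ r)]
    have a1 := (pade_pos r T (by linarith)).1.1
    have : 717 * padeR (r+1) T ≤ padeR (r+2) T := by
      rw [padeR_succ, le_div_iff₀ h2]
      have b1 : 0 ≤ 4*(((r:ℝ)+1)^2-1/16)/((r:ℝ)+1)*padeR r T := by positivity
      have b2 := (pade_pos r T (by linarith)).2.1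
      have b3 : 717*((r:ℝ)+2) ≤ (2*(r:ℝ)+3)*2*T := by nlinarith [(Nat.cast_nonneg r : (0:ℝ) ≤ r)]
      nlinarith [mul_le_mul_of_nonneg_right b3 b2.le]
    calc _ = 717*(2/3*717^(r+1) : ℝ) := by ring
      _ ≤ 717 * padeR (r+1) T := by linarith
      _ ≤ _ := this

lemma pade_upper (r : ℕ) : (padeR r 239 + padeS r 239 ≤ 960^r) ∧ (padeR (r+1) 239 + padeS (r+1) 239 ≤ 960^(r+1)) := by
  induction r with
  | zero => simp only [padeR_zero, zero_add, padeR_one, padeS_zero, padeS_one]; norm_num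
  | succ r ih =>
    refine ⟨ih.2, ?_⟩
    have h1 : (0:ℝ) < (r:ℝ)+1 := by positivity
    have h2 : (0:ℝ) < (r:ℝ)+2 := by positivity
    have hpos : (0:ℝ) < ((r:ℝ)+1)^2-1/16 := by nlinarith [(Nat.cast_nonneg r : (0:ℝ) ≤ r)]
    obtain ⟨⟨a1, a2, a3⟩, b1, b2, b3⟩ := pade_pos r 239 (by norm_num)
    rw [show r+1+1=r+2 from rfl, padeR_succ, padeS_succ, ← add_div, div_le_iff₀ h2]
    have c2 : 4*(((r:ℝ)+1)^2-1/16)/((r:ℝ)+1) ≤ 4*((r:ℝ)+2) := by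
      rw [div_le_iff₀ h1]; nlinarith
    have := mul_le_mul_of_nonneg_right c2 (add_nonneg a1.le a2)
    have := mul_le_mul_of_nonneg_left ih.1 (by positivity : (0:ℝ) ≤ 4*((r:ℝ)+2))
    have c1 : (2*(r:ℝ)+3)*2*239 ≤ 956*((r:ℝ)+2) := by linarith
    have := mul_le_mul_of_nonneg_right c1 (add_nonneg b1.le b2)
    have := mul_le_mul_of_nonneg_left ih.2 (by positivity : (0:ℝ) ≤ 956*((r:ℝ)+2))
    have : (960:ℝ)^(r+2) * ((r:ℝ)+2) = 960*960^(r+1)*((r:ℝ)+2) := by ring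
    have h5 : (960:ℝ)^(r+1) = 960*960^r := by ring
    have h6 : (0:ℝ) < 960^r := by positivity
    rw [this]
    nlinarith

def padeTheta (r : ℕ) (T : ℝ) : ℝ := Real.arctan (padeS r T / padeR r T) - Real.arctan (1/T)/4

lemma padeTheta_deriv (r : ℕ) (T : ℝ) (hT : 239 ≤ T) :
    ∃ d, HasDerivAt (padeTheta (r+1)) d T ∧ |d| ≤ 4^r/(2/3*717^(r+1))^2 * (1/T^2) := by
  have hT0 : 0 < T := by linarith
  obtain ⟨⟨dR0, dS0⟩, dR, dS⟩ := pade_deriv T r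
  obtain ⟨-, R0, S0, hSR⟩ := pade_pos r T hT0
  have h3 : 0 < 1+T^2 := by positivity
  have hA : 0 < padeR (r+1) T^2 + padeS (r+1) T^2 := by positivity
  have d1 := (dS.div dR R0.ne').arctan
  have d2 := (((hasDerivAt_inv hT0.ne').arctan).div_const 4)
  have d3 := d1.sub d2
  have e : padeTheta (r+1) = fun T => Real.arctan (padeS (r+1) T / padeR (r+1) T) - Real.arctan (T⁻¹)/4 := by
    funext T; simp [padeTheta]
  rw [e]
  refine ⟨_, d3, ?_⟩
  have key : 1 / (1 + (padeS (r + 1) / padeR (r + 1)) T ^ 2) *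
            ((padeS' (r + 1) T * padeR (r + 1) T - padeS (r + 1) T * padeR' (r + 1) T) / padeR (r + 1) T ^ 2) -
          1 / (1 + T⁻¹ ^ 2) * -(T ^ 2)⁻¹ / 4 = -(2*(((r:ℝ)+1)^2-1/16)/((r:ℝ)+1)*padeW r T)/((padeR (r+1) T^2 + padeS (r+1) T^2)*(1+T^2)) := by
    rw [padeR'_low, padeS'_low, padeW]
    simp only [Pi.div_apply]
    have h1 : (r:ℝ)+1 ≠ 0 := by positivity
    have e1 : 1 / (1 + (padeS (r + 1) T / padeR (r + 1) T) ^ 2) = padeR (r+1) T^2/(padeR (r+1) T^2 + padeS (r+1) T^2) := by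
      field_simp
    have e2 : 1 / (1 + T⁻¹ ^ 2) * -(T ^ 2)⁻¹ / 4 = -1/(4*(1+T^2)) := by
      field_simp; ring
    rw [e1, e2]
    field_simp
    ring
  rw [key, abs_div, abs_neg, abs_mul, abs_of_pos (mul_pos hA h3)]
  have hpos : (0:ℝ) < ((r:ℝ)+1)^2-1/16 := by nlinarith [(Nat.cast_nonneg r : (0:ℝ) ≤ r)]
  have h1 : (0:ℝ) < (r:ℝ)+1 := by positivity
  have n1 : |2*(((r:ℝ)+1)^2-1/16)/((r:ℝ)+1)| * |padeW r T| ≤ 4^r := by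
    rw [abs_of_pos (by positivity)]
    calc _ ≤ (2*((r:ℝ)+1)) * (4^r/(2*((r:ℝ)+1))) := by
          apply mul_le_mul _ (padeW_bound r T).2 (abs_nonneg _) (by positivity)
          rw [div_le_iff₀ h1]; nlinarith
      _ = 4^r := by field_simp
  rw [div_mul_div_comm, mul_one]
  apply div_le_div₀ (by positivity) n1 (by positivity)
  have hl := padeR_lower r T hT
  have : (2/3*717^(r+1):ℝ)^2 ≤ padeR (r+1) T^2 := by
    apply pow_le_pow_left₀ (by positivity) hl
  apply mul_le_mul _ _ (by positivity) hA.le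
  · nlinarith [sq_nonneg (padeS (r+1) T)]
  · linarith

lemma padeTheta_tendsto (r : ℕ) : Filter.Tendsto (padeTheta (r+1)) Filter.atTop (nhds 0) := by
  have h1 : Filter.Tendsto (fun T : ℝ => 1/T) Filter.atTop (nhds 0) := by
    simpa using tendsto_inv_atTop_zero (𝕜 := ℝ)
  have h2 : Filter.Tendsto (fun T => padeS (r+1) T / padeR (r+1) T) Filter.atTop (nhds 0) := by
    apply squeeze_zero' _ _ h1
    · filter_upwards [Filter.eventually_gt_atTop 0] with T hT
      obtain ⟨-, R0, S0, hSR⟩ := pade_pos r T hT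
      positivity
    · filter_upwards [Filter.eventually_gt_atTop 0] with T hT
      obtain ⟨-, R0, S0, hSR⟩ := pade_pos r T hT
      rw [div_le_div_iff₀ R0 hT]; linarith
  have c := Real.continuous_arctan.tendsto 0
  rw [Real.arctan_zero] at c
  have := (c.comp h2).sub ((c.comp h1).div_const 4)
  show Filter.Tendsto (fun T => Real.arctan (padeS (r+1) T / padeR (r+1) T) - Real.arctan (1/T)/4) _ _
  simpa [Function.comp_def] using this

lemma pade_theta (r : ℕ) : |padeTheta (r+1) 239| ≤ 4^r/(2/3*717^(r+1))^2 * (1/239) := by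
  set B : ℝ := 4^r/(2/3*717^(r+1))^2 with hB
  choose! d hd1 hd2 using padeTheta_deriv r
  have dinv : ∀ T : ℝ, 239 ≤ T → HasDerivAt (fun T : ℝ => B*(1/T)) (-(B*(1/T^2))) T := by
    intro T hT
    have := (hasDerivAt_inv (by linarith : T ≠ 0)).const_mul B
    simpa using this
  have tinv : Filter.Tendsto (fun T : ℝ => B*(1/T)) Filter.atTop (nhds 0) := by
    simpa using (tendsto_inv_atTop_zero (𝕜 := ℝ)).const_mul B
  have F1 : AntitoneOn (fun T => padeTheta (r+1) T + B*(1/T)) (Set.Ici 239) := by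
    apply antitoneOn_of_deriv_nonpos (convex_Ici _)
    · intro T hT; exact ((hd1 T hT).add (dinv T hT)).continuousAt.continuousWithinAt
    · intro T hT
      rw [interior_Ici] at hT
      exact ((hd1 T (le_of_lt hT)).add (dinv T (le_of_lt hT))).differentiableAt.differentiableWithinAt
    · intro T hT
      rw [interior_Ici] at hT
      change deriv (padeTheta (r + 1) + fun T => B * (1 / T)) T ≤ 0
      rw [((hd1 T (le_of_lt hT)).add (dinv T (le_of_lt hT))).deriv]
      linarith [(abs_le.1 (hd2 T (le_of_lt hT))).2]
  have F2 : MonotoneOn (fun T => padeTheta (r+1) T - B*(1/T)) (Set.Ici 239) := by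
    apply monotoneOn_of_deriv_nonneg (convex_Ici _)
    · intro T hT; exact ((hd1 T hT).sub (dinv T hT)).continuousAt.continuousWithinAt
    · intro T hT
      rw [interior_Ici] at hT
      exact ((hd1 T (le_of_lt hT)).sub (dinv T (le_of_lt hT))).differentiableAt.differentiableWithinAt
    · intro T hT
      rw [interior_Ici] at hT
      change 0 ≤ deriv (padeTheta (r + 1) - fun T => B * (1 / T)) T
      rw [((hd1 T (le_of_lt hT)).sub (dinv T (le_of_lt hT))).deriv]
      linarith [(abs_le.1 (hd2 T (le_of_lt hT))).1]
  have t1 := (padeTheta_tendsto r).add tinv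
  have t2 := (padeTheta_tendsto r).sub tinv
  have g1 := le_of_tendsto t1 (by
    filter_upwards [Filter.eventually_ge_atTop 239] with T hT
    exact F1 (Set.mem_Ici.2 le_rfl) (Set.mem_Ici.2 hT) hT)
  have g2 := ge_of_tendsto t2 (by
    filter_upwards [Filter.eventually_ge_atTop 239] with T hT
    exact F2 (Set.mem_Ici.2 le_rfl) (Set.mem_Ici.2 hT) hT)
  rw [abs_le]
  constructor <;> linarith

lemma fact_dvd_prod (m d : ℕ) : d.factorial ∣ 2^d * ∏ l ∈ Finset.range d, (m + 4*l) := by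
  obtain ⟨v, q, hq, hd⟩ := Nat.exists_eq_two_pow_mul_odd (Nat.factorial_ne_zero d)
  have hv : v ≤ d := by
    by_contra h
    push Not at h
    have h1 : 2^(d+1) ∣ d.factorial := by
      rw [hd]; exact Dvd.dvd.mul_right (pow_dvd_pow 2 h) q
    rcases Nat.eq_zero_or_pos d with rfl | h0
    · simp at h1
    · have h2 := Nat.emultiplicity_two_factorial_lt h0.ne'
      have h3 : ((d+1 : ℕ) : ℕ∞) ≤ emultiplicity 2 d.factorial := le_emultiplicity_of_pow_dvd h1
      have h4 := lt_of_le_of_lt h3 h2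
      have := Nat.cast_lt.1 h4
      omega
  have hc4 : Nat.Coprime 4 q := by
    have : Nat.Coprime (2^2) q := Nat.Coprime.pow_left 2 ((Nat.coprime_two_left).2 hq)
    simpa using this
  have hq2 : q ∣ ∏ l ∈ Finset.range d, (m + 4*l) := by
    have h4 : (4 : ZMod q) * ((4:ZMod q)⁻¹) = 1 := by
      have := ZMod.coe_mul_inv_eq_one 4 hc4
      exact_mod_cast this
    obtain ⟨t, ht⟩ : ∃ t : ℕ, (t : ZMod q) = (4:ZMod q)⁻¹ := by
      have : NeZero q := ⟨by rintro rfl; simp at hq⟩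
      exact ⟨_, ZMod.natCast_zmod_val _⟩
    have h1 : d.factorial ∣ (m*t).ascFactorial d := Nat.factorial_dvd_ascFactorial _ _
    have h2 : q ∣ (m*t).ascFactorial d := (Dvd.intro_left _ hd.symm).trans h1
    rw [← ZMod.natCast_eq_zero_iff] at h2 ⊢
    rw [Nat.ascFactorial_eq_prod_range] at h2
    have h5 : ((∏ l ∈ Finset.range d, (m + 4*l) : ℕ) : ZMod q) = 4^d * ((∏ i ∈ Finset.range d, (m * t + i) : ℕ) : ZMod q) := by
      push_cast
      conv_rhs => rw [show (4:ZMod q)^d = ∏ i ∈ Finset.range d, 4 by simp]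
      rw [← Finset.prod_mul_distrib]
      apply Finset.prod_congr rfl
      intro l _
      rw [ht]
      linear_combination (-(m:ZMod q)) * h4
    rw [h5, h2, mul_zero]
  rw [hd]
  exact mul_dvd_mul (pow_dvd_pow 2 hv) hq2

def pG (r : ℕ) : ℂ := ∏ l ∈ Finset.range r, ((l:ℂ) + 3/4)
lemma pG_succ (r : ℕ) : pG (r+1) = pG r * ((r:ℂ)+3/4) := by simp [pG, Finset.prod_range_succ]
lemma pG_ne (r : ℕ) : pG r ≠ 0 := by
  rw [pG, Finset.prod_ne_zero_iff]
  intro l _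
  have h : ((l:ℝ) + 3/4 : ℝ) ≠ 0 := by positivity
  intro h2
  apply h
  have := congrArg Complex.re h2
  simpa using this

def pAl (J : ℂ) (r k : ℕ) : ℂ :=
  pG r / pG k * (r.choose k) * (r+k).factorial / (r.factorial : ℂ)^2 * J^r / J^k

lemma pAl_rec2 (J : ℂ) (hJ : J ≠ 0) (r k : ℕ) :
    ((r:ℂ)+2)*(r+1) * pAl J (r+2) (k+2) = ((r:ℂ)+1)*(2*r+3)*(2*pAl J (r+1) (k+1) + J * pAl J (r+1) (k+2))
      - J^2*(((r:ℂ)+1)^2-1/16)*pAl J r (k+2) := by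
  have c1 : ((r.choose (k+1) : ℕ) : ℂ) = ((r:ℂ)-k)/(k+1) * (r.choose k) := by
    have h := Nat.choose_succ_right_eq r k
    have hk : (k:ℂ)+1 ≠ 0 := by exact_mod_cast Nat.succ_ne_zero k
    rcases le_or_gt k r with h1 | h1
    · have h' : ((r.choose (k+1) : ℕ) : ℂ) * (k+1) = r.choose k * ((r:ℂ)-k) := by
        rw [← Nat.cast_sub h1]; exact_mod_cast h
      field_simp; linear_combination h'
    · rw [Nat.choose_eq_zero_of_lt h1, Nat.choose_eq_zero_of_lt (by omega)]; simp
  have c2 : ((r.choose (k+2) : ℕ) : ℂ) = ((r:ℂ)-k-1)/(k+2) * (r.choose (k+1)) := by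
    have h := Nat.choose_succ_right_eq r (k+1)
    have hk : (k:ℂ)+2 ≠ 0 := by exact_mod_cast Nat.succ_ne_zero (k+1)
    rcases le_or_gt (k+1) r with h1 | h1
    · have h' : ((r.choose (k+2) : ℕ) : ℂ) * (k+2) = r.choose (k+1) * ((r:ℂ)-(k+1:ℕ)) := by
        rw [← Nat.cast_sub h1]; exact_mod_cast h
      push_cast at h'
      field_simp; linear_combination h'
    · rw [Nat.choose_eq_zero_of_lt h1, Nat.choose_eq_zero_of_lt (by omega)]; simp
  have hk1 : (k:ℂ)+1 ≠ 0 := by exact_mod_cast Nat.succ_ne_zero k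
  have hk2 : (k:ℂ)+2 ≠ 0 := by exact_mod_cast Nat.succ_ne_zero (k+1)
  have hr1 : (r:ℂ)+1 ≠ 0 := by exact_mod_cast Nat.succ_ne_zero r
  have hr2 : (r:ℂ)+2 ≠ 0 := by exact_mod_cast Nat.succ_ne_zero (r+1)
  have g0 := pG_ne k
  have g1 : (k:ℂ)+3/4 ≠ 0 := by
    have := pG_ne (k+1); rw [pG_succ] at this; exact right_ne_zero_of_mul this
  have g2 : (k:ℂ)+1+3/4 ≠ 0 := by
    have := pG_ne (k+2); rw [pG_succ] at this; have := right_ne_zero_of_mul this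
    push_cast at this; exact this
  have f0 : (r.factorial : ℂ) ≠ 0 := by exact_mod_cast Nat.factorial_ne_zero r
  unfold pAl
  rw [show r+2+(k+2) = r+k+4 by ring, show r+1+(k+1) = r+k+2 by ring, show r+1+(k+2) = r+k+3 by ring,
    show r+(k+2) = r+k+2 by ring]
  rw [Nat.choose_succ_succ (r+1) (k+1), Nat.choose_succ_succ r k, Nat.choose_succ_succ r (k+1)]
  simp only [pG_succ, Nat.factorial_succ]
  push_cast
  rw [c2, c1]
  have g1' : (4*k+3:ℂ) ≠ 0 := by intro h; apply g1; linear_combination h/4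
  have g2' : (4*(k+1)+3:ℂ) ≠ 0 := by intro h; apply g2; linear_combination h/4
  have hr2' : (r:ℂ)+1+1 ≠ 0 := by intro h; apply hr2; linear_combination h
  field_simp
  ring

lemma pAl_rec1 (J : ℂ) (hJ : J ≠ 0) (r : ℕ) :
    ((r:ℂ)+2)*(r+1) * pAl J (r+2) 1 = ((r:ℂ)+1)*(2*r+3)*(2*pAl J (r+1) 0 + J * pAl J (r+1) 1)
      - J^2*(((r:ℂ)+1)^2-1/16)*pAl J r 1 := by
  have hr1 : (r:ℂ)+1 ≠ 0 := by exact_mod_cast Nat.succ_ne_zero r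
  have hr2 : (r:ℂ)+2 ≠ 0 := by exact_mod_cast Nat.succ_ne_zero (r+1)
  have f0 : (r.factorial : ℂ) ≠ 0 := by exact_mod_cast Nat.factorial_ne_zero r
  have hr2' : (r:ℂ)+1+1 ≠ 0 := by intro h; apply hr2; linear_combination h
  have p0 : pG 0 = 1 := by simp [pG]
  have p1 : pG 1 = 3/4 := by simp [pG]
  unfold pAl
  simp only [pG_succ r, pG_succ (r+1), Nat.factorial_succ, p0, p1, Nat.choose_one_right, Nat.choose_zero_right, add_zero]
  push_cast
  field_simp
  ring

lemma pAl_rec0 (J : ℂ) (hJ : J ≠ 0) (r : ℕ) :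
    ((r:ℂ)+2)*(r+1) * pAl J (r+2) 0 = ((r:ℂ)+1)*(2*r+3)*(J * pAl J (r+1) 0)
      - J^2*(((r:ℂ)+1)^2-1/16)*pAl J r 0 := by
  have hr1 : (r:ℂ)+1 ≠ 0 := by exact_mod_cast Nat.succ_ne_zero r
  have hr2 : (r:ℂ)+2 ≠ 0 := by exact_mod_cast Nat.succ_ne_zero (r+1)
  have f0 : (r.factorial : ℂ) ≠ 0 := by exact_mod_cast Nat.factorial_ne_zero r
  have hr2' : (r:ℂ)+1+1 ≠ 0 := by intro h; apply hr2; linear_combination h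
  have p0 : pG 0 = 1 := by simp [pG]
  unfold pAl
  simp only [pG_succ r, pG_succ (r+1), Nat.factorial_succ, p0, Nat.choose_zero_right, add_zero]
  push_cast
  field_simp
  ring

lemma pAl_zero (J : ℂ) (r k : ℕ) (h : r < k) : pAl J r k = 0 := by
  simp [pAl, Nat.choose_eq_zero_of_lt h]

lemma pAl_sum_rec (J X : ℂ) (hJ : J ≠ 0) (r : ℕ) :
    ((r:ℂ)+2)*(r+1) * ∑ k ∈ Finset.range (r+3), pAl J (r+2) k * X^k =
     ((r:ℂ)+1)*(2*r+3)*((2*X+J) * ∑ k ∈ Finset.range (r+2), pAl J (r+1) k * X^k)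
      - J^2*(((r:ℂ)+1)^2-1/16)* ∑ k ∈ Finset.range (r+1), pAl J r k * X^k := by
  have e1 : ∑ k ∈ Finset.range (r+2), pAl J (r+1) k * X^k = ∑ k ∈ Finset.range (r+3), pAl J (r+1) k * X^k := by
    rw [Finset.sum_range_succ _ (r+2), pAl_zero J (r+1) (r+2) (by omega)]; simp
  have e2 : ∑ k ∈ Finset.range (r+1), pAl J r k * X^k = ∑ k ∈ Finset.range (r+3), pAl J r k * X^k := by
    rw [Finset.sum_range_succ _ (r+2), pAl_zero J r (r+2) (by omega), Finset.sum_range_succ _ (r+1), pAl_zero J r (r+1) (by omega)]; simp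
  have e3 : X * ∑ k ∈ Finset.range (r+2), pAl J (r+1) k * X^k = ∑ k ∈ Finset.range (r+1), pAl J (r+1) (k+1) * X^(k+2) + pAl J (r+1) 0 * X := by
    rw [Finset.sum_range_succ', mul_add, Finset.mul_sum]
    congr 1
    · apply Finset.sum_congr rfl; intro k _; ring
    · ring
  rw [add_mul (2*X) J, show 2*X*∑ k ∈ Finset.range (r+2), pAl J (r+1) k * X^k = 2*(X*∑ k ∈ Finset.range (r+2), pAl J (r+1) k * X^k) by ring, e3, e1, e2]
  rw [Finset.sum_range_succ' _ (r+2), Finset.sum_range_succ' _ (r+1), Finset.sum_range_succ' _ (r+2), Finset.sum_range_succ' _ (r+1), Finset.sum_range_succ' _ (r+2), Finset.sum_range_succ' _ (r+1)]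
  have h0 := pAl_rec0 J hJ r
  have h1 := pAl_rec1 J hJ r
  have h2 : ((r:ℂ)+2)*(r+1) * ∑ k ∈ Finset.range (r+1), pAl J (r+2) (k+1+1) * X^(k+1+1) =
     ((r:ℂ)+1)*(2*r+3)*(2 * ∑ k ∈ Finset.range (r+1), pAl J (r+1) (k+1) * X^(k+2) + J * ∑ k ∈ Finset.range (r+1), pAl J (r+1) (k+1+1) * X^(k+1+1))
      - J^2*(((r:ℂ)+1)^2-1/16)* ∑ k ∈ Finset.range (r+1), pAl J r (k+1+1) * X^(k+1+1) := by
    simp only [Finset.mul_sum, ← Finset.sum_add_distrib, ← Finset.sum_sub_distrib]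
    apply Finset.sum_congr rfl
    intro k _
    linear_combination X^(k+2) * pAl_rec2 J hJ r k
  linear_combination h0 + X * h1 + h2

lemma pade_explicit (r : ℕ) (T : ℝ) :
    ((padeR r T : ℂ) + padeS r T * Complex.I = ∑ k ∈ Finset.range (r+1), pAl (-2*Complex.I) r k * ((T:ℂ)+Complex.I)^k) ∧
    ((padeR (r+1) T : ℂ) + padeS (r+1) T * Complex.I = ∑ k ∈ Finset.range (r+2), pAl (-2*Complex.I) (r+1) k * ((T:ℂ)+Complex.I)^k) := by
  have hJ : -2*Complex.I ≠ 0 := by simp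
  have p0 : pG 0 = 1 := by simp [pG]
  have p1 : pG 1 = 3/4 := by simp [pG]
  induction r with
  | zero =>
    constructor
    · simp [pAl, p0, padeR_zero, padeS_zero]
    · have i0 := Complex.I_ne_zero
      simp [Finset.sum_range_succ, pAl, p0, p1, padeR_one, padeS_one]
      ring
  | succ r ih =>
    refine ⟨ih.2, ?_⟩
    have h := pAl_sum_rec (-2*Complex.I) (T+Complex.I) hJ r
    rw [← ih.1, ← ih.2] at h
    have hr1 : (r:ℂ)+1 ≠ 0 := by exact_mod_cast Nat.succ_ne_zero r
    have hr2 : (r:ℂ)+2 ≠ 0 := by exact_mod_cast Nat.succ_ne_zero (r+1)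
    apply mul_left_cancel₀ (mul_ne_zero hr2 hr1)
    rw [show r+1+2 = r+3 by ring, show r+1+1 = r+2 by ring, h, padeR_succ, padeS_succ]
    push_cast
    have i2 := Complex.I_sq
    field_simp
    ring_nf
    simp only [i2, show Complex.I^3 = -Complex.I by rw [pow_succ, i2]; ring]
    ring

lemma pAl_int (r k : ℕ) (h : k ≤ r) : ∃ z : ℤ, (4:ℂ)^r * pAl (-2*Complex.I) r k = z * (-Complex.I)^(r-k) := by
  obtain ⟨d, rfl⟩ := Nat.exists_eq_add_of_le h
  have hJ : -2*Complex.I ≠ 0 := by simp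
  obtain ⟨q, hq⟩ := fact_dvd_prod (4*k+3) d
  refine ⟨(4^k * ((k+d+k).choose k) * q : ℕ), ?_⟩
  have hG : pG (k+d) * 4^d = pG k * ((∏ l ∈ Finset.range d, (4*k+3 + 4*l) : ℕ):ℂ) := by
    rw [pG, Finset.prod_range_add, ← pG]
    push_cast
    rw [show (4:ℂ)^d = ∏ i ∈ Finset.range d, 4 by simp, mul_assoc, ← Finset.prod_mul_distrib]
    congr 1
    apply Finset.prod_congr rfl
    intro l _
    ring
  have hqC : (2:ℂ)^d * ((∏ l ∈ Finset.range d, (4*k+3 + 4*l) : ℕ):ℂ) = (d.factorial:ℂ) * q := by exact_mod_cast hq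
  have hc1 : (((k+d).choose k : ℕ):ℂ) * k.factorial * d.factorial = ((k+d).factorial : ℂ) := by
    have := Nat.choose_mul_factorial_mul_factorial h
    rw [Nat.add_sub_cancel_left] at this
    exact_mod_cast this
  have hc2 : (((k+d+k).choose k : ℕ):ℂ) * k.factorial * (k+d).factorial = ((k+d+k).factorial : ℂ) := by
    have := Nat.choose_mul_factorial_mul_factorial (show k ≤ k+d+k by omega)
    rw [Nat.add_sub_cancel] at this
    exact_mod_cast this
  have f1 : (k.factorial : ℂ) ≠ 0 := by exact_mod_cast Nat.factorial_ne_zero _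
  have f2 : (d.factorial : ℂ) ≠ 0 := by exact_mod_cast Nat.factorial_ne_zero _
  have f3 : ((k+d).factorial : ℂ) ≠ 0 := by exact_mod_cast Nat.factorial_ne_zero _
  have g0 := pG_ne k
  rw [Nat.add_sub_cancel_left]
  unfold pAl
  have e1 : pG (k+d) = pG k * ((∏ l ∈ Finset.range d, (4*k+3 + 4*l) : ℕ):ℂ) / 4^d := by
    rw [← hG]; field_simp
  have e2 : ((∏ l ∈ Finset.range d, (4*k+3 + 4*l) : ℕ):ℂ) = (d.factorial:ℂ) * q / 2^d := by
    rw [← hqC]; field_simp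
  have e3 : (((k+d).choose k : ℕ):ℂ) = ((k+d).factorial : ℂ)/ (k.factorial * d.factorial) := by
    rw [← hc1]; field_simp
  rw [e1, e2, e3, ← hc2, pow_add (-2*Complex.I) k d, show (-2*Complex.I)^d = 2^d * (-Complex.I)^d by rw [← mul_pow]; ring_nf]
  push_cast
  have : (-2*Complex.I)^k ≠ 0 := pow_ne_zero _ hJ
  rw [pow_add (4:ℂ)]
  field_simp

lemma pade_int (r : ℕ) : ∃ P Q : ℤ, 4^r * padeR r 239 = P ∧ 4^r * padeS r 239 = Q := by
  obtain ⟨z, hz⟩ : ∃ z : GaussianInt, (4:ℂ)^r * ((padeR r 239 : ℂ) + padeS r 239 * Complex.I) = GaussianInt.toComplex z := by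
    rw [(pade_explicit r 239).1, Finset.mul_sum]
    have : ∀ k ∈ Finset.range (r+1), (4:ℂ)^r * (pAl (-2*Complex.I) r k * (((239:ℝ):ℂ)+Complex.I)^k) ∈ GaussianInt.toComplex.range := by
      intro k hk
      obtain ⟨z, hz⟩ := pAl_int r k (by simpa [Nat.lt_succ_iff] using hk)
      rw [← mul_assoc, hz]
      refine ⟨z * (⟨0,-1⟩ : GaussianInt)^(r-k) * (⟨239,1⟩ : GaussianInt)^k, ?_⟩
      simp only [map_mul, map_pow, GaussianInt.toComplex_def']
      simp
    obtain ⟨z, hz⟩ := Subring.sum_mem _ this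
    exact ⟨z, hz.symm⟩
  refine ⟨z.re, z.im, ?_⟩
  rw [show (4:ℂ)^r = ((4^r:ℝ):ℂ) by push_cast; rfl] at hz
  have h1 := congrArg Complex.re hz
  have h2 := congrArg Complex.im hz
  rw [Complex.re_ofReal_mul] at h1
  rw [Complex.im_ofReal_mul] at h2
  simp at h1 h2
  exact ⟨h1.trans (GaussianInt.intCast_re z).symm, h2.trans (GaussianInt.intCast_im z).symm⟩

lemma pade_step (u v : ℤ) (H φ x : ℝ) (hu : (u:ℝ) = H * Real.cos φ) (hv : (v:ℝ) = H * Real.sin φ)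
    (hφ : φ = (Real.arctan (1/x) + Real.arctan (1/239))/4) (hx : 0 < x) (hH : 10^19 ≤ H)
    (hHx : 1/(4*x) ≤ 125/H^4) (t : ℕ) (h1 : H * (3/100)^(t+1) < 1) (h2 : (3840^(t+1))^2 ≤ 3840^4*H^5) :
    (v:ℝ) * padeR (t+1) 239 = u * padeS (t+1) 239 := by
  have hH0 : 0 < H := lt_of_lt_of_le (by norm_num) hH
  obtain ⟨-, R0, S0, -⟩ := pade_pos t 239 (by norm_num)
  have hup := (pade_upper t).2
  have hth := pade_theta t
  obtain ⟨P, Q, hP, hQ⟩ := pade_int (t+1)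
  set R := padeR (t+1) 239
  set S := padeS (t+1) 239
  set ψ := Real.arctan (S/R) with hψ
  have hK : 0 < Real.sqrt (R^2+S^2) := Real.sqrt_pos.2 (by positivity)
  set K := Real.sqrt (R^2+S^2) with hKdef
  have hK2 : K^2 = R^2+S^2 := Real.sq_sqrt (by positivity)
  have hKle : K ≤ 960^(t+1) := by
    refine le_trans ?_ hup
    rw [hKdef]
    apply Real.sqrt_le_iff.2
    constructor
    · positivity
    · nlinarith [mul_nonneg R0.le S0]
  have hsq : Real.sqrt (1 + (S/R)^2) = K / R := by
    rw [hKdef, show R^2+S^2 = (1+(S/R)^2)*R^2 by field_simp, Real.sqrt_mul (by positivity), Real.sqrt_sq R0.le]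
    field_simp
  have hc : R = K * Real.cos ψ := by
    rw [hψ, Real.cos_arctan, hsq]; field_simp
  have hs : S = K * Real.sin ψ := by
    rw [hψ, Real.sin_arctan, hsq]; field_simp
  have hN : (v:ℝ)*R - u*S = H*K*Real.sin (φ-ψ) := by
    rw [hu, hv, Real.sin_sub]
    conv_lhs => rw [hc, hs]
    ring
  have hax : |Real.arctan (1/x)| ≤ 1/x := by
    have h0 : 0 ≤ 1/x := by positivity
    rw [abs_of_nonneg (Real.arctan_nonneg.2 h0)]
    have := Real.le_tan (Real.arctan_nonneg.2 h0) (Real.arctan_lt_pi_div_two (1/x))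
    rwa [Real.tan_arctan] at this
  have hang : |φ-ψ| ≤ 125/H^4 + 4^t/(2/3*717^(t+1))^2*(1/239) := by
    have e : φ-ψ = Real.arctan (1/x)/4 - padeTheta (t+1) 239 := by
      rw [hφ, padeTheta]; ring
    rw [e]
    have e2 : |Real.arctan (1/x)/4| ≤ 1/(4*x) := by
      rw [abs_div, abs_of_pos (by norm_num : (0:ℝ)<4), show 1/(4*x) = 1/x/4 by field_simp]
      linarith
    calc _ ≤ |Real.arctan (1/x)/4| + |padeTheta (t+1) 239| := abs_sub _ _
      _ ≤ _ := by linarith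
  have hsin : |Real.sin (φ-ψ)| ≤ |φ-ψ| := Real.abs_sin_le_abs
  have b1 : 125*3840^(t+1)/H^3 ≤ (6/10:ℝ) := by
    apply le_of_sq_le_sq _ (by norm_num)
    rw [div_pow, div_le_iff₀ (by positivity), mul_pow]
    have : (10:ℝ)^19*H^5 ≤ H*H^5 := mul_le_mul_of_nonneg_right hH (by positivity)
    nlinarith
  have b2 : H*3840^(t+1)*(4^t/(2/3*717^(t+1))^2*(1/239)) ≤ (1/10:ℝ) := by
    have e : H*3840^(t+1)*(4^t/(2/3*717^(t+1))^2*(1/239)) = H * (15360/514089)^(t+1) * (9/(16*239)) := by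
      rw [div_pow, show (15360:ℝ) = 3840*4 by norm_num, show (514089:ℝ) = 717^2 by norm_num, mul_pow (3840:ℝ) 4, pow_succ 4 t]
      rw [← pow_mul, mul_pow (2/3:ℝ), ← pow_mul, mul_comm 2 (t+1)]
      field_simp
      ring
    rw [e]
    have : (15360/514089:ℝ)^(t+1) ≤ (3/100)^(t+1) := pow_le_pow_left₀ (by norm_num) (by norm_num) _
    have := mul_le_mul_of_nonneg_left this hH0.le
    linarith
  have hfin : |((v*P - u*Q : ℤ):ℝ)| < 1 := by
    have e : ((v*P - u*Q : ℤ):ℝ) = 4^(t+1)*(v*R-u*S) := by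
      push_cast; rw [← hP, ← hQ]; ring
    rw [e, hN, abs_mul, abs_mul, abs_of_pos (by positivity : (0:ℝ) < 4^(t+1)), abs_of_pos (by positivity : (0:ℝ) < H*K)]
    have hstep : 4^(t+1)*(H*K*|Real.sin (φ-ψ)|) ≤ 4^(t+1)*(H*960^(t+1)*(125/H^4 + 4^t/(2/3*717^(t+1))^2*(1/239))) := by
      apply mul_le_mul_of_nonneg_left _ (by positivity)
      apply mul_le_mul _ (hsin.trans hang) (abs_nonneg _) (by positivity)
      exact mul_le_mul_of_nonneg_left hKle hH0.le
    have e2 : 4^(t+1)*(H*960^(t+1)*(125/H^4 + 4^t/(2/3*717^(t+1))^2*(1/239))) = 125*3840^(t+1)/H^3 + H*3840^(t+1)*(4^t/(2/3*717^(t+1))^2*(1/239)) := by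
      rw [show (3840:ℝ) = 4*960 by norm_num, mul_pow (4:ℝ) 960]
      rw [mul_add, mul_add]
      congr 1
      · field_simp
      · ring
    rw [e2] at hstep
    linarith
  have hz : v*P - u*Q = 0 := by
    rw [← Int.cast_abs] at hfin
    have : |v*P-u*Q| < 1 := by exact_mod_cast hfin
    exact Int.abs_lt_one_iff.1 this
  have hz' : (v:ℝ)*P = u*Q := by exact_mod_cast (sub_eq_zero.1 hz)
  rw [← hP, ← hQ] at hz'
  have h4 : (4:ℝ)^(t+1) ≠ 0 := by positivity
  apply mul_left_cancel₀ h4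
  linear_combination hz'

lemma pade_core (u v : ℤ) (H φ x : ℝ) (hu : (u:ℝ) = H * Real.cos φ) (hv : (v:ℝ) = H * Real.sin φ)
    (hφ : φ = (Real.arctan (1/x) + Real.arctan (1/239))/4) (hx : 0 < x) (hH : 10^19 ≤ H)
    (hHx : 1/(4*x) ≤ 125/H^4) (hu0 : u ≠ 0) : False := by
  have hH0 : 0 < H := lt_of_lt_of_le (by norm_num) hH
  obtain ⟨s, hs1, hs2⟩ := exists_nat_pow_near (x := H) (y := (100/3:ℝ)) (le_trans (by norm_num) hH) (by norm_num)
  have k : ∀ m, H * (3/100)^(s+1+m) < 1 := by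
    intro m
    have e : H * (3/100)^(s+1+m) ≤ H*(3/100)^(s+1) := by
      apply mul_le_mul_of_nonneg_left _ hH0.le
      apply pow_le_pow_of_le_one (by norm_num) (by norm_num) (by omega)
    have : (100/3:ℝ)^(s+1)*(3/100)^(s+1) = 1 := by rw [← mul_pow]; norm_num
    have : H*(3/100)^(s+1) < (100/3:ℝ)^(s+1)*(3/100)^(s+1) := mul_lt_mul_of_pos_right hs2 (by positivity)
    linarith
  have hb : (3840^s:ℝ)^2 ≤ H^5 := by
    calc (3840^s:ℝ)^2 = (3840^2)^s := by rw [← pow_mul, ← pow_mul, mul_comm]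
      _ ≤ ((100/3)^5)^s := pow_le_pow_left₀ (by norm_num) (by norm_num) _
      _ = ((100/3)^s)^5 := by rw [← pow_mul, ← pow_mul, mul_comm]
      _ ≤ H^5 := pow_le_pow_left₀ (by positivity) hs1 _
  have h1 := pade_step u v H φ x hu hv hφ hx hH hHx s (k 0) (by rw [pow_succ 3840 s, mul_pow]; nlinarith [sq_nonneg ((3840:ℝ)^s)])
  have h2 := pade_step u v H φ x hu hv hφ hx hH hHx (s+1) (k 1) (by rw [pow_succ 3840 (s+1), pow_succ 3840 s, mul_pow, mul_pow]; nlinarith [sq_nonneg ((3840:ℝ)^s)])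
  apply (padeW_bound (s+1) 239).1
  have hu' : (u:ℝ) ≠ 0 := by exact_mod_cast hu0
  apply mul_left_cancel₀ hu'
  rw [padeW]
  linear_combination padeR (s+1+1) 239 * h1 - padeR (s+1) 239 * h2

lemma ofReal_add_I_polar (x : ℝ) (hx : 0 < x) : (x:ℂ) + Complex.I = (Real.sqrt (x^2+1) : ℝ) * Complex.exp ((Real.arctan (1/x) : ℝ) * Complex.I) := by
  have hs : 0 < Real.sqrt (x^2+1) := Real.sqrt_pos.2 (by positivity)
  have hsq : Real.sqrt (1 + (1/x)^2) = Real.sqrt (x^2+1) / x := by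
    rw [show x^2+1 = (1+(1/x)^2)*x^2 by field_simp, Real.sqrt_mul (by positivity), Real.sqrt_sq hx.le]
    field_simp
  apply Complex.ext
  · rw [Complex.re_ofReal_mul, Complex.exp_ofReal_mul_I_re, Real.cos_arctan, hsq]
    simp; field_simp
  · rw [Complex.im_ofReal_mul, Complex.exp_ofReal_mul_I_im, Real.sin_arctan, hsq]
    simp; field_simp

lemma ljung_core (V : GaussianInt) (x : ℤ) (hx : 10^75 ≤ x) (hV : (⟨1,1⟩ : GaussianInt) * V^4 = ⟨x,1⟩) : False := by
  set Z : GaussianInt := V * ⟨3,-2⟩ * ⟨1,1⟩ with hZ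
  have hZ4 : Z^4 = 2 * ⟨x,1⟩ * ⟨239,1⟩ := by
    rw [← hV, hZ, mul_pow, mul_pow]
    have : (⟨3,-2⟩:GaussianInt)^4 * (⟨1,1⟩:GaussianInt)^4 = 2 * ⟨1,1⟩ * ⟨239,1⟩ := by decide
    linear_combination V^4 * this
  have hZc : (GaussianInt.toComplex Z)^4 = 2 * ((x:ℝ) + Complex.I) * ((239:ℝ) + Complex.I) := by
    rw [← map_pow, hZ4, map_mul, map_mul, GaussianInt.toComplex_def' x 1, GaussianInt.toComplex_def' 239 1, map_ofNat]
    simp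
  have hxR : (10^75:ℝ) ≤ x := by exact_mod_cast hx
  have hx0 : (0:ℝ) < x := lt_of_lt_of_le (by norm_num) hxR
  set H : ℝ := ‖GaussianInt.toComplex Z‖ with hH
  set φ : ℝ := (Real.arctan (1/(x:ℝ)) + Real.arctan (1/239))/4 with hφ
  have hpol : (GaussianInt.toComplex Z)^4 = ((2 * Real.sqrt ((x:ℝ)^2+1) * Real.sqrt (239^2+1) : ℝ):ℂ) * Complex.exp ((φ:ℝ)*Complex.I)^4 := by
    rw [hZc, ofReal_add_I_polar _ hx0, ofReal_add_I_polar _ (by norm_num : (0:ℝ) < 239), ← Complex.exp_nat_mul]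
    have : ((4:ℕ):ℂ) * ((φ:ℝ)*Complex.I) = (Real.arctan (1/(x:ℝ)) : ℝ)*Complex.I + (Real.arctan (1/239) : ℝ) * Complex.I := by
      rw [hφ]; push_cast; ring
    rw [this, Complex.exp_add]
    push_cast; ring
  have hH4 : H^4 = 2 * Real.sqrt ((x:ℝ)^2+1) * Real.sqrt (239^2+1) := by
    rw [hH, ← norm_pow, hpol, norm_mul, norm_pow, Complex.norm_exp_ofReal_mul_I, Complex.norm_real, Real.norm_of_nonneg (by positivity)]
    ring
  have hH0 : 0 ≤ H := norm_nonneg _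
  have s1 : Real.sqrt ((x:ℝ)^2+1) ≤ 101/100 * x := by
    apply Real.sqrt_le_iff.2; constructor
    · positivity
    · nlinarith
  have s2 : (x:ℝ) ≤ Real.sqrt ((x:ℝ)^2+1) := by
    apply Real.le_sqrt_of_sq_le; linarith
  have s3 : Real.sqrt (239^2+1) ≤ 240 := by
    apply Real.sqrt_le_iff.2; constructor <;> norm_num
  have s4 : 239 ≤ Real.sqrt (239^2+1) := by
    apply Real.le_sqrt_of_sq_le; norm_num
  have hup : H^4 ≤ 500*x := by
    rw [hH4]; nlinarith
  have hlow : 400*(x:ℝ) ≤ H^4 := by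
    rw [hH4]; nlinarith
  have hHbig : 10^19 ≤ H := by
    by_contra h
    push Not at h
    have : H^4 ≤ (10^19)^4 := pow_le_pow_left₀ hH0 h.le 4
    have e : ((10:ℝ)^19)^4 = 10*10^75 := by norm_num
    linarith
  have hHp : 0 < H := lt_of_lt_of_le (by norm_num) hHbig
  have hHx : 1/(4*(x:ℝ)) ≤ 125/H^4 := by
    rw [div_le_div_iff₀ (by positivity) (by positivity)]; linarith
  have hZne : GaussianInt.toComplex Z ≠ 0 := by
    intro h; rw [hH, h, norm_zero] at hHp; exact lt_irrefl _ hHp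
  have hw : ∃ k : ℕ, (H:ℂ) * Complex.exp ((φ:ℝ)*Complex.I) = Complex.I^k * GaussianInt.toComplex Z := by
    have : ((H:ℂ) * Complex.exp ((φ:ℝ)*Complex.I))^4 = (GaussianInt.toComplex Z)^4 := by
      rw [hpol, ← hH4]; push_cast; ring
    set w := (H:ℂ) * Complex.exp ((φ:ℝ)*Complex.I)
    set z := GaussianInt.toComplex Z
    have f : (w - z)*(w+z)*((w-Complex.I*z)*(w+Complex.I*z)) = 0 := by
      have i2 := Complex.I_sq
      linear_combination this + (-w^2*z^2+z^4)*i2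
    rcases mul_eq_zero.1 f with f | f <;> rcases mul_eq_zero.1 f with f | f
    · exact ⟨0, by linear_combination f⟩
    · exact ⟨2, by rw [Complex.I_sq]; linear_combination f⟩
    · exact ⟨1, by linear_combination f⟩
    · exact ⟨3, by rw [pow_succ, Complex.I_sq]; linear_combination f⟩
  obtain ⟨k, hk⟩ := hw
  set Y : GaussianInt := ⟨0,1⟩^k * Z with hY
  have hYc : (H:ℂ) * Complex.exp ((φ:ℝ)*Complex.I) = GaussianInt.toComplex Y := by
    rw [hk, hY, map_mul _ _ Z, map_pow, GaussianInt.toComplex_def' 0 1]; simp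
  have hu : (Y.re:ℝ) = H * Real.cos φ := by
    rw [GaussianInt.intCast_re, ← hYc, Complex.re_ofReal_mul, Complex.exp_ofReal_mul_I_re]
  have hv : (Y.im:ℝ) = H * Real.sin φ := by
    rw [GaussianInt.intCast_im, ← hYc, Complex.im_ofReal_mul, Complex.exp_ofReal_mul_I_im]
  have hcos : 0 < Real.cos φ := by
    apply Real.cos_pos_of_mem_Ioo
    have a1 := Real.arctan_lt_pi_div_two (1/(x:ℝ))
    have a2 := Real.arctan_lt_pi_div_two (1/239)
    have a3 := Real.neg_pi_div_two_lt_arctan (1/(x:ℝ))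
    have a4 := Real.neg_pi_div_two_lt_arctan (1/239)
    constructor <;> rw [hφ] <;> linarith [Real.pi_pos]
  refine pade_core Y.re Y.im H φ x hu hv hφ hx0 hHbig hHx ?_
  intro h
  rw [h] at hu
  have : 0 < H * Real.cos φ := by positivity
  rw [← hu] at this
  simp at this

def pellF (k : ℕ) : ℕ × ℕ := Nat.rec (1,1) (fun _ z => (3*z.1+4*z.2, 2*z.1+3*z.2)) k

lemma pellF_succ (k : ℕ) : pellF (k+1) = (3*(pellF k).1+4*(pellF k).2, 2*(pellF k).1+3*(pellF k).2) := rfl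

def rtF (y : ℕ) (fuel : ℕ) : ℕ → ℕ :=
  Nat.rec (fun lo => lo) (fun n ih lo => Nat.rec (ih lo) (fun _ _ => ih (lo + 2^n)) (y + 1 - (lo+2^n)^4)) fuel

lemma pellF_check : (∀ k < 100, k = 0 ∨ (let y := (pellF k).2; (rtF y 70 0)^4 < y ∧ y < (rtF y 70 0+1)^4)) ∧ 10^75 ≤ (pellF 100).2 := by
  decide +kernel

lemma pellF_mono : Monotone (fun k => (pellF k).2) := by
  apply monotone_nat_of_le_succ
  intro k
  rw [pellF_succ]; simp only; omega

lemma pell_enum (y : ℕ) : ∀ x : ℕ, x^2+1 = 2*y^2 → ∃ k, pellF k = (x,y) := by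
  induction y using Nat.strong_induction_on with
  | _ y ih =>
    intro x h
    rcases Nat.lt_or_ge y 3 with hy | hy
    · have hx : x < 3 := by nlinarith
      interval_cases y <;> interval_cases x <;> simp at h
      exact ⟨0, rfl⟩
    · have h1 : 4*y < 3*x := by nlinarith
      have h2 : 2*x < 3*y := by nlinarith
      have h3 : y < x := by nlinarith
      obtain ⟨u, hu⟩ := Nat.exists_eq_add_of_lt h1
      obtain ⟨v, hv⟩ := Nat.exists_eq_add_of_lt h2
      obtain ⟨k, hk⟩ := ih (v+1) (by omega) (u+1) (by
        zify at *
        have a1 : (u:ℤ)+1 = 3*x-4*y := by linarith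
        have a2 : (v:ℤ)+1 = 3*y-2*x := by linarith
        rw [a1, a2]; nlinarith)
      refine ⟨k+1, ?_⟩
      rw [pellF_succ, hk]
      ext <;> simp only <;> omega

lemma pell_fourth (x q : ℕ) (hq : 2 ≤ q) (h : x^2+1 = 2*(q^4)^2) : 10^75 ≤ x := by
  have hy : 10^75 ≤ q^4 := by
    obtain ⟨k, hk⟩ := pell_enum (q^4) x h
    rcases Nat.lt_or_ge k 100 with h1 | h1
    · exfalso
      rcases pellF_check.1 k h1 with rfl | h2
      · have : 1 = q^4 := congrArg Prod.snd hk
        have : 2^4 ≤ q^4 := Nat.pow_le_pow_left hq 4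
        omega
      · rw [hk] at h2
        simp only at h2
        have a1 := lt_of_pow_lt_pow_left₀ 4 (Nat.zero_le _) h2.1
        have a2 := lt_of_pow_lt_pow_left₀ 4 (Nat.zero_le _) h2.2
        omega
    · have := pellF_mono h1
      simp only [hk] at this
      exact pellF_check.2.trans this
  generalize q^4 = y at *
  have : y ≤ x := by nlinarith
  omega

def gBad (z : GaussianInt) : Prop := (z.re + z.im)^2 = 1 ∨ (z.re - z.im)^2 = 1

lemma gBad_I (z : GaussianInt) (h : gBad z) : gBad (⟨0,1⟩ * z) := by
  unfold gBad at *
  simp only [Zsqrtd.re_mul, Zsqrtd.im_mul]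
  rcases h with h | h
  · right; linear_combination h
  · left; linear_combination h

lemma gBad_neg (z : GaussianInt) (h : gBad z) : gBad (-z) := by
  unfold gBad at *
  simp only [Zsqrtd.re_neg, Zsqrtd.im_neg]
  rcases h with h | h
  · left; linear_combination h
  · right; linear_combination h

lemma gBad_star (z : GaussianInt) (h : gBad z) : gBad (star z) := by
  unfold gBad at *
  simp only [Zsqrtd.re_star, Zsqrtd.im_star]
  rcases h with h | h
  · right; linear_combination h
  · left; linear_combination h

lemma gBad_Ipow (k : ℕ) (z : GaussianInt) (h : gBad z) : gBad (⟨0,1⟩^k * z) := by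
  induction k with
  | zero => simpa using h
  | succ k ih => rw [pow_succ', mul_assoc]; exact gBad_I _ ih

lemma binom3 {R : Type*} [CommRing R] (t : R) (N : ℕ) :
    ∃ z C : R, 2*C = N*(N-1) ∧ C = (N.choose 2 : ℕ) ∧ (1+t)^N = 1 + N*t + C*t^2 + t^3*z := by
  induction N with
  | zero => exact ⟨0, 0, by simp, by simp, by simp⟩
  | succ N ih =>
    obtain ⟨z, C, h1, hc, h2⟩ := ih
    refine ⟨C + z + t*z, C + N, ?_, ?_, ?_⟩
    · push_cast; linear_combination h1
    · rw [hc, Nat.choose_succ_succ N 1]; push_cast; simp; ring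
    · rw [pow_succ, h2]; push_cast; ring

lemma two_choose (N : ℕ) : 2 * ((N.choose 2 : ℕ) : ℤ) = N*(N-1) := by
  obtain ⟨z, C, h1, h2, -⟩ := binom3 (0:ℤ) N
  rw [← h2, h1]

abbrev lam : GaussianInt := ⟨1,1⟩

lemma lam_pow3 : lam^3 = 2 * ⟨-1,1⟩ := by decide
lemma lam_pow2 : lam^2 = 2 * ⟨0,1⟩ := by decide

lemma lte2 (c : ℤ) (hc : Even c) (h a : ℕ) :
    ∃ w : GaussianInt, (1 + (c:GaussianInt)*lam)^(2^(a+1)*h) =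
      1 + (2^(a+1)*h : ℕ)*((c:GaussianInt)*lam) + (((2^(a+1)*h).choose 2 : ℕ):GaussianInt)*(c*lam)^2 + 2^(a+2)*c^2*w := by
  obtain ⟨e, he⟩ := hc
  have hce : (c:GaussianInt) = 2*e := by rw [he]; push_cast; ring
  induction a with
  | zero =>
    obtain ⟨z, C, h1, hC, h2⟩ := binom3 ((c:GaussianInt)*lam) (2*h)
    refine ⟨e*⟨-1,1⟩*z, ?_⟩
    rw [show 2^(0+1)*h = 2*h by ring, h2, hC]
    have : (c*lam)^3 = 4*c^2*(e*⟨-1,1⟩:GaussianInt) := by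
      rw [mul_pow, lam_pow3]; linear_combination (2*⟨-1,1⟩*c^2:GaussianInt) * hce
    rw [this]; ring
  | succ a ih =>
    obtain ⟨w, hw⟩ := ih
    set N := 2^(a+1)*h with hN
    have hN2 : 2^(a+1+1)*h = 2*N := by rw [hN]; ring
    rw [hN2, pow_mul', hw]
    have c1 : (((2*N).choose 2 : ℕ) : GaussianInt) = N^2 + 2*(N.choose 2 : ℕ) := by
      have a1 := two_choose (2*N)
      have a2 := two_choose N
      have : (((2*N).choose 2 : ℕ) : ℤ) = N^2 + 2*(N.choose 2 : ℕ) := by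
        push_cast at a1; linarith
      exact_mod_cast congrArg (Int.cast : ℤ → GaussianInt) this
    have hNc : (N:GaussianInt) = 2^(a+1)*h := by rw [hN]; push_cast; ring
    have c2 : ((N.choose 2 : ℕ) : GaussianInt) = 2^a*h*(N-1) := by
      have a2 := two_choose N
      have : ((N.choose 2 : ℕ):ℤ) = 2^a*h*(N-1) := by
        have : (N:ℤ) = 2*(2^a*h) := by rw [hN]; push_cast; ring
        nlinarith
      exact_mod_cast congrArg (Int.cast : ℤ → GaussianInt) this
    set C := ((N.choose 2 : ℕ) : GaussianInt) with hC
    rw [c1]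
    push_cast
    set q : GaussianInt := 2^a with hq
    have p1 : (2:GaussianInt)^(a+1) = 2*q := by rw [hq]; ring
    have p2 : (2:GaussianInt)^(a+2) = 4*q := by rw [hq]; ring
    have p3 : (2:GaussianInt)^(a+1+2) = 8*q := by rw [hq]; ring
    rw [p1] at hNc
    rw [p2, p3]
    -- u = N t + C t^2 + 4 q c^2 w
    set t := (c:GaussianInt)*lam with ht
    have l4 : lam^4 = -4 := by decide
    refine ⟨w + h*C*e*lam^3 - 2*q*h^2*(N-1)^2*e^2 + w*(N*t+C*t^2) + 2*q*c^2*w^2, ?_⟩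
    rw [ht]
    linear_combination (2*C*c^3*lam^3)*hNc + (4*q*h*C*c^2*lam^3)*hce + c^4*lam^4*(C+q*h*(N-1))*c2
      + q^2*h^2*(N-1)^2*lam^4*c^2*(c+2*e)*hce + (4*q^2*h^2*(N-1)^2*e^2*c^2)*l4

lemma sq_one_cases (a : ℤ) (h : a^2 = 1) : a = 1 ∨ a = -1 := by
  rcases mul_eq_zero.1 (show (a-1)*(a+1) = 0 by linear_combination h) with h | h <;> omega

lemma gBad_E (c : ℤ) (hc : Even c) (hc0 : c ≠ 0) (m : ℕ) (hm : Odd m) (hm3 : 3 ≤ m) :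
    ¬ gBad ((1 + (c:GaussianInt)*lam)^m) := by
  have hc' := hc
  obtain ⟨e, he⟩ := hc
  have he2 : c = 2*e := by linarith
  obtain ⟨z, C, -, hC, hz⟩ := binom3 ((c:GaussianInt)*lam) m
  have hmc := two_choose m
  obtain ⟨K, hK⟩ : ∃ K : ℤ, K = ((m.choose 2 : ℕ) : ℤ) := ⟨_, rfl⟩
  rw [← hK] at hmc
  have hCK : C = (K:GaussianInt) := by rw [hC, hK]; simp
  have e1 : (1 + (c:GaussianInt)*lam)^m = 1 + ((m*c:ℤ):GaussianInt)*⟨1,1⟩ + ((2*K*c^2:ℤ):GaussianInt)*⟨0,1⟩ + ((2*c^3:ℤ):GaussianInt)*(⟨-1,1⟩*z) := by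
    rw [hz, mul_pow, mul_pow, lam_pow3, lam_pow2, hCK]; push_cast; ring
  obtain ⟨y, hy⟩ : ∃ y, y = (⟨-1,1⟩:GaussianInt)*z := ⟨_, rfl⟩
  rw [← hy] at e1
  have hX : ((1 + (c:GaussianInt)*lam)^m).re = 1 + m*c + 2*c^3*y.re := by
    rw [e1]; simp only [Zsqrtd.re_add, Zsqrtd.re_mul, Zsqrtd.re_intCast, Zsqrtd.im_intCast, Zsqrtd.re_one]; ring
  have hY : ((1 + (c:GaussianInt)*lam)^m).im = m*c + 2*K*c^2 + 2*c^3*y.im := by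
    rw [e1]; simp only [Zsqrtd.im_add, Zsqrtd.im_mul, Zsqrtd.re_intCast, Zsqrtd.im_intCast, Zsqrtd.im_one]; ring
  have hm' := hm
  obtain ⟨j, hj⟩ := hm
  have hmz : (m:ℤ) = 2*j+1 := by rw [hj]; push_cast; ring
  have hKz : K = (2*j+1)*j := by rw [hmz] at hmc; nlinarith
  rintro (h | h)
  · rw [hX, hY] at h
    rcases sq_one_cases _ h with h | h
    · have h1 : c*(2*(m + K*c + c^2*(y.re+y.im))) = 0 := by linear_combination h
      have h2 : m + K*c + c^2*(y.re+y.im) = 0 := by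
        have := (mul_eq_zero.1 h1).resolve_left hc0
        linarith
      rw [he2, hmz] at h2
      have : 2 * (-j - K*e - 2*e^2*(y.re+y.im)) = 1 := by linear_combination -h2
      omega
    · rw [he2] at h
      have : 4*(m*e + 2*K*e^2 + 4*e^3*(y.re+y.im)) = -2 := by linear_combination h
      omega
  · rcases sq_one_cases _ h with h | h
    · clear hX hY e1 hz hK hKz hmc hy y hCK hC
      obtain ⟨a', q, hq, hmq⟩ := Nat.exists_eq_two_pow_mul_odd (show m-1 ≠ 0 by omega)
      rcases a' with _ | a
      · obtain ⟨q', hq'⟩ := hq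
        simp at hmq; omega
      obtain ⟨w, hw⟩ := lte2 c hc' q a
      have hK := two_choose (2^(a+1)*q)
      obtain ⟨K', hK'⟩ : ∃ K' : ℤ, K' = (((2^(a+1)*q).choose 2 : ℕ) : ℤ) := ⟨_, rfl⟩
      rw [← hK'] at hK
      rw [← hmq] at hw hK hK'
      obtain ⟨N, hN⟩ : ∃ N : ℤ, N = ((m-1 : ℕ):ℤ) := ⟨_, rfl⟩
      have hNq : N = 2^(a+1)*q := by rw [hN, hmq]; push_cast; ring
      have hE : (1 + (c:GaussianInt)*lam)^m = 1 + ((c*(1+N) : ℤ):GaussianInt)*⟨1,1⟩ + ((2*c^2*(N+K') : ℤ):GaussianInt)*⟨0,1⟩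
         + ((2*c^3*K':ℤ):GaussianInt)*⟨-1,1⟩ + ((2^(a+2)*c^2 : ℤ):GaussianInt)*((1 + (c:GaussianInt)*lam)*w) := by
        rw [show m = (m-1)+1 by omega, pow_succ, hw]
        have k1 : (((m-1).choose 2 : ℕ) : GaussianInt) = (K':GaussianInt) := by rw [hK']; simp
        have k2 : ((m-1 : ℕ) : GaussianInt) = (N:GaussianInt) := by rw [hN]; simp
        have l2 := lam_pow2
        have l3 := lam_pow3
        rw [k1, k2]
        push_cast
        linear_combination (c^2*(N+K'):GaussianInt)*l2 + (c^3*K':GaussianInt)*l3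
      obtain ⟨y, hy⟩ : ∃ y, y = (1 + (c:GaussianInt)*lam)*w := ⟨_, rfl⟩
      rw [← hy] at hE
      rw [hE] at h
      simp only [Zsqrtd.re_add, Zsqrtd.re_mul, Zsqrtd.re_intCast, Zsqrtd.im_intCast, Zsqrtd.re_one, Zsqrtd.im_add, Zsqrtd.im_mul, Zsqrtd.im_one] at h
      rw [← hN] at hK
      have h1 : (c^2*2^(a+1))*(2*q + q*(N-1)*(1+2*c) - 2*(y.re-y.im)) = 0 := by
        linear_combination -h + (-(c^2)*(1+2*c))*hK - (2*c^2 + c^2*(1+2*c)*(N-1))*hNq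
      have h2 := (mul_eq_zero.1 h1).resolve_left (by positivity)
      obtain ⟨q', hq'⟩ := hq
      have hqz : (q:ℤ) = 2*q'+1 := by rw [hq']; push_cast; ring
      have hNz : N = 2*(2^a*q) := by rw [hNq]; ring
      rw [hNz, hqz] at h2
      have h3 : (2*q'+1) * (2*(2^a*(2*q'+1)) - 1) * (1+2*c) = 2*((y.re-y.im) - (2*q'+1)) := by linear_combination h2
      have h4 : Odd ((2*(q':ℤ)+1) * (2*(2^a*(2*q'+1)) - 1) * (1+2*c)) := by
        apply Odd.mul
        · apply Odd.mul
          · exact ⟨q', rfl⟩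
          · exact ⟨2^a*(2*q'+1)-1, by ring⟩
        · exact ⟨c, by ring⟩
      rw [h3] at h4
      exact (Int.not_even_iff_odd.2 h4) (even_two_mul _)
    · rw [hX, hY, he2] at h
      have : 4*(-2*K*e^2 + 4*e^3*(y.re-y.im)) = -2 := by linear_combination h
      omega

lemma gBad_pow (W : GaussianInt) (m : ℕ) (hm : Odd m) (hm3 : 3 ≤ m) (h1 : gBad W) (h2 : gBad (W^m)) :
    W.norm = 1 := by
  -- case A - B = 1, B even
  have s1 : ∀ W : GaussianInt, W.re - W.im = 1 → Even W.im → gBad (W^m) → W.norm = 1 := by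
    intro W h he hb
    have e : W = 1 + (W.im:GaussianInt)*lam := by
      apply Zsqrtd.ext
      · simp; linarith
      · simp
    by_cases h0 : W.im = 0
    · have : W.re = 1 := by linarith
      simp [Zsqrtd.norm_def, h0, this]
    · rw [e] at hb
      exact absurd hb (gBad_E _ he h0 m hm hm3)
  have s2 : ∀ W : GaussianInt, (W.re - W.im)^2 = 1 → Even W.im → gBad (W^m) → W.norm = 1 := by
    intro W h he hb
    rcases sq_one_cases _ h with h | h
    · exact s1 W h he hb
    · have := s1 (-W) (by simp; linarith) (by simpa using he) (by rw [hm.neg_pow]; exact gBad_neg _ hb)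
      rwa [Zsqrtd.norm_neg] at this
  have s3 : ∀ W : GaussianInt, gBad W → Even W.im → gBad (W^m) → W.norm = 1 := by
    intro W h he hb
    rcases h with h | h
    · have := s2 (star W) (by simpa using h) (by simpa using he) (by rw [← star_pow]; exact gBad_star _ hb)
      rwa [Zsqrtd.norm_conj] at this
    · exact s2 W h he hb
  rcases Int.even_or_odd W.im with he | ho
  · exact s3 W h1 he h2
  · have := s3 (⟨0,1⟩*W) (gBad_I _ h1) (by
      have hr : Even W.re := by
        rcases h1 with h | h
        · rcases sq_one_cases _ h with h | h <;> rcases ho with ⟨k, hk⟩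
          · exact ⟨-k, by linarith⟩
          · exact ⟨-k-1, by linarith⟩
        · rcases sq_one_cases _ h with h | h <;> rcases ho with ⟨k, hk⟩
          · exact ⟨k+1, by linarith⟩
          · exact ⟨k, by linarith⟩
      simpa using hr) (by rw [mul_pow]; exact gBad_Ipow _ _ h2)
    rw [Zsqrtd.norm_mul] at this
    simpa [Zsqrtd.norm_def] using this

lemma gBad_of_pow (W : GaussianInt) (m : ℕ) (hm : Odd m) (h : (W^m).re + (W^m).im = 1) : gBad W := by
  have key : W^m + ⟨0,1⟩ * (star W)^m = ⟨1,1⟩ := by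
    rw [← star_pow]
    generalize W^m = Y at h
    apply Zsqrtd.ext
    · simp; linarith
    · simp; linarith
  have hu : ∀ d : ℤ, ∀ v : GaussianInt, v.norm = 2 → (d:GaussianInt)*v ∣ ⟨1,1⟩ → d^2 = 1 := by
    rintro d v hv ⟨q, hq⟩
    have := congrArg Zsqrtd.norm hq
    rw [Zsqrtd.norm_mul, Zsqrtd.norm_mul, hv, Zsqrtd.norm_intCast] at this
    have h2 : (d*d)*q.norm = 1 := by
      have e : Zsqrtd.norm (⟨1,1⟩:GaussianInt) = 2 := by decide
      rw [e] at this; linarith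
    have := Int.eq_one_or_neg_one_of_mul_eq_one h2
    rcases this with h3 | h3
    · rw [sq]; exact h3
    · nlinarith
  rcases Nat.odd_mod_four_iff.1 (Nat.odd_iff.1 hm) with h4 | h4
  · left
    have hi : (⟨0,1⟩:GaussianInt)^m = ⟨0,1⟩ := by
      rw [← Nat.div_add_mod m 4, h4, pow_add, pow_mul, show (⟨0,1⟩:GaussianInt)^4 = 1 by decide]; simp
    have hd : W + ⟨0,1⟩*star W ∣ W^m + (⟨0,1⟩*star W)^m := hm.add_dvd_pow_add_pow _ _
    rw [mul_pow, hi, key] at hd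
    apply hu (W.re+W.im) ⟨1,1⟩ (by decide)
    convert hd using 1
    apply Zsqrtd.ext <;> simp
    ring
  · right
    have hi : (⟨0,-1⟩:GaussianInt)^m = ⟨0,1⟩ := by
      rw [← Nat.div_add_mod m 4, h4, pow_add, pow_mul, show (⟨0,-1⟩:GaussianInt)^4 = 1 by decide]
      simp; decide
    have hd : W + ⟨0,-1⟩*star W ∣ W^m + (⟨0,-1⟩*star W)^m := hm.add_dvd_pow_add_pow _ _
    rw [mul_pow, hi, key] at hd
    apply hu (W.re-W.im) ⟨1,-1⟩ (by decide)
    convert hd using 1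
    apply Zsqrtd.ext <;> simp <;> ring

lemma stormer (W : GaussianInt) (m : ℕ) (hm : Odd m) (hm3 : 3 ≤ m) (h : (W^m).re + (W^m).im = 1) : W.norm = 1 :=
  gBad_pow W m hm hm3 (gBad_of_pow W m hm h) (Or.inl (by rw [h]; norm_num))

lemma gauss_unit_cases (u : GaussianInt) (h : IsUnit u) : u = 1 ∨ u = -1 ∨ u = ⟨0,1⟩ ∨ u = ⟨0,-1⟩ := by
  rw [← Zsqrtd.norm_eq_one_iff' (by norm_num)] at h
  rw [Zsqrtd.norm_def] at h
  have h1 : u.re ≤ 1 := by nlinarith [sq_nonneg u.im]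
  have h2 : -1 ≤ u.re := by nlinarith [sq_nonneg u.im]
  have h3 : u.im ≤ 1 := by nlinarith [sq_nonneg u.re]
  have h4 : -1 ≤ u.im := by nlinarith [sq_nonneg u.re]
  rcases u with ⟨a, b⟩
  simp only at h h1 h2 h3 h4
  interval_cases a <;> interval_cases b <;> simp_all
  · exact Or.inr rfl
  · left; rfl

lemma gamma_pow (p n k j : ℕ) (h : (p^j)^k = 8*n^2+4*n+1) :
    ∃ (W : GaussianInt) (u : GaussianIntˣ), W^k * u = (⟨2*n+1, -(2*n)⟩ : GaussianInt) := by
  set g : GaussianInt := ⟨2*n+1, -(2*n)⟩ with hg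
  have hs : g * star g = 8*n^2+4*n+1 := by
    have : (8*n^2+4*n+1 : GaussianInt) = ((8*n^2+4*n+1 : ℤ) : GaussianInt) := by push_cast; ring
    rw [this]
    apply Zsqrtd.ext
    · simp only [hg, Zsqrtd.re_mul, Zsqrtd.re_star, Zsqrtd.im_star, Zsqrtd.re_intCast]; ring
    · simp only [hg, Zsqrtd.im_mul, Zsqrtd.re_star, Zsqrtd.im_star, Zsqrtd.im_intCast]; ring
  have ha : g + star g = 4*n+2 := by
    have : (4*n+2 : GaussianInt) = ((4*n+2 : ℤ) : GaussianInt) := by push_cast; ring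
    rw [this]
    apply Zsqrtd.ext
    · simp only [hg, Zsqrtd.re_add, Zsqrtd.re_star, Zsqrtd.re_intCast]; ring
    · simp only [hg, Zsqrtd.im_add, Zsqrtd.im_star, Zsqrtd.im_intCast]; ring
  have hc : IsCoprime g (star g) := ⟨star g - 2*n, -(2*n), by linear_combination hs - 2*n*ha⟩
  have hm : g * star g = ((p^j : ℕ) : GaussianInt)^k := by
    rw [hs]; exact_mod_cast h.symm
  obtain ⟨W, u, hu⟩ := exists_associated_pow_of_mul_eq_pow' hc hm
  exact ⟨W, u, hu⟩

lemma no_odd (p n m j : ℕ) (hp : 2 ≤ p) (hj : 1 ≤ j) (hm : Odd m) (hm3 : 3 ≤ m) (h : (p^j)^m = 8*n^2+4*n+1) : False := by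
  obtain ⟨W, u, hW⟩ := gamma_pow p n m j h
  have hu : (u:GaussianInt)^(m*m) = u := by
    have h4 : (u:GaussianInt)^4 = 1 := by
      rcases gauss_unit_cases _ u.isUnit with h | h | h | h <;> rw [h] <;> decide
    have : m*m % 4 = 1 := by
      rcases Nat.odd_mod_four_iff.1 (Nat.odd_iff.1 hm) with h | h <;> simp [Nat.mul_mod, h]
    rw [← Nat.div_add_mod (m*m) 4, this, pow_add, pow_mul, h4]; simp
  have hW2 : (W*(u:GaussianInt)^m)^m = ⟨2*n+1, -(2*n)⟩ := by
    rw [mul_pow, ← pow_mul, hu, hW]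
  have h1 := stormer (W*(u:GaussianInt)^m) m hm hm3 (by rw [hW2]; ring)
  have h2 := congrArg Zsqrtd.norm hW2
  have h3 : Zsqrtd.norm ((W*(u:GaussianInt)^m)^m) = (Zsqrtd.norm (W*(u:GaussianInt)^m))^m := map_pow Zsqrtd.normMonoidHom _ _
  rw [h3, h1, one_pow, Zsqrtd.norm_def] at h2
  simp only at h2
  have h5 : n = 0 := by
    have : (n:ℤ) * (8*n+4) = 0 := by linarith
    rcases mul_eq_zero.1 this with h | h
    · exact_mod_cast h
    · omega
  subst h5
  have : 1 < (p^j)^m := Nat.one_lt_pow (by omega) (Nat.one_lt_pow (by omega) (by omega))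
  omega

lemma no_eight (p n j : ℕ) (hp : 2 ≤ p) (hj : 1 ≤ j) (h : p^(8*j) = 8*n^2+4*n+1) : False := by
  have h' : (p^(2*j))^4 = 8*n^2+4*n+1 := by rw [← h, ← pow_mul]; ring_nf
  obtain ⟨V, u, hV⟩ := gamma_pow p n 4 (2*j) h'
  have hx := pell_fourth (4*n+1) (p^j) (by
    calc 2 ≤ p := hp
      _ ≤ p^j := Nat.le_self_pow (by omega) p) (by
    have : ((p^j)^4)^2 = p^(8*j) := by rw [← pow_mul, ← pow_mul]; ring_nf
    rw [this, h]; ring)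
  have re4 : (V^4).re = V.re^4 - 6*V.re^2*V.im^2 + V.im^4 := by
    simp only [pow_succ, pow_zero, one_mul, Zsqrtd.re_mul, Zsqrtd.im_mul]; ring
  have im4 : (V^4).im = 4*(V.re*V.im*(V.re^2-V.im^2)) := by
    simp only [pow_succ, pow_zero, one_mul, Zsqrtd.re_mul, Zsqrtd.im_mul]; ring
  have hmod : (V.re^4 - 6*V.re^2*V.im^2 + V.im^4) % 4 ≠ 3 := by
    have aux : ∀ a b : ZMod 4, a^4 - 6*a^2*b^2+b^4 ≠ 3 := by decide
    intro hc
    apply aux V.re V.im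
    have := (ZMod.intCast_eq_intCast_iff' (V.re^4 - 6*V.re^2*V.im^2 + V.im^4) 3 4).2 (by simpa using hc)
    exact_mod_cast this
  have hV4 : V^4 = ⟨2*n+1, -(2*n)⟩ := by
    rcases gauss_unit_cases _ u.isUnit with hu | hu | hu | hu <;> rw [hu] at hV
    · rwa [mul_one] at hV
    · exfalso
      have r := congrArg Zsqrtd.re hV
      have i := congrArg Zsqrtd.im hV
      simp only [mul_neg, mul_one, Zsqrtd.re_neg, Zsqrtd.im_neg, re4, im4] at r i
      generalize V.re*V.im*(V.re^2-V.im^2) = s at i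
      generalize V.re^4 - 6*V.re^2*V.im^2 + V.im^4 = t at *
      omega
    · exfalso
      have r := congrArg Zsqrtd.re hV
      simp only [Zsqrtd.re_mul, im4] at r
      generalize V.re*V.im*(V.re^2-V.im^2) = s at r
      omega
    · exfalso
      have r := congrArg Zsqrtd.re hV
      simp only [Zsqrtd.re_mul, im4] at r
      generalize V.re*V.im*(V.re^2-V.im^2) = s at r
      omega
  refine ljung_core V (4*n+1) (by exact_mod_cast hx) ?_
  rw [hV4]
  apply Zsqrtd.ext
  · simp only [Zsqrtd.re_mul]; ring
  · simp only [Zsqrtd.im_mul]; ring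

lemma r_le_five (p n r : ℕ) (hp : 2 ≤ p) (h : p^r = 8*n^2+4*n+1) : r ≤ 5 := by
  by_contra hr
  push Not at hr
  obtain ⟨k, m, hm, hrm⟩ := Nat.exists_eq_two_pow_mul_odd (show r ≠ 0 by omega)
  rcases Nat.lt_or_ge m 3 with h3 | h3
  · have : m = 1 := by rcases hm with ⟨q, hq⟩; omega
    subst this
    rcases Nat.lt_or_ge k 3 with hk | hk
    · interval_cases k <;> omega
    · obtain ⟨l, rfl⟩ := Nat.exists_eq_add_of_le hk
      apply no_eight p n (2^l) hp Nat.one_le_two_pow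
      rw [← h, hrm]; congr 1; ring
  · apply no_odd p n m (2^k) hp Nat.one_le_two_pow hm h3
    rw [← h, hrm, pow_mul]

lemma poly_pow_coeff (P : Polynomial ℤ) (h0 : P.coeff 0 = 1) (h1 : P.coeff 1 = 4) (h2 : P.coeff 2 = 8) (n : ℕ) :
    (P^n).coeff 0 = 1 ∧ (P^n).coeff 1 = 4*n ∧ (P^n).coeff 2 = 8*n^2 := by
  induction n with
  | zero => simp [Polynomial.coeff_one]
  | succ n ih =>
    obtain ⟨a0, a1, a2⟩ := ih
    rw [pow_succ]
    refine ⟨?_, ?_, ?_⟩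
    · simp [Polynomial.coeff_mul, a0, h0]
    · simp [Polynomial.coeff_mul, Finset.Nat.antidiagonal_succ, a0, h0, a1, h1]; ring
    · simp [Polynomial.coeff_mul, Finset.Nat.antidiagonal_succ, a0, h0, a1, h1, a2, h2]; ring

lemma count_ball {α : Type*} [Fintype α] (w : α → ℕ)
    (h0 : (Finset.univ.filter (fun a => w a = 0)).card = 1)
    (h1 : (Finset.univ.filter (fun a => w a = 1)).card = 4)
    (h2 : (Finset.univ.filter (fun a => w a = 2)).card = 8) (n : ℕ) :
    (Finset.univ.filter (fun v : Fin n → α => ∑ i, w (v i) ≤ 2)).card = 8*n^2+4*n+1 := by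
  set P : Polynomial ℤ := ∑ a, Polynomial.X ^ (w a) with hP
  have hc : ∀ k, P.coeff k = ((Finset.univ.filter (fun a => w a = k)).card : ℤ) := by
    intro k
    rw [hP, Polynomial.finsetSum_coeff]
    simp only [Polynomial.coeff_X_pow, eq_comm (a := k)]
    rw [Finset.sum_boole]
  have hc2 : ∀ k, (P^n).coeff k = ((Finset.univ.filter (fun v : Fin n → α => ∑ i, w (v i) = k)).card : ℤ) := by
    intro k
    rw [hP, Fintype.sum_pow, Polynomial.finsetSum_coeff]
    simp only [Finset.prod_pow_eq_pow_sum, Polynomial.coeff_X_pow, eq_comm (a := k)]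
    rw [Finset.sum_boole]
  obtain ⟨b0, b1, b2⟩ := poly_pow_coeff P (by rw [hc, h0]; rfl) (by rw [hc, h1]; rfl) (by rw [hc, h2]; rfl) n
  rw [hc2] at b0 b1 b2
  have e : (Finset.univ.filter (fun v : Fin n → α => ∑ i, w (v i) ≤ 2)) =
     ((Finset.univ.filter (fun v : Fin n → α => ∑ i, w (v i) = 0)) ∪ (Finset.univ.filter (fun v : Fin n → α => ∑ i, w (v i) = 1)))
      ∪ (Finset.univ.filter (fun v : Fin n → α => ∑ i, w (v i) = 2)) := by
    ext v; simp only [Finset.mem_filter, Finset.mem_univ, true_and, Finset.mem_union]; omega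
  rw [e, Finset.card_union_of_disjoint, Finset.card_union_of_disjoint]
  · have c0 : (Finset.univ.filter (fun v : Fin n → α => ∑ i, w (v i) = 0)).card = 1 := Nat.cast_injective (R := ℤ) (b0.trans (by norm_num))
    have c1 : (Finset.univ.filter (fun v : Fin n → α => ∑ i, w (v i) = 1)).card = 4*n := Nat.cast_injective (R := ℤ) (b1.trans (by push_cast; ring))
    have c2 : (Finset.univ.filter (fun v : Fin n → α => ∑ i, w (v i) = 2)).card = 8*n^2 := Nat.cast_injective (R := ℤ) (b2.trans (by push_cast; ring))
    rw [c0, c1, c2]; ring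
  · rw [Finset.disjoint_filter]; intro v _ _; omega
  · rw [← Finset.filter_or, Finset.disjoint_filter]; intro v _ _; omega

def l1 (z : GaussianInt) : ℕ := z.re.natAbs + z.im.natAbs

lemma l1_ideal (a b : ℕ) (hab5 : 5 ≤ a + b) (q : GaussianInt) (hq : q ≠ 0) :
    5 ≤ l1 ((⟨a,b⟩:GaussianInt) * q) := by
  by_cases hu : IsUnit q
  · rcases gauss_unit_cases q hu with rfl | rfl | rfl | rfl <;> simp [l1] <;> omega
  · have hN : 2 ≤ q.re^2 + q.im^2 := by
      by_contra h
      apply hu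
      rw [← Zsqrtd.norm_eq_one_iff' (by norm_num), Zsqrtd.norm_def]
      have : q.re^2+q.im^2 ≠ 0 := by
        intro h0
        apply hq
        apply Zsqrtd.ext
        · simp; nlinarith [sq_nonneg q.re, sq_nonneg q.im]
        · simp; nlinarith [sq_nonneg q.re, sq_nonneg q.im]
      have : 0 ≤ q.re^2+q.im^2 := by positivity
      have : q.re^2+q.im^2 = 1 := by omega
      linarith
    unfold l1
    simp only [Zsqrtd.re_mul, Zsqrtd.im_mul]
    zify
    set s := (a:ℤ)*q.re + -1*b*q.im
    set t := (a:ℤ)*q.im + b*q.re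
    have e : s^2+t^2 = ((a:ℤ)^2+b^2)*(q.re^2+q.im^2) := by simp only [s, t]; ring
    have h5 : (5:ℤ) ≤ a + b := by exact_mod_cast hab5
    have h2 : 25 ≤ (|s|+|t|)^2 := by
      have : (a:ℤ)^2+b^2 ≥ 0 := by positivity
      nlinarith [sq_abs s, sq_abs t, abs_nonneg s, abs_nonneg t, mul_nonneg (abs_nonneg s) (abs_nonneg t), sq_nonneg ((a:ℤ)-b)]
    nlinarith [abs_nonneg s, abs_nonneg t]

lemma l1_inj (a b : ℕ) (hab5 : 5 ≤ a + b) (z z' : GaussianInt) (h : gmk ⟨a,b⟩ z = gmk ⟨a,b⟩ z')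
    (h1 : l1 z ≤ 2) (h2 : l1 z' ≤ 2) : z = z' := by
  unfold gmk at h
  rw [Ideal.Quotient.eq, Ideal.mem_span_singleton] at h
  obtain ⟨q, hq⟩ := h
  by_contra hne
  have hq0 : q ≠ 0 := by
    rintro rfl
    rw [mul_zero] at hq
    exact hne (sub_eq_zero.1 hq)
  have := l1_ideal a b hab5 q hq0
  rw [← hq] at this
  unfold l1 at *
  simp only [Zsqrtd.re_sub, Zsqrtd.im_sub] at this
  omega

lemma mWt_spec (pi : GaussianInt) (α : GQuot pi) : ∃ z, gmk pi z = α ∧ l1 z = mWt pi α := by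
  have : (mWt pi α) ∈ { w : ℕ | ∃ z : GaussianInt, gmk pi z = α ∧ z.re.natAbs + z.im.natAbs = w } := by
    apply Nat.sInf_mem
    obtain ⟨z, hz⟩ := Ideal.Quotient.mk_surjective α
    exact ⟨_, z, hz, rfl⟩
  exact this

lemma mWt_le (pi z : GaussianInt) : mWt pi (gmk pi z) ≤ l1 z := Nat.sInf_le ⟨z, rfl, rfl⟩

lemma mWt_small (a b : ℕ) (hab5 : 5 ≤ a + b) (z : GaussianInt) (h : l1 z ≤ 2) : mWt ⟨a,b⟩ (gmk ⟨a,b⟩ z) = l1 z := by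
  obtain ⟨z', h1, h2⟩ := mWt_spec ⟨a,b⟩ (gmk ⟨a,b⟩ z)
  have := mWt_le ⟨a,b⟩ z
  rw [← h2, l1_inj a b hab5 z' z h1 (by omega) h]

def sph (k : ℕ) : Finset (ℤ × ℤ) :=
  (Finset.Icc (-2) 2 ×ˢ Finset.Icc (-2) 2).filter (fun z => z.1.natAbs + z.2.natAbs = k)

lemma card_wt (a b : ℕ) (hab5 : 5 ≤ a + b) [Fintype (GQuot ⟨a,b⟩)] (k : ℕ) (hk : k ≤ 2) :
    (Finset.univ.filter (fun α : GQuot ⟨a,b⟩ => mWt ⟨a,b⟩ α = k)).card = (sph k).card := by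
  symm
  apply Finset.card_bij (fun z _ => gmk ⟨a,b⟩ ⟨z.1, z.2⟩)
  · intro z hz
    simp only [sph, Finset.mem_filter] at hz
    simp only [Finset.mem_filter, Finset.mem_univ, true_and]
    rw [mWt_small a b hab5 _ (by show z.1.natAbs + z.2.natAbs ≤ 2; omega)]
    exact hz.2
  · intro z hz z' hz' h
    simp only [sph, Finset.mem_filter] at hz hz'
    have := l1_inj a b hab5 _ _ h (by show z.1.natAbs + z.2.natAbs ≤ 2; omega) (by show z'.1.natAbs + z'.2.natAbs ≤ 2; omega)
    rw [Zsqrtd.ext_iff] at this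
    exact Prod.ext this.1 this.2
  · intro α hα
    simp only [Finset.mem_filter, Finset.mem_univ, true_and] at hα
    obtain ⟨z, h1, h2⟩ := mWt_spec _ α
    refine ⟨(z.re, z.im), ?_, h1⟩
    unfold l1 at h2
    simp only [sph, Finset.mem_filter, Finset.mem_product, Finset.mem_Icc]
    omega

lemma sph_card : (sph 0).card = 1 ∧ (sph 1).card = 4 ∧ (sph 2).card = 8 := by
  unfold sph
  refine ⟨?_, ?_, ?_⟩ <;> decide +kernel

lemma ideal_max (a b : ℕ) (ha : 0 < a) (hab : a < b) (hp : Nat.Prime (a^2+b^2)) :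
    (Ideal.span {(⟨a,b⟩ : GaussianInt)}).IsMaximal ∧ Nat.card (GQuot ⟨a,b⟩) = a^2+b^2 := by
  have : Fact (Nat.Prime (a^2+b^2)) := ⟨hp⟩
  have hb0 : ((b:ℕ) : ZMod (a^2+b^2)) ≠ 0 := by
    rw [Ne, ZMod.natCast_eq_zero_iff]
    intro h
    have := Nat.le_of_dvd (by omega) h
    nlinarith
  have hsum : ((a:ℕ) : ZMod (a^2+b^2))^2 + ((b:ℕ) : ZMod (a^2+b^2))^2 = 0 := by
    exact_mod_cast ZMod.natCast_self (a^2+b^2)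
  set s : ZMod (a^2+b^2) := -((a:ℕ):ZMod (a^2+b^2)) / ((b:ℕ):ZMod (a^2+b^2)) with hs
  have hss : s*s = ((-1:ℤ) : ZMod (a^2+b^2)) := by
    rw [hs]; push_cast; field_simp; linear_combination hsum
  set f : GaussianInt →+* ZMod (a^2+b^2) := Zsqrtd.lift ⟨s, hss⟩ with hf
  have hfa : ∀ z : GaussianInt, f z = z.re + z.im * s := fun z => rfl
  have hsurj : Function.Surjective f := by
    intro y
    exact ⟨(⟨(y.val : ℤ), 0⟩ : GaussianInt), by rw [hfa]; simp⟩
  have hker : RingHom.ker f = Ideal.span {(⟨a,b⟩ : GaussianInt)} := by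
    apply le_antisymm
    · intro z hz
      rw [RingHom.mem_ker, hfa] at hz
      rw [Ideal.mem_span_singleton]
      have e1 : ((b:ZMod (a^2+b^2)) * z.re - a * z.im) = 0 := by
        rw [hs] at hz; field_simp at hz; linear_combination hz
      have e2 : ((a:ZMod (a^2+b^2)) * z.re + b * z.im) = 0 := by
        apply mul_left_cancel₀ hb0
        linear_combination a * e1 + z.im * hsum
      obtain ⟨u, hu⟩ := (ZMod.intCast_zmod_eq_zero_iff_dvd ((b:ℤ)*z.re - a*z.im) (a^2+b^2)).1 (by push_cast; exact e1)
      obtain ⟨v, hv⟩ := (ZMod.intCast_zmod_eq_zero_iff_dvd ((a:ℤ)*z.re + b*z.im) (a^2+b^2)).1 (by push_cast; exact e2)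
      push_cast at hu hv
      have hpos : ((a:ℤ)^2+b^2) ≠ 0 := by positivity
      refine ⟨⟨v, -u⟩, ?_⟩
      apply Zsqrtd.ext
      · simp only [Zsqrtd.re_mul]
        apply mul_left_cancel₀ hpos
        linear_combination b*hu + a*hv
      · simp only [Zsqrtd.im_mul]
        apply mul_left_cancel₀ hpos
        linear_combination -a*hu + b*hv
    · rw [Ideal.span_singleton_le_iff_mem, RingHom.mem_ker, hfa, hs]
      push_cast
      field_simp
      ring
  constructor
  · rw [← hker]; exact RingHom.ker_isMaximal_of_surjective f hsurj
  · unfold GQuot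
    rw [← hker, Nat.card_congr (RingHom.quotientKerEquivOfSurjective hsurj).toEquiv, Nat.card_zmod]

lemma perfect_card (a b : ℕ) (ha : 0 < a) (hab : a < b) (hab5 : 5 ≤ a + b)
    (hp : Nat.Prime (a ^ 2 + b ^ 2)) (n r : ℕ) (hrn : r ≤ n)
    (C : Submodule (GQuot ⟨a,b⟩) (Fin n → GQuot ⟨a,b⟩))
    (hdim : Module.finrank (GQuot ⟨a,b⟩) C = n - r)
    (hperfect : ∀ v : Fin n → GQuot ⟨a,b⟩, ∃! c : Fin n → GQuot ⟨a,b⟩,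
      c ∈ C ∧ mWtVec ⟨a,b⟩ (v - c) ≤ 2) :
    (a ^ 2 + b ^ 2) ^ r = 8 * n ^ 2 + 4 * n + 1 := by
  obtain ⟨hmax, hcard⟩ := ideal_max a b ha hab hp
  have hfin : Finite (GQuot ⟨a,b⟩) := Nat.finite_of_card_ne_zero (by rw [hcard]; positivity)
  let _ : Fintype (GQuot ⟨a,b⟩) := Fintype.ofFinite _
  have hC : Nat.card C = (a^2+b^2)^(n-r) := by
    let _ : Field (GQuot ⟨a,b⟩) := Ideal.Quotient.field _
    rw [← hdim, ← hcard]
    exact Module.natCard_eq_pow_finrank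
  let B : Set (Fin n → GQuot ⟨a,b⟩) := {v | mWtVec ⟨a,b⟩ v ≤ 2}
  have hB : Nat.card B = 8*n^2+4*n+1 := by
    rw [Nat.card_eq_fintype_card, Fintype.card_subtype]
    obtain ⟨s0, s1, s2⟩ := sph_card
    exact count_ball (mWt ⟨a,b⟩) (by rw [card_wt a b hab5 0 (by norm_num), s0]) (by rw [card_wt a b hab5 1 (by norm_num), s1])
      (by rw [card_wt a b hab5 2 (by norm_num), s2]) n
  have hbij : Function.Bijective (fun x : C × B => (x.1 : Fin n → GQuot ⟨a,b⟩) + x.2) := by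
    constructor
    · rintro ⟨⟨c, hc⟩, ⟨e, he⟩⟩ ⟨⟨c', hc'⟩, ⟨e', he'⟩⟩ h
      simp only at h
      obtain ⟨d, -, hd⟩ := hperfect (c+e)
      have h1 := hd c ⟨hc, by rw [add_sub_cancel_left]; exact he⟩
      have h2 := hd c' ⟨hc', by rw [h, add_sub_cancel_left]; exact he'⟩
      have h3 : c = c' := h1.trans h2.symm
      subst h3
      have h4 := add_left_cancel h
      subst h4
      rfl
    · intro v
      obtain ⟨c, ⟨hc, h⟩, -⟩ := hperfect v
      exact ⟨(⟨c, hc⟩, ⟨v - c, h⟩), by simp⟩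
  have hk := Nat.card_congr (Equiv.ofBijective _ hbij)
  rw [Nat.card_prod, hC, hB, Nat.card_fun, hcard, Nat.card_fin] at hk
  have e : (a^2+b^2)^n = (a^2+b^2)^(n-r) * (a^2+b^2)^r := by rw [← pow_add]; congr 1; omega
  rw [e] at hk
  exact (Nat.eq_of_mul_eq_mul_left (by positivity) hk).symm

/-- if `a + b ≥ 5` and `C` is a linear `[n, n-r]` code (with `1 ≤ r ≤ n`)
which is a 2-error-correcting perfect code for the Mannheim metric (every vector lies within
Mannheim distance 2 of exactly one codeword), then `p^r = 8n² + 4n + 1` and `r ≤ 5`. -/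
theorem stmt13 (a b : ℕ) (ha : 0 < a) (hab : a < b) (hgcd : Nat.gcd a b = 1)
    (hab5 : 5 ≤ a + b)
    (hp : Nat.Prime (a ^ 2 + b ^ 2)) (hmod : (a ^ 2 + b ^ 2) % 4 = 1)
    (pi : GaussianInt) (hpi : pi = (⟨(a : ℤ), (b : ℤ)⟩ : GaussianInt))
    (n r : ℕ) (hr1 : 1 ≤ r) (hrn : r ≤ n)
    (C : Submodule (GQuot pi) (Fin n → GQuot pi))
    (hdim : Module.finrank (GQuot pi) C = n - r)
    (hperfect : ∀ v : Fin n → GQuot pi, ∃! c : Fin n → GQuot pi,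
      c ∈ C ∧ mWtVec pi (v - c) ≤ 2) :
    (a ^ 2 + b ^ 2) ^ r = 8 * n ^ 2 + 4 * n + 1 ∧ r ≤ 5 := by
  subst hpi
  have h := perfect_card a b ha hab hab5 hp n r hrn C hdim hperfect
  exact ⟨h, r_le_five (a ^ 2 + b ^ 2) n r hp.two_le h⟩
end
end

section
/- There do not exist positive integers p and n such that p⁴ = 8n² + 4n + 1. -/
def pstep (v : ℕ × ℕ) : ℕ × ℕ := (3 * v.1 + 4 * v.2, 2 * v.1 + 3 * v.2)

lemma pell_desc : ∀ y x : ℕ, x ^ 2 + 1 = 2 * y ^ 2 → ∃ k : ℕ, pstep^[k] (1, 1) = (x, y) := by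
  intro y
  induction y using Nat.strong_induction_on with
  | _ y ih =>
    intro x h
    have hy0 : y ≠ 0 := by rintro rfl; simp at h
    rcases (by omega : y = 1 ∨ y = 2 ∨ 3 ≤ y) with rfl | rfl | hy
    · refine ⟨0, ?_⟩
      have : x = 1 := by nlinarith
      simp [this]
    · exfalso
      have h1 : x < 3 := by nlinarith
      interval_cases x <;> omega
    · have h1 : 4 * y ≤ 3 * x := by nlinarith
      have h2 : 2 * x < 3 * y := by nlinarith
      have h3 : y < x := by nlinarith
      obtain ⟨k, hk⟩ := ih (3 * y - 2 * x) (by omega) (3 * x - 4 * y) (by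
        zify [h1, h2.le] at h ⊢; linear_combination h)
      refine ⟨k + 1, ?_⟩
      rw [Function.iterate_succ_apply', hk]
      unfold pstep
      simp only [Prod.mk.injEq]
      omega

lemma pell_grow : ∀ k : ℕ, (pstep^[k] (1, 1)).2 ≤ (pstep^[k] (1, 1)).1 ∧ 5 ^ k ≤ (pstep^[k] (1, 1)).2 := by
  intro k
  induction k with
  | zero => simp
  | succ k ih =>
    rw [Function.iterate_succ_apply', pow_succ]
    unfold pstep at *
    simp only
    omega

lemma small_check : ∀ k < 63, k = 0 ∨ k = 3 ∨
    (Nat.sqrt (pstep^[k] (1, 1)).2) ^ 2 ≠ (pstep^[k] (1, 1)).2 := by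
  decide +kernel

lemma small_p (p n : ℕ) (hn : 0 < n) (h : p ^ 4 = 8 * n ^ 2 + 4 * n + 1) : 2 ^ 72 < p := by
  by_contra hp
  rw [not_lt] at hp
  obtain ⟨k, hk⟩ := pell_desc (p ^ 2) (4 * n + 1) (by nlinarith)
  have hg := (pell_grow k).2
  have hk63 : k < 63 := by
    by_contra hk'
    have h1 : 5 ^ 63 ≤ 5 ^ k := Nat.pow_le_pow_right (by norm_num) (by omega)
    rw [hk] at hg
    have h2 : p ^ 2 ≤ (2 ^ 72) ^ 2 := Nat.pow_le_pow_left hp 2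
    have := h1.trans (hg.trans h2)
    norm_num at this
  rcases small_check k hk63 with rfl | rfl | h1
  · simp at hk; omega
  · simp [pstep] at hk; omega
  · rw [hk] at h1
    apply h1
    simp [pow_two, Nat.sqrt_eq]

open Finset

def LA (r i : ℕ) : ℕ := ∏ l ∈ range i, (4 * (r - l) - 1)
def LB (r j : ℕ) : ℕ := ∏ l ∈ range j, (4 * (r - l) + 1)
def Lc (r i : ℕ) : ℕ :=
  (2 ^ i * LA r i / i.factorial) * (2 ^ (r - i) * LB r (r - i) / (r - i).factorial)

lemma odd_dvd_prod (m : ℕ) (hm : Odd m) (i : ℕ) (hd : m ∣ i.factorial) (a : ℤ) :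
    (m : ℤ) ∣ ∏ l ∈ range i, (a - 4 * l) := by
  have hc : IsCoprime (4 : ℤ) (m : ℤ) := by
    have h2 : Nat.Coprime 4 m := by
      have : Nat.Coprime 2 m := (Nat.coprime_two_left).2 hm
      exact Nat.Coprime.pow_left 2 this
    exact_mod_cast Nat.isCoprime_iff_coprime.2 h2
  obtain ⟨u, v, huv⟩ := hc
  have hm1 : (1 : ℤ) ≤ m := by have := hm.pos; exact_mod_cast this
  have hb0 : 0 ≤ a * u + m * (|a * u| + i) := by
    have h1 := neg_abs_le (a * u)
    have h3 : 0 ≤ |a * u| + (i : ℤ) := by positivity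
    nlinarith
  have hbi : (i : ℤ) ≤ a * u + m * (|a * u| + i) := by
    have h1 := neg_abs_le (a * u)
    have h3 : 0 ≤ |a * u| + (i : ℤ) := by positivity
    nlinarith
  obtain ⟨b, hb⟩ := Int.eq_ofNat_of_zero_le hb0
  have hab : ((a : ℤ) : ZMod m) = ((4 * b : ℤ) : ZMod m) := by
    rw [ZMod.intCast_eq_intCast_iff_dvd_sub, ← hb]
    refine ⟨4 * (|a * u| + i) - a * v, ?_⟩
    linear_combination a * huv
  rw [← ZMod.intCast_zmod_eq_zero_iff_dvd] at * 
  push_cast at hab ⊢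
  rw [hab]
  have : ∏ x ∈ range i, ((4 : ZMod m) * (b : ZMod m) - 4 * x) = 4 ^ i * (b.descFactorial i : ℕ) := by
    rw [Nat.descFactorial_eq_prod_range]
    push_cast
    have e : (4 : ZMod m) ^ i = ∏ _x ∈ range i, (4 : ZMod m) := by simp
    rw [e, ← Finset.prod_mul_distrib]
    refine Finset.prod_congr rfl fun x hx => ?_
    have hx' := Finset.mem_range.1 hx
    rw [Nat.cast_sub (by rw [hb] at hbi; have : i ≤ b := by exact_mod_cast hbi
                         omega)]
    ring
  rw [this]
  have h0 : ((b.descFactorial i : ℕ) : ZMod m) = 0 := by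
    rw [ZMod.natCast_eq_zero_iff]
    exact hd.trans (Nat.factorial_dvd_descFactorial _ _)
  rw [h0, mul_zero]

lemma fact_dvd_int (i : ℕ) (a : ℤ) :
    ((i.factorial : ℕ) : ℤ) ∣ 2 ^ i * ∏ l ∈ range i, (a - 4 * l) := by
  obtain ⟨k, m, hm, h⟩ := Nat.exists_eq_two_pow_mul_odd (Nat.factorial_ne_zero i)
  have hk : k ≤ i := by
    rcases Nat.eq_zero_or_pos i with h0 | h0
    · subst h0
      rcases Nat.eq_zero_or_pos k with h1 | h1
      · omega
      · exfalso
        have : 2 ∣ Nat.factorial 0 := by rw [h]; exact (dvd_pow_self 2 h1.ne').mul_right _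
        simp at this
    · have h1 := Nat.emultiplicity_two_factorial_lt h0.ne'
      have h2 : (k : ℕ∞) ≤ emultiplicity 2 (i.factorial) :=
        le_emultiplicity_of_pow_dvd (by rw [h]; exact dvd_mul_right _ _)
      exact_mod_cast (h2.trans h1.le)
  rw [h]
  push_cast
  exact mul_dvd_mul (pow_dvd_pow _ hk) (odd_dvd_prod m hm i (by rw [h]; exact dvd_mul_left _ _) a)

lemma LA_int (r i : ℕ) (h : i ≤ r) : (LA r i : ℤ) = ∏ l ∈ range i, ((4 * r - 1 : ℤ) - 4 * l) := by
  unfold LA; push_cast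
  refine Finset.prod_congr rfl fun x hx => ?_
  have hx' := Finset.mem_range.1 hx
  rw [Nat.cast_sub (by omega)]; push_cast [Nat.cast_sub (show x ≤ r by omega)]; ring

lemma LB_int (r i : ℕ) (h : i ≤ r) : (LB r i : ℤ) = ∏ l ∈ range i, ((4 * r + 1 : ℤ) - 4 * l) := by
  unfold LB; push_cast
  refine Finset.prod_congr rfl fun x hx => ?_
  have hx' := Finset.mem_range.1 hx
  push_cast [Nat.cast_sub (show x ≤ r by omega)]; ring

lemma LA_dvd (r i : ℕ) (h : i ≤ r) : i.factorial ∣ 2 ^ i * LA r i := by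
  have := fact_dvd_int i (4 * r - 1)
  rw [← LA_int r i h] at this
  exact_mod_cast this

lemma LB_dvd (r i : ℕ) (h : i ≤ r) : i.factorial ∣ 2 ^ i * LB r i := by
  have := fact_dvd_int i (4 * r + 1)
  rw [← LB_int r i h] at this
  exact_mod_cast this

lemma Lc_mul (r i : ℕ) (h : i ≤ r) :
    Lc r i * (i.factorial * (r - i).factorial) = 2 ^ r * (LA r i * LB r (r - i)) := by
  unfold Lc
  have h1 := Nat.div_mul_cancel (LA_dvd r i h)
  have h2 := Nat.div_mul_cancel (LB_dvd r (r - i) (by omega))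
  have h3 : 2 ^ r = 2 ^ i * 2 ^ (r - i) := by rw [← pow_add]; congr 1; omega
  calc _ = (2 ^ i * LA r i / i.factorial * i.factorial) *
      (2 ^ (r - i) * LB r (r - i) / (r - i).factorial * (r - i).factorial) := by ring
    _ = _ := by rw [h1, h2, h3]; ring

lemma LA_le (r i : ℕ) : LA r i ≤ 4 ^ i * r.descFactorial i := by
  unfold LA
  rw [Nat.descFactorial_eq_prod_range]
  have e : 4 ^ i = ∏ _x ∈ range i, 4 := by simp
  rw [e, ← Finset.prod_mul_distrib]
  exact Finset.prod_le_prod' fun x _ => by omega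

lemma LB_le (r i : ℕ) (h : i ≤ r) : LB r i ≤ 4 ^ i * (r + 1).descFactorial i := by
  unfold LB
  rw [Nat.descFactorial_eq_prod_range]
  have e : 4 ^ i = ∏ _x ∈ range i, 4 := by simp
  rw [e, ← Finset.prod_mul_distrib]
  refine Finset.prod_le_prod' fun x hx => ?_
  have hx' := Finset.mem_range.1 hx
  omega

lemma Lc_le (r i : ℕ) (h : i ≤ r) : Lc r i ≤ 8 ^ r * (r.choose i * (r + 1).choose (r - i)) := by
  have h1 := Lc_mul r i h
  have h2 := LA_le r i
  have h3 := LB_le r (r - i) (by omega)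
  rw [Nat.descFactorial_eq_factorial_mul_choose] at h2 h3
  have h4 : 4 ^ r = 4 ^ i * 4 ^ (r - i) := by rw [← pow_add]; congr 1; omega
  have h8 : 8 ^ r = 2 ^ r * (4 ^ i * 4 ^ (r - i)) := by rw [← h4, ← mul_pow]; norm_num
  refine Nat.le_of_mul_le_mul_right (c := i.factorial * (r - i).factorial) ?_ (by positivity)
  rw [h1, h8]
  calc 2 ^ r * (LA r i * LB r (r - i)) ≤ 2 ^ r * (_ * _) :=
        Nat.mul_le_mul_left _ (Nat.mul_le_mul h2 h3)
    _ = _ := by ring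

lemma Lc_sum_le (r : ℕ) : ∑ i ∈ range (r + 1), Lc r i ≤ 32 ^ r := by
  calc ∑ i ∈ range (r + 1), Lc r i
      ≤ ∑ i ∈ range (r + 1), 8 ^ r * (r.choose i * (r + 1).choose (r - i)) :=
        Finset.sum_le_sum fun i hi => Lc_le r i (by have := Finset.mem_range.1 hi; omega)
    _ = 8 ^ r * (2 * r + 1).choose r := by
        rw [← Finset.mul_sum, show 2 * r + 1 = r + (r + 1) by ring, Nat.add_choose_eq,
          Finset.Nat.sum_antidiagonal_eq_sum_range_succ_mk]
    _ ≤ 8 ^ r * 4 ^ r := Nat.mul_le_mul_left _ (Nat.choose_middle_le_pow r)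
    _ = 32 ^ r := by rw [← mul_pow]; norm_num

lemma alt_sum_succ (r : ℕ) (f : ℕ → ℂ) :
    ∑ j ∈ range (r + 2), (-1) ^ j * ((r + 1).choose j : ℂ) * f j =
    ∑ j ∈ range (r + 1), (-1) ^ j * (r.choose j : ℂ) * (f j - f (j + 1)) := by
  rw [Finset.sum_range_succ']
  simp only [Nat.choose_succ_succ, Nat.cast_add, mul_sub, Finset.sum_sub_distrib, mul_add, add_mul,
    Finset.sum_add_distrib]
  have h : ∑ j ∈ range (r + 1), (-1 : ℂ) ^ j * (r.choose j : ℂ) * f j =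
     ∑ j ∈ range (r + 1), (-1 : ℂ) ^ (j + 1) * (r.choose (j + 1) : ℂ) * f (j + 1) + f 0 := by
    have := Finset.sum_range_succ' (fun j => (-1 : ℂ) ^ j * (r.choose j : ℂ) * f j) (r + 1)
    rw [Finset.sum_range_succ] at this
    simpa using this
  rw [h]
  have h2 : ∑ j ∈ range (r + 1), (-1 : ℂ) ^ (j + 1) * (r.choose j : ℂ) * f (j + 1) =
      - ∑ j ∈ range (r + 1), (-1 : ℂ) ^ j * (r.choose j : ℂ) * f (j + 1) := by
    rw [← Finset.sum_neg_distrib]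
    exact Finset.sum_congr rfl fun j _ => by ring
  rw [h2]
  simp
  ring

lemma partial_frac (r : ℕ) : ∀ a : ℂ, (∀ l : ℕ, a + 4 * l ≠ 0) →
    ∑ j ∈ range (r + 1), (-1) ^ j * (r.choose j : ℂ) * (1 / (a + 4 * j)) *
      ∏ l ∈ range (r + 1), (a + 4 * l) = 4 ^ r * r.factorial := by
  induction r with
  | zero => intro a ha; have := ha 0; simp at this; simp [this]
  | succ r ih =>
    intro a ha
    have ha' : ∀ l : ℕ, (a + 4) + 4 * l ≠ 0 := fun l => by
      have := ha (l + 1); push_cast at this; intro h; apply this; rw [← h]; ring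
    have h1 := ih a ha
    have h2 := ih (a + 4) ha'
    rw [← Finset.sum_mul] at h1 h2 ⊢
    rw [alt_sum_succ]
    simp only [mul_sub, Finset.sum_sub_distrib, sub_mul]
    have e1 : ∏ l ∈ range (r + 1 + 1), (a + 4 * (l : ℂ)) =
      (∏ l ∈ range (r + 1), (a + 4 * (l : ℂ))) * (a + 4 * ((r : ℂ) + 1)) := by
      rw [Finset.prod_range_succ]; push_cast; rfl
    have e2 : ∏ l ∈ range (r + 1 + 1), (a + 4 * (l : ℂ)) =
      (∏ l ∈ range (r + 1), (a + 4 + 4 * (l : ℂ))) * a := by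
      rw [Finset.prod_range_succ']
      congr 1
      · exact Finset.prod_congr rfl fun x _ => by push_cast; ring
      · simp
    have e3 : ∑ x ∈ range (r + 1), (-1 : ℂ) ^ x * (r.choose x : ℂ) * (1 / (a + 4 * ((x + 1 : ℕ) : ℂ)))
       = ∑ x ∈ range (r + 1), (-1 : ℂ) ^ x * (r.choose x : ℂ) * (1 / (a + 4 + 4 * (x : ℂ))) :=
      Finset.sum_congr rfl fun x _ => by push_cast; ring_nf
    rw [e3]
    nth_rewrite 1 [e1]
    rw [e2, ← mul_assoc, ← mul_assoc, h1, h2, Nat.factorial_succ]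
    push_cast
    ring
open Finset

def Lq {R : Type*} [CommRing R] (r : ℕ) (X Y : R) : R :=
  ∑ i ∈ range (r + 1), (Lc r i : R) * X ^ (r - i) * Y ^ i

def LF (r : ℕ) : ℤ := ∏ l ∈ range (2 * r + 1), (4 * ((l : ℤ) - r) + 1)

lemma LF_split (r i : ℕ) (h : i ≤ r) :
    LF r = (-1) ^ i * (LA r i * LB r (r - i)) *
      ∏ l ∈ range (r + 1), (4 * ((i : ℤ) - r) + 1 + 4 * l) := by
  have e : 2 * r + 1 = i + (r + 1) + (r - i) := by omega
  unfold LF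
  rw [e, Finset.prod_range_add, Finset.prod_range_add, LA_int r i h, LB_int r (r - i) (by omega)]
  have h1 : ∏ l ∈ range i, (4 * ((l : ℤ) - r) + 1) =
      (-1) ^ i * ∏ l ∈ range i, ((4 * r - 1 : ℤ) - 4 * l) := by
    have e : (-1 : ℤ) ^ i = ∏ _x ∈ range i, (-1 : ℤ) := by simp
    rw [e, ← Finset.prod_mul_distrib]
    exact Finset.prod_congr rfl fun x _ => by ring
  have h2 : ∏ x ∈ range (r - i), (4 * (((i + (r + 1) + x : ℕ) : ℤ) - r) + 1) =
      ∏ l ∈ range (r - i), ((4 * r + 1 : ℤ) - 4 * l) := by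
    rw [← Finset.prod_range_reflect]
    refine Finset.prod_congr rfl fun x hx => ?_
    have hx' := Finset.mem_range.1 hx
    have : ((r - i - 1 - x : ℕ) : ℤ) = r - i - 1 - x := by omega
    push_cast [this]; ring
  have h3 : ∏ x ∈ range (r + 1), (4 * (((i + x : ℕ) : ℤ) - r) + 1) =
      ∏ l ∈ range (r + 1), (4 * ((i : ℤ) - r) + 1 + 4 * l) :=
    Finset.prod_congr rfl fun x _ => by push_cast; ring
  rw [h1, h2, h3]; ring

lemma LF_le (r : ℕ) : |LF r| ≤ 16 ^ r * (r.factorial : ℤ) ^ 2 := by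
  rw [LF_split r r le_rfl, abs_mul, abs_mul, abs_pow, abs_neg, abs_one, one_pow, one_mul]
  simp only [Nat.sub_self, sub_self, mul_zero, zero_add]
  have h0 : LB r 0 = 1 := by simp [LB]
  rw [h0, LA_int r r le_rfl, Nat.cast_one, mul_one, Finset.prod_range_succ', ← Finset.prod_range_reflect]
  simp only [Nat.cast_zero, mul_zero, add_zero, mul_one]
  rw [← abs_mul, ← Finset.prod_mul_distrib, ← Finset.prod_range_add_one_eq_factorial]
  have e : (16 : ℤ) ^ r = ∏ _x ∈ range r, (16 : ℤ) := by simp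
  push_cast
  rw [e, ← Finset.prod_pow, ← Finset.prod_mul_distrib, Finset.abs_prod]
  refine Finset.prod_le_prod (fun _ _ => abs_nonneg _) fun x hx => ?_
  have hx' := Finset.mem_range.1 hx
  have : ((r - 1 - x : ℕ) : ℤ) = r - 1 - x := by omega
  rw [this, abs_le]
  constructor <;> nlinarith

noncomputable def LG (r : ℕ) (X Y t : ℂ) : ℂ :=
  ∑ i ∈ range (r + 1), ∑ j ∈ range (r + 1),
    ((r.choose i : ℂ) * (-1) ^ (r - i) * X ^ (r - i)) * ((r.choose j : ℂ) * (-1) ^ j * Y ^ (r - j)) *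
      (t ^ (4 * ((i : ℤ) + j - r) + 1) / (4 * ((i : ℂ) + j - r) + 1))

lemma four_ne (k : ℤ) : (4 * (k : ℂ) + 1) ≠ 0 := by
  have : (4 * k + 1 : ℤ) ≠ 0 := by omega
  exact_mod_cast this

lemma four_ne' (i j r : ℕ) : (4 * ((i : ℂ) + j - r) + 1) ≠ 0 := by
  have := four_ne (i + j - r); push_cast at this; exact this

lemma LG_deriv (r : ℕ) (X Y t : ℂ) (ht : t ≠ 0) :
    HasDerivAt (LG r X Y) (((t ^ 4 - X) * (Y - t ^ 4) / t ^ 4) ^ r) t := by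
  have h : ((t ^ 4 - X) * (Y - t ^ 4) / t ^ 4) ^ r =
    ∑ i ∈ range (r + 1), ∑ j ∈ range (r + 1),
    ((r.choose i : ℂ) * (-1) ^ (r - i) * X ^ (r - i)) * ((r.choose j : ℂ) * (-1) ^ j * Y ^ (r - j)) *
      (((4 * ((i : ℤ) + j - r) + 1 : ℤ) : ℂ) * t ^ (4 * ((i : ℤ) + j - r) + 1 - 1) / (4 * ((i : ℂ) + j - r) + 1)) := by
    have e1 : (t ^ 4 - X) ^ r = (t ^ 4 + -X) ^ r := by ring
    have e2 : (Y - t ^ 4) ^ r = (- t ^ 4 + Y) ^ r := by ring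
    rw [div_pow, mul_pow, e1, e2, add_pow, add_pow, Finset.sum_mul_sum, Finset.sum_div]
    refine Finset.sum_congr rfl fun i hi => ?_
    rw [Finset.sum_div]
    refine Finset.sum_congr rfl fun j hj => ?_
    have h1 : ((4 * ((i : ℤ) + j - r) + 1 : ℤ) : ℂ) * t ^ (4 * ((i : ℤ) + j - r) + 1 - 1) /
       (4 * ((i : ℂ) + j - r) + 1) = t ^ (4 * i) * t ^ (4 * j) / t ^ (4 * r) := by
      push_cast
      rw [mul_div_assoc, mul_div_left_comm, div_self (four_ne' i j r), mul_one]
      rw [show (4 * ((i : ℤ) + j - r) + 1 - 1) = ((4 * i : ℕ) : ℤ) + ((4 * j : ℕ) : ℤ) - ((4 * r : ℕ) : ℤ) by push_cast; ring,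
        zpow_sub₀ ht, zpow_add₀ ht, zpow_natCast, zpow_natCast, zpow_natCast]
    rw [h1, neg_pow X, neg_pow (t ^ 4)]
    simp only [← pow_mul]
    ring
  rw [h]
  unfold LG
  refine HasDerivAt.fun_sum fun i _ => HasDerivAt.fun_sum fun j _ => ?_
  exact ((hasDerivAt_zpow _ t (Or.inl ht)).div_const _).const_mul _

noncomputable def LS (r i : ℕ) : ℂ :=
  ∑ j ∈ range (r + 1), (-1) ^ j * (r.choose j : ℂ) * (1 / (4 * ((i : ℂ) + j - r) + 1))

lemma LS_eq (r i : ℕ) (h : i ≤ r) :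
    (LF r : ℂ) * ((r.choose i : ℂ) * LS r i) =
      (-1) ^ i * 2 ^ r * (r.factorial : ℂ) ^ 2 * Lc r i := by
  have h1 := partial_frac r (4 * ((i : ℂ) - r) + 1) (fun l => by
    have := four_ne' i l r; intro h; apply this; rw [← h]; ring)
  rw [← Finset.sum_mul] at h1
  have e : ∑ j ∈ range (r + 1), (-1) ^ j * (r.choose j : ℂ) * (1 / (4 * ((i : ℂ) - r) + 1 + 4 * j))
      = LS r i := Finset.sum_congr rfl fun j _ => by ring_nf
  rw [e] at h1
  have h2 : (LF r : ℂ) = (-1) ^ i * (LA r i * LB r (r - i)) *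
      ∏ l ∈ range (r + 1), (4 * ((i : ℂ) - r) + 1 + 4 * l) := by
    rw [LF_split r i h]; push_cast; rfl
  have h3 : (Lc r i : ℂ) * (i.factorial * (r - i).factorial) = 2 ^ r * (LA r i * LB r (r - i)) := by
    exact_mod_cast Lc_mul r i h
  have h4 : (r.choose i : ℂ) * i.factorial * (r - i).factorial = r.factorial := by
    exact_mod_cast Nat.choose_mul_factorial_mul_factorial h
  have h5 : (4 : ℂ) ^ r = 2 ^ r * 2 ^ r := by rw [← mul_pow]; norm_num
  rw [h2]
  calc _ = (-1) ^ i * (LA r i * LB r (r - i)) * (r.choose i : ℂ) *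
      (LS r i * ∏ l ∈ range (r + 1), (4 * ((i : ℂ) - r) + 1 + 4 * l)) := by ring
    _ = (-1) ^ i * (2 ^ r * (LA r i * LB r (r - i))) * (r.choose i : ℂ) * (2 ^ r * r.factorial) := by
      rw [h1, h5]; ring
    _ = (-1) ^ i * 2 ^ r * ((r.choose i : ℂ) * i.factorial * (r - i).factorial) * r.factorial * Lc r i := by
      rw [← h3]; ring
    _ = _ := by rw [h4]; ring

lemma neg_one_sub (r i : ℕ) (h : i ≤ r) : (-1 : ℂ) ^ (r - i) = (-1) ^ r * (-1) ^ i := by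
  obtain ⟨k, rfl⟩ := Nat.exists_eq_add_of_le h
  rw [Nat.add_sub_cancel_left, pow_add]
  have : (-1 : ℂ) ^ i * (-1) ^ i = 1 := by rw [← mul_pow]; simp
  linear_combination -(-1 : ℂ) ^ k * this

lemma LG_y (r : ℕ) (X y : ℂ) (hy : y ≠ 0) :
    (LF r : ℂ) * LG r X (y ^ 4) y = (-1) ^ r * 2 ^ r * (r.factorial : ℂ) ^ 2 * (y * Lq r X (y ^ 4)) := by
  unfold LG Lq
  simp only [Finset.mul_sum]
  refine Finset.sum_congr rfl fun i hi => ?_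
  have hi' : i ≤ r := by have := Finset.mem_range.1 hi; omega
  have h1 := LS_eq r i hi'
  have h2 := neg_one_sub r i hi'
  have h3 : (-1 : ℂ) ^ i * (-1) ^ i = 1 := by rw [← mul_pow]; simp
  have : ∑ j ∈ range (r + 1), (LF r : ℂ) * (((r.choose i : ℂ) * (-1) ^ (r - i) * X ^ (r - i)) * ((r.choose j : ℂ) * (-1) ^ j * (y ^ 4) ^ (r - j)) *
      (y ^ (4 * ((i : ℤ) + j - r) + 1) / (4 * ((i : ℂ) + j - r) + 1))) =
      (LF r : ℂ) * ((r.choose i : ℂ) * LS r i) * ((-1) ^ (r - i) * X ^ (r - i) * y * (y ^ 4) ^ i) := by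
    unfold LS
    simp only [Finset.mul_sum, Finset.sum_mul]
    refine Finset.sum_congr rfl fun j hj => ?_
    have hj' : j ≤ r := by have := Finset.mem_range.1 hj; omega
    have : y ^ (4 * ((i : ℤ) + j - r) + 1) * (y ^ 4) ^ (r - j) = y * (y ^ 4) ^ i := by
      rw [← pow_mul, ← pow_mul, ← zpow_natCast, ← zpow_natCast, ← zpow_add₀ hy, ← zpow_one_add₀ hy]
      congr 1; push_cast [Nat.cast_sub hj']; ring
    linear_combination (LF r : ℂ) * ((r.choose i : ℂ) * (-1) ^ (r - i) * X ^ (r - i)) * ((r.choose j : ℂ) * (-1) ^ j) * (1 / (4 * ((i : ℂ) + j - r) + 1)) * this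
  rw [this, h1, h2]
  linear_combination (-1 : ℂ) ^ r * 2 ^ r * (r.factorial : ℂ) ^ 2 * y * Lc r i * X ^ (r - i) * (y ^ 4) ^ i * h3

lemma LG_x (r : ℕ) (Y x : ℂ) (hx : x ≠ 0) :
    (LF r : ℂ) * LG r (x ^ 4) Y x = (-1) ^ r * 2 ^ r * (r.factorial : ℂ) ^ 2 * (x * Lq r Y (x ^ 4)) := by
  unfold LG Lq
  rw [Finset.sum_comm]
  simp only [Finset.mul_sum]
  refine Finset.sum_congr rfl fun i hi => ?_
  have hi' : i ≤ r := by have := Finset.mem_range.1 hi; omega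
  have h1 := LS_eq r i hi'
  have h3 : (-1 : ℂ) ^ i * (-1) ^ i = 1 := by rw [← mul_pow]; simp
  have : ∑ j ∈ range (r + 1), (LF r : ℂ) * (((r.choose j : ℂ) * (-1) ^ (r - j) * (x ^ 4) ^ (r - j)) * ((r.choose i : ℂ) * (-1) ^ i * Y ^ (r - i)) *
      (x ^ (4 * ((j : ℤ) + i - r) + 1) / (4 * ((j : ℂ) + i - r) + 1))) =
      (LF r : ℂ) * ((r.choose i : ℂ) * LS r i) * ((-1) ^ r * (-1) ^ i * Y ^ (r - i) * x * (x ^ 4) ^ i) := by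
    unfold LS
    simp only [Finset.mul_sum, Finset.sum_mul]
    refine Finset.sum_congr rfl fun j hj => ?_
    have hj' : j ≤ r := by have := Finset.mem_range.1 hj; omega
    have : x ^ (4 * ((j : ℤ) + i - r) + 1) * (x ^ 4) ^ (r - j) = x * (x ^ 4) ^ i := by
      rw [← pow_mul, ← pow_mul, ← zpow_natCast, ← zpow_natCast, ← zpow_add₀ hx, ← zpow_one_add₀ hx]
      congr 1; push_cast [Nat.cast_sub hj']; ring
    rw [neg_one_sub r j hj', add_comm (i : ℂ) j]
    linear_combination (LF r : ℂ) * ((r.choose j : ℂ) * ((-1) ^ r * (-1) ^ j)) * ((r.choose i : ℂ) * (-1) ^ i * Y ^ (r - i)) * (1 / (4 * ((j : ℂ) + i - r) + 1)) * this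
  rw [this, h1]
  linear_combination (-1 : ℂ) ^ r * 2 ^ r * (r.factorial : ℂ) ^ 2 * x * Lc r i * Y ^ (r - i) * (x ^ 4) ^ i * h3

lemma quart_le (t x : ℂ) (M : ℝ) (ht : ‖t‖ ≤ M) (hx : ‖x‖ ≤ M) :
    ‖t ^ 4 - x ^ 4‖ ≤ 4 * M ^ 3 * ‖t - x‖ := by
  have hM : 0 ≤ M := (norm_nonneg _).trans ht
  have e : t ^ 4 - x ^ 4 = (t ^ 3 + t ^ 2 * x + t * x ^ 2 + x ^ 3) * (t - x) := by ring
  rw [e, norm_mul]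
  gcongr
  have h1 : ‖t ^ 3‖ ≤ M ^ 3 := by rw [norm_pow]; gcongr
  have h2 : ‖t ^ 2 * x‖ ≤ M ^ 2 * M := by rw [norm_mul, norm_pow]; gcongr
  have h3 : ‖t * x ^ 2‖ ≤ M * M ^ 2 := by rw [norm_mul, norm_pow]; gcongr
  have h4 : ‖x ^ 3‖ ≤ M ^ 3 := by rw [norm_pow]; gcongr
  calc _ ≤ ‖t ^ 3‖ + ‖t ^ 2 * x‖ + ‖t * x ^ 2‖ + ‖x ^ 3‖ := norm_add₄_le
    _ ≤ _ := by nlinarith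

lemma W_bound (r : ℕ) (x y : ℂ) (M m : ℝ) (hm : 0 < m) (hx : ‖x‖ ≤ M) (hy : ‖y‖ ≤ M)
    (hs : ∀ t ∈ segment ℝ x y, m ≤ ‖t‖) :
    ‖y * Lq r (x ^ 4) (y ^ 4) - x * Lq r (y ^ 4) (x ^ 4)‖ ≤
      8 ^ r * (4 * M ^ 6 * ‖y - x‖ ^ 2 / m ^ 4) ^ r * ‖y - x‖ := by
  have hM : 0 ≤ M := (norm_nonneg _).trans hx
  have hx0 : x ≠ 0 := by
    have := hs x (left_mem_segment ℝ x y); rw [← norm_pos_iff]; linarith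
  have hy0 : y ≠ 0 := by
    have := hs y (right_mem_segment ℝ x y); rw [← norm_pos_iff]; linarith
  have hG : ‖LG r (x ^ 4) (y ^ 4) y - LG r (x ^ 4) (y ^ 4) x‖ ≤
      (4 * M ^ 6 * ‖y - x‖ ^ 2 / m ^ 4) ^ r * ‖y - x‖ := by
    refine Convex.norm_image_sub_le_of_norm_hasDerivWithin_le (s := segment ℝ x y)
      (f' := fun t => ((t ^ 4 - x ^ 4) * (y ^ 4 - t ^ 4) / t ^ 4) ^ r)
      (fun t ht => (LG_deriv r _ _ t ?_).hasDerivWithinAt) (fun t ht => ?_) (convex_segment x y)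
      (left_mem_segment ℝ x y) (right_mem_segment ℝ x y)
    · have := hs t ht; rw [← norm_pos_iff]; linarith
    · have hmt := hs t ht
      have htM : ‖t‖ ≤ M := by
        have : t ∈ Metric.closedBall (0 : ℂ) M :=
          (convex_closedBall (0 : ℂ) M).segment_subset (by simpa using hx) (by simpa using hy) ht
        simpa using this
      rw [norm_pow]
      refine pow_le_pow_left₀ (norm_nonneg _) ?_ r
      rw [norm_div, norm_mul, norm_pow]
      have h1 := quart_le t x M htM hx
      have h2 := quart_le y t M hy htM
      have h3 : ‖t - x‖ * ‖y - t‖ ≤ ‖y - x‖ ^ 2 / 4 := by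
        have h4 : ‖t - x‖ + ‖y - t‖ = ‖y - x‖ := by
          have := dist_add_dist_of_mem_segment ht
          rw [dist_eq_norm, dist_eq_norm, dist_eq_norm, norm_sub_rev x t, norm_sub_rev t y, norm_sub_rev x y] at this
          exact this
        rw [← h4]; nlinarith [sq_nonneg (‖t - x‖ - ‖y - t‖)]
      have h5 : ‖t ^ 4 - x ^ 4‖ * ‖y ^ 4 - t ^ 4‖ ≤ 4 * M ^ 6 * ‖y - x‖ ^ 2 := by
        calc _ ≤ (4 * M ^ 3 * ‖t - x‖) * (4 * M ^ 3 * ‖y - t‖) := by gcongr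
          _ = 16 * M ^ 6 * (‖t - x‖ * ‖y - t‖) := by ring
          _ ≤ 16 * M ^ 6 * (‖y - x‖ ^ 2 / 4) := by gcongr
          _ = _ := by ring
      gcongr
  have h1 := LG_y r (x ^ 4) y hy0
  have h2 := LG_x r (y ^ 4) x hx0
  have h3 : (LF r : ℂ) * (LG r (x ^ 4) (y ^ 4) y - LG r (x ^ 4) (y ^ 4) x) =
      (-1) ^ r * 2 ^ r * (r.factorial : ℂ) ^ 2 *
        (y * Lq r (x ^ 4) (y ^ 4) - x * Lq r (y ^ 4) (x ^ 4)) := by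
    rw [mul_sub, h1, h2]; ring
  have h4 := congrArg norm h3
  simp only [norm_mul, norm_pow, norm_neg, norm_one, one_pow, one_mul, Complex.norm_natCast,
    Complex.norm_intCast, Complex.norm_ofNat] at h4
  have h5 : (|(LF r : ℝ)|) ≤ 16 ^ r * (r.factorial : ℝ) ^ 2 := by exact_mod_cast LF_le r
  have h6 : (0 : ℝ) < 2 ^ r * (r.factorial : ℝ) ^ 2 := by positivity
  refine le_of_mul_le_mul_left ?_ h6
  rw [← h4]
  calc _ ≤ (16 ^ r * (r.factorial : ℝ) ^ 2) * ((4 * M ^ 6 * ‖y - x‖ ^ 2 / m ^ 4) ^ r * ‖y - x‖) := by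
        gcongr
    _ = _ := by
      have : (16 : ℝ) ^ r = 2 ^ r * 8 ^ r := by rw [← mul_pow]; norm_num
      rw [this]; ring
open Finset

lemma Lq_norm_le (r : ℕ) (X Y : ℂ) (B : ℝ) (hX : ‖X‖ ≤ B) (hY : ‖Y‖ ≤ B) :
    ‖Lq r X Y‖ ≤ 32 ^ r * B ^ r := by
  have hB : 0 ≤ B := (norm_nonneg _).trans hX
  unfold Lq
  calc _ ≤ ∑ i ∈ range (r + 1), (Lc r i : ℝ) * B ^ r := by
        refine norm_sum_le_of_le _ fun i hi => ?_
        have hi' : i ≤ r := by have := Finset.mem_range.1 hi; omega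
        rw [norm_mul, norm_mul, norm_pow, norm_pow, Complex.norm_natCast, mul_assoc]
        have : B ^ r = B ^ (r - i) * B ^ i := by rw [← pow_add]; congr 1; omega
        rw [this]
        gcongr
    _ = ((∑ i ∈ range (r + 1), Lc r i : ℕ) : ℝ) * B ^ r := by
        push_cast; rw [Finset.sum_mul]
    _ ≤ _ := by
        gcongr
        exact_mod_cast Lc_sum_le r

lemma LA_succ (r : ℕ) : LA (r + 1) (r + 1) = LA r r * (4 * r + 3) := by
  unfold LA
  rw [Finset.prod_range_succ']
  congr 1
  exact Finset.prod_congr rfl fun x _ => by rw [Nat.add_sub_add_right]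

lemma LB_succ (r : ℕ) : LB (r + 1) (r + 1) = LB r r * (4 * r + 5) := by
  unfold LB
  rw [Finset.prod_range_succ']
  congr 1
  exact Finset.prod_congr rfl fun x _ => by rw [Nat.add_sub_add_right]

lemma LA_pos (r : ℕ) : 0 < LA r r := by
  induction r with
  | zero => simp [LA]
  | succ r ih => rw [LA_succ]; positivity

lemma LB_pos (r : ℕ) : 0 < LB r r := by
  induction r with
  | zero => simp [LB]
  | succ r ih => rw [LB_succ]; positivity

lemma Lc_ne (r : ℕ) : Lc r 0 * Lc (r + 1) (r + 1) ≠ Lc r r * Lc (r + 1) 0 := by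
  intro h
  have h1 := Lc_mul r 0 (by omega)
  have h2 := Lc_mul r r le_rfl
  have h3 := Lc_mul (r + 1) 0 (by omega)
  have h4 := Lc_mul (r + 1) (r + 1) le_rfl
  have a0 : ∀ r, LA r 0 = 1 := fun r => by simp [LA]
  have b0 : ∀ r, LB r 0 = 1 := fun r => by simp [LB]
  simp only [Nat.sub_self, Nat.sub_zero, Nat.factorial_zero, one_mul, mul_one, a0, b0, LA_succ, LB_succ] at h1 h2 h3 h4
  have h5 : (2 ^ r * LB r r) * (2 ^ (r + 1) * (LA r r * (4 * r + 3))) =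
      (2 ^ r * LA r r) * (2 ^ (r + 1) * (LB r r * (4 * r + 5))) := by
    rw [← h1, ← h2, ← h3, ← h4]
    linear_combination (r.factorial * (r + 1).factorial) * h
  have h6 : 0 < 2 ^ r * LB r r * (2 ^ (r + 1) * LA r r) := by
    have := LA_pos r; have := LB_pos r; positivity
  have h7 : (2 ^ r * LB r r * (2 ^ (r + 1) * LA r r)) * (4 * r + 3) =
    (2 ^ r * LB r r * (2 ^ (r + 1) * LA r r)) * (4 * r + 5) := by linarith
  have := Nat.eq_of_mul_eq_mul_left h6 h7
  omega

open Polynomial in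
noncomputable def LD (r : ℕ) : ℂ[X] :=
  Lq r X 1 * Lq (r + 1) 1 X - Lq r 1 X * Lq (r + 1) X 1

open Polynomial in
lemma LD_coeff (r : ℕ) : (LD r).coeff (r + (r + 1)) ≠ 0 ∧ (LD r).natDegree ≤ r + (r + 1) := by
  have d1 : ∀ r, (Lq r (X : ℂ[X]) 1).natDegree ≤ r := fun r => by
    unfold Lq
    refine natDegree_sum_le_of_forall_le _ _ fun i hi => ?_
    rw [one_pow, mul_one, ← C_eq_natCast]
    exact (natDegree_C_mul_X_pow_le _ _).trans (Nat.sub_le _ _)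
  have d2 : ∀ r, (Lq r 1 (X : ℂ[X])).natDegree ≤ r := fun r => by
    unfold Lq
    refine natDegree_sum_le_of_forall_le _ _ fun i hi => ?_
    rw [one_pow, mul_one, ← C_eq_natCast]
    exact (natDegree_C_mul_X_pow_le _ _).trans (by have := Finset.mem_range.1 hi; omega)
  have c1 : ∀ r, (Lq r (X : ℂ[X]) 1).coeff r = Lc r 0 := fun r => by
    unfold Lq
    simp only [one_pow, mul_one, ← C_eq_natCast, finsetSum_coeff, coeff_C_mul_X_pow]
    rw [Finset.sum_eq_single 0]
    · simp
    · intro b hb hb0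
      have := Finset.mem_range.1 hb
      rw [if_neg (by omega)]
    · simp
  have c2 : ∀ r, (Lq r 1 (X : ℂ[X])).coeff r = Lc r r := fun r => by
    unfold Lq
    simp only [one_pow, mul_one, ← C_eq_natCast, finsetSum_coeff, coeff_C_mul_X_pow]
    rw [Finset.sum_eq_single r]
    · simp
    · intro b hb hb0
      rw [if_neg (by omega)]
    · simp
  unfold LD
  constructor
  · rw [coeff_sub, coeff_mul_add_eq_of_natDegree_le (d1 _) (d2 _),
      coeff_mul_add_eq_of_natDegree_le (d2 _) (d1 _), c1, c2, c1, c2, sub_ne_zero]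
    exact_mod_cast Lc_ne r
  · refine (natDegree_sub_le _ _).trans (max_le ?_ ?_)
    · exact natDegree_mul_le_of_le (d1 _) (d2 _)
    · exact natDegree_mul_le_of_le (d2 _) (d1 _)

open Polynomial in
lemma Lq_eval (r : ℕ) (A B : ℂ[X]) (t : ℂ) : (Lq r A B).eval t = Lq r (A.eval t) (B.eval t) := by
  unfold Lq
  simp [eval_finsetSum]

lemma LD_small (r : ℕ) : ∃ C : ℝ, ∀ x : ℝ, 1 / 2 ≤ x → x < 1 →
    ‖(LD r).eval ((x : ℂ) ^ 4)‖ ≤ C * (1 - x) ^ (2 * r + 1) := by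
  refine ⟨2 * (32 ^ (r + 1) * 512 ^ r + 32 ^ r * 512 ^ (r + 1)), fun x h1 h2 => ?_⟩
  have hx : ‖(x : ℂ)‖ = x := by rw [Complex.norm_real, Real.norm_of_nonneg (by linarith)]
  have hyx : ‖(1 : ℂ) - x‖ = 1 - x := by
    rw [← Complex.ofReal_one, ← Complex.ofReal_sub, Complex.norm_real, Real.norm_of_nonneg (by linarith)]
  have hseg : ∀ t ∈ segment ℝ (x : ℂ) 1, 1 / 2 ≤ ‖t‖ := by
    rintro t ⟨a, b, ha, hb, hab, rfl⟩
    have : a • (x : ℂ) + b • (1 : ℂ) = ((a * x + b : ℝ) : ℂ) := by simp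
    rw [this, Complex.norm_real]
    refine le_trans ?_ (le_abs_self _)
    nlinarith
  have W : ∀ s, ‖Lq s ((x : ℂ) ^ 4) 1 - x * Lq s 1 ((x : ℂ) ^ 4)‖ ≤ 512 ^ s * (1 - x) ^ (2 * s + 1) := by
    intro s
    have := W_bound s (x : ℂ) 1 1 (1 / 2) (by norm_num) (by rw [hx]; exact h2.le) (by simp) hseg
    rw [hyx, one_pow, one_mul] at this
    refine this.trans (le_of_eq ?_)
    have e : (1 - x) ^ (2 * s + 1) = ((1 - x) ^ 2) ^ s * (1 - x) := by rw [pow_succ, pow_mul]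
    rw [e, ← mul_pow, ← mul_assoc, ← mul_pow]
    congr 2; ring
  have hX : ‖(x : ℂ) ^ 4‖ ≤ 1 := by rw [norm_pow, hx]; exact pow_le_one₀ (by linarith) h2.le
  have Q : ∀ s, ‖Lq s ((x : ℂ) ^ 4) 1‖ ≤ 32 ^ s := fun s => by
    have := Lq_norm_le s ((x : ℂ) ^ 4) 1 1 hX (by simp)
    simpa using this
  have e : (x : ℂ) * (LD r).eval ((x : ℂ) ^ 4) =
    Lq (r + 1) ((x : ℂ) ^ 4) 1 * (Lq r ((x : ℂ) ^ 4) 1 - x * Lq r 1 ((x : ℂ) ^ 4)) -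
    Lq r ((x : ℂ) ^ 4) 1 * (Lq (r + 1) ((x : ℂ) ^ 4) 1 - x * Lq (r + 1) 1 ((x : ℂ) ^ 4)) := by
    unfold LD
    simp only [Polynomial.eval_sub, Polynomial.eval_mul, Lq_eval, Polynomial.eval_X, Polynomial.eval_one]
    ring
  have hn : x * ‖(LD r).eval ((x : ℂ) ^ 4)‖ ≤
      (32 ^ (r + 1) * 512 ^ r + 32 ^ r * 512 ^ (r + 1)) * (1 - x) ^ (2 * r + 1) := by
    nth_rewrite 1 [← hx]
    rw [← norm_mul, e]
    refine (norm_sub_le _ _).trans ?_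
    rw [norm_mul, norm_mul, add_mul, mul_assoc, mul_assoc]
    have hp : (1 - x) ^ (2 * (r + 1) + 1) ≤ (1 - x) ^ (2 * r + 1) :=
      pow_le_pow_of_le_one (by linarith) (by linarith) (by omega)
    gcongr
    · exact Q _
    · exact W _
    · exact Q _
    · exact (W _).trans (by gcongr)
  have h0 := norm_nonneg ((LD r).eval ((x : ℂ) ^ 4))
  nlinarith

open Polynomial Filter Topology in
lemma LD_dvd (r : ℕ) : (X - C 1) ^ (2 * r + 1) ∣ LD r := by
  have hD : LD r ≠ 0 := by
    intro h; have := (LD_coeff r).1; rw [h] at this; simp at this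
  obtain ⟨g, hg, hnd⟩ := exists_eq_pow_rootMultiplicity_mul_and_not_dvd (LD r) hD 1
  by_contra hcon
  have hm : rootMultiplicity 1 (LD r) < 2 * r + 1 := by
    by_contra hle
    exact hcon ((pow_dvd_pow _ (not_lt.1 hle)).trans (pow_rootMultiplicity_dvd _ _))
  set m := rootMultiplicity 1 (LD r)
  obtain ⟨C0, hC⟩ := LD_small r
  apply hnd
  rw [dvd_iff_isRoot, IsRoot, ← norm_le_zero_iff]
  have t1 : Tendsto (fun x : ℝ => ‖g.eval ((x : ℂ) ^ 4)‖) (𝓝[<] 1) (𝓝 ‖g.eval 1‖) := by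
    have : Continuous (fun x : ℝ => ‖g.eval ((x : ℂ) ^ 4)‖) := by fun_prop
    have := this.tendsto 1
    simp only [Complex.ofReal_one, one_pow] at this
    exact this.mono_left nhdsWithin_le_nhds
  have t2 : Tendsto (fun x : ℝ => |C0| * (1 - x)) (𝓝[<] 1) (𝓝 0) := by
    have : Continuous (fun x : ℝ => |C0| * (1 - x)) := by fun_prop
    have := this.tendsto 1
    simp only [sub_self, mul_zero] at this
    exact this.mono_left nhdsWithin_le_nhds
  refine le_of_tendsto_of_tendsto t1 t2 ?_
  have hev : ∀ᶠ x : ℝ in 𝓝[<] 1, x ∈ Set.Ioo (1 / 2 : ℝ) 1 := Ioo_mem_nhdsLT (by norm_num)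
  filter_upwards [hev] with x hx
  have h := hC x hx.1.le hx.2
  rw [hg, eval_mul, eval_pow, norm_mul, norm_pow, eval_sub, eval_X, eval_C] at h
  have e : ‖(x : ℂ) ^ 4 - 1‖ = 1 - x ^ 4 := by
    have : (x : ℂ) ^ 4 - 1 = ((x ^ 4 - 1 : ℝ) : ℂ) := by push_cast; ring
    rw [this, Complex.norm_real, Real.norm_eq_abs, abs_sub_comm, abs_of_nonneg]
    have := pow_le_one₀ (n := 4) (by linarith [hx.1] : 0 ≤ x) hx.2.le
    linarith
  rw [e] at h
  have hx1 : 0 < 1 - x := by linarith [hx.2]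
  have hle : 1 - x ≤ 1 - x ^ 4 := by
    have := pow_le_of_le_one (by linarith [hx.1] : 0 ≤ x) hx.2.le (show (4 : ℕ) ≠ 0 by norm_num)
    linarith
  have hp : (1 - x) ^ (2 * r + 1) ≤ (1 - x) ^ m * (1 - x) := by
    rw [← pow_succ]
    exact pow_le_pow_of_le_one hx1.le (by linarith [hx.1]) (by omega)
  have hpm : 0 < (1 - x) ^ m := by positivity
  refine le_of_mul_le_mul_left ?_ hpm
  calc (1 - x) ^ m * ‖g.eval ((x : ℂ) ^ 4)‖ ≤ (1 - x ^ 4) ^ m * ‖g.eval ((x : ℂ) ^ 4)‖ := by gcongr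
    _ ≤ C0 * (1 - x) ^ (2 * r + 1) := h
    _ ≤ |C0| * (1 - x) ^ (2 * r + 1) := by gcongr; exact le_abs_self _
    _ ≤ |C0| * ((1 - x) ^ m * (1 - x)) := by gcongr
    _ = _ := by ring

lemma Lq_hom (r : ℕ) (X Y : ℂ) (s : ℂ) : Lq r (s * X) (s * Y) = s ^ r * Lq r X Y := by
  unfold Lq
  rw [Finset.mul_sum]
  refine Finset.sum_congr rfl fun i hi => ?_
  have hi' : i ≤ r := by have := Finset.mem_range.1 hi; omega
  have : s ^ r = s ^ (r - i) * s ^ i := by rw [← pow_add]; congr 1; omega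
  rw [this, mul_pow, mul_pow]; ring

open Polynomial in
lemma det_ne (r : ℕ) (A B : ℂ) (hB : B ≠ 0) (hAB : A ≠ B) :
    Lq r A B * Lq (r + 1) B A - Lq r B A * Lq (r + 1) A B ≠ 0 := by
  have hD : LD r ≠ 0 := by
    intro h; have := (LD_coeff r).1; rw [h] at this; simp at this
  obtain ⟨g, hg⟩ := LD_dvd r
  have hg0 : g ≠ 0 := by rintro rfl; rw [mul_zero] at hg; exact hD hg
  have hmon : ((X - C (1 : ℂ)) ^ (2 * r + 1)).Monic := (monic_X_sub_C 1).pow _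
  have hdeg : g.natDegree = 0 := by
    have h1 := (LD_coeff r).2
    rw [hg, hmon.natDegree_mul' hg0, (monic_X_sub_C (1 : ℂ)).natDegree_pow, natDegree_X_sub_C] at h1
    omega
  rw [eq_C_of_natDegree_eq_zero hdeg] at hg hg0
  have hc : g.coeff 0 ≠ 0 := by simpa using hg0
  have e1 : ∀ s, Lq s A B = B ^ s * Lq s (A / B) 1 := fun s => by
    rw [← Lq_hom]; congr 1 <;> field_simp
  have e2 : ∀ s, Lq s B A = B ^ s * Lq s 1 (A / B) := fun s => by
    rw [← Lq_hom]; congr 1 <;> field_simp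
  have h := congrArg (eval (A / B)) hg
  unfold LD at h
  simp only [eval_sub, eval_mul, eval_pow, Lq_eval, eval_X, eval_one, eval_C] at h
  rw [e1, e2, e1, e2]
  have : B ^ r * Lq r (A / B) 1 * (B ^ (r + 1) * Lq (r + 1) 1 (A / B)) -
      B ^ r * Lq r 1 (A / B) * (B ^ (r + 1) * Lq (r + 1) (A / B) 1) =
      B ^ r * B ^ (r + 1) * ((A / B - 1) ^ (2 * r + 1) * g.coeff 0) := by rw [← h]; ring
  rw [this]
  have h1 : A / B - 1 ≠ 0 := by
    rw [sub_ne_zero]; intro h; rw [div_eq_one_iff_eq hB] at h; exact hAB h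
  positivity
open Finset

lemma sq_split (u v : ℂ) : ∃ s : ℂ, (s = 1 ∨ s = -1) ∧ ‖u - s * v‖ * ‖v‖ ≤ ‖u ^ 2 - v ^ 2‖ := by
  have h : 2 * ‖v‖ ≤ ‖u - v‖ + ‖u + v‖ := by
    have h1 : ‖(u + v) - (u - v)‖ ≤ ‖u + v‖ + ‖u - v‖ := norm_sub_le _ _
    have h2 : (u + v) - (u - v) = 2 * v := by ring
    rw [h2, norm_mul, Complex.norm_ofNat] at h1
    linarith
  have e : u ^ 2 - v ^ 2 = (u - v) * (u + v) := by ring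
  rw [e, norm_mul]
  have n1 := norm_nonneg (u - v)
  have n2 := norm_nonneg (u + v)
  rcases le_or_gt ‖v‖ ‖u + v‖ with hv | hv
  · refine ⟨1, Or.inl rfl, ?_⟩
    rw [one_mul]; gcongr
  · refine ⟨-1, Or.inr rfl, ?_⟩
    rw [show u - -1 * v = u + v by ring, mul_comm]
    gcongr
    linarith

lemma near_root (η ξ : ℂ) : ∃ τ : ℂ, τ ^ 4 = Complex.I ∧
    ‖η - τ * ξ‖ * ‖ξ‖ ^ 3 ≤ ‖η ^ 4 - Complex.I * ξ ^ 4‖ := by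
  obtain ⟨a, ha⟩ := IsAlgClosed.exists_pow_nat_eq Complex.I (n := 4) (by norm_num)
  have hn : ∀ b : ℂ, b ^ 4 = Complex.I → ‖b‖ = 1 := fun b hb => by
    have h := congrArg norm hb
    rw [norm_pow, Complex.norm_I] at h
    exact (pow_eq_one_iff_of_nonneg (norm_nonneg _) (by norm_num)).1 h
  obtain ⟨s, hs, h1⟩ := sq_split (η ^ 2) (a ^ 2 * ξ ^ 2)
  have : ∃ b : ℂ, b ^ 4 = Complex.I ∧ s * (a ^ 2 * ξ ^ 2) = (b * ξ) ^ 2 := by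
    rcases hs with rfl | rfl
    · exact ⟨a, ha, by ring⟩
    · refine ⟨Complex.I * a, ?_, ?_⟩
      · rw [mul_pow, Complex.I_pow_four, ha, one_mul]
      · rw [mul_pow, mul_pow, Complex.I_sq]; ring
  obtain ⟨b, hb, hb2⟩ := this
  rw [hb2] at h1
  obtain ⟨s', hs', h2⟩ := sq_split η (b * ξ)
  refine ⟨s' * b, ?_, ?_⟩
  · rw [mul_pow, hb]; rcases hs' with rfl | rfl <;> norm_num
  · rw [show (η ^ 2) ^ 2 - (a ^ 2 * ξ ^ 2) ^ 2 = η ^ 4 - a ^ 4 * ξ ^ 4 by ring, ha] at h1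
    rw [norm_mul, norm_pow, norm_pow, hn a ha, one_pow, one_mul] at h1
    rw [norm_mul b, hn b hb, one_mul, ← mul_assoc] at h2
    calc _ = (‖η - s' * b * ξ‖ * ‖ξ‖) * ‖ξ‖ ^ 2 := by ring
      _ ≤ ‖η ^ 2 - (b * ξ) ^ 2‖ * ‖ξ‖ ^ 2 := by gcongr
      _ ≤ _ := h1

lemma start : ∃ τ : ℂ, τ ^ 4 = Complex.I ∧ ∀ r : ℕ,
    ‖(3 - 2 * Complex.I) * Lq r (-120 - 119 * Complex.I) (-119 - 120 * Complex.I) -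
      τ * (3 + 2 * Complex.I) * Lq r (-119 - 120 * Complex.I) (-120 - 119 * Complex.I)‖ * 32 ^ r
      ≤ 0.00767 := by
  obtain ⟨τ, hτ, h⟩ := near_root (3 - 2 * Complex.I) (3 + 2 * Complex.I)
  refine ⟨τ, hτ, fun r => ?_⟩
  have hI := Complex.I_sq
  have hy4 : (3 - 2 * Complex.I) ^ 4 = -119 - 120 * Complex.I := by
    linear_combination (16 * Complex.I ^ 2 - 96 * Complex.I + 200) * hI
  have hx4 : (τ * (3 + 2 * Complex.I)) ^ 4 = -120 - 119 * Complex.I := by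
    rw [mul_pow, hτ]
    linear_combination (16 * Complex.I ^ 3 + 96 * Complex.I ^ 2 + 200 * Complex.I + 120) * hI
  have hτn : ‖τ‖ = 1 := by
    have h := congrArg norm hτ
    rw [norm_pow, Complex.norm_I] at h
    exact (pow_eq_one_iff_of_nonneg (norm_nonneg _) (by norm_num)).1 h
  have hn1 : ‖3 - 2 * Complex.I‖ ^ 2 = 13 := by
    rw [Complex.sq_norm, Complex.normSq_apply]; norm_num
  have hn2 : ‖3 + 2 * Complex.I‖ ^ 2 = 13 := by
    rw [Complex.sq_norm, Complex.normSq_apply]; norm_num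
  have hn3 : ‖1 - Complex.I‖ ^ 2 = 2 := by
    rw [Complex.sq_norm, Complex.normSq_apply]; norm_num
  rw [show (3 - 2 * Complex.I) ^ 4 - Complex.I * (3 + 2 * Complex.I) ^ 4 = 1 - Complex.I by
    rw [mul_pow, hτ] at hx4; rw [hx4, hy4]; ring] at h
  set x := τ * (3 + 2 * Complex.I) with hx
  set y := 3 - 2 * Complex.I with hy
  have hnx : ‖x‖ ^ 2 = 13 := by rw [hx, norm_mul, hτn, one_mul]; exact hn2
  have hx32 : ‖3 + 2 * Complex.I‖ = ‖x‖ := by rw [hx, norm_mul, hτn, one_mul]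
  rw [hx32] at h
  have hxy : ‖y‖ = ‖x‖ := by
    rw [← sq_eq_sq₀ (norm_nonneg _) (norm_nonneg _), hn1, hnx]
  have hlow : 3.6 ≤ ‖x‖ := by nlinarith [norm_nonneg x]
  have hup : ‖x‖ ≤ 3.61 := by nlinarith [norm_nonneg x]
  have h2up : ‖1 - Complex.I‖ ≤ 1.4143 := by nlinarith [norm_nonneg (1 - Complex.I)]
  have hd0 := norm_nonneg (y - x)
  have hd1 : ‖y - x‖ ≤ 0.0303 := by
    have : ‖x‖ ^ 3 = 13 * ‖x‖ := by rw [pow_succ, hnx]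
    rw [this] at h
    nlinarith
  have hs1 : 7.16 ≤ ‖y + x‖ := by
    have h1 : ‖(y + x) - (y - x)‖ ≤ ‖y + x‖ + ‖y - x‖ := norm_sub_le _ _
    rw [show (y + x) - (y - x) = 2 * x by ring, norm_mul, Complex.norm_ofNat] at h1
    linarith
  have hs1' : ‖y + x‖ ≤ 7.22 := by
    have := norm_add_le y x; linarith
  have hs2 : 25.78 ≤ ‖y ^ 2 + x ^ 2‖ := by
    have h1 : ‖(y ^ 2 + x ^ 2) - (y - x) * (y + x)‖ ≤ ‖y ^ 2 + x ^ 2‖ + ‖(y - x) * (y + x)‖ :=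
      norm_sub_le _ _
    rw [show (y ^ 2 + x ^ 2) - (y - x) * (y + x) = 2 * x ^ 2 by ring, norm_mul, Complex.norm_ofNat,
      norm_pow, hnx, norm_mul] at h1
    nlinarith [norm_nonneg (y + x)]
  have hd2 : ‖y - x‖ ≤ 0.00767 := by
    have e : ‖y - x‖ * (‖y + x‖ * ‖y ^ 2 + x ^ 2‖) = ‖1 - Complex.I‖ := by
      rw [← norm_mul, ← norm_mul]
      congr 1
      have : (y - x) * ((y + x) * (y ^ 2 + x ^ 2)) = y ^ 4 - x ^ 4 := by ring
      rw [this, hy4, hx4]; ring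
    have h3 : 7.16 * 25.78 ≤ ‖y + x‖ * ‖y ^ 2 + x ^ 2‖ := by gcongr
    nlinarith
  have hseg : ∀ t ∈ segment ℝ x y, 3.59 ≤ ‖t‖ := by
    intro t ht
    have h1 := dist_add_dist_of_mem_segment ht
    rw [dist_eq_norm, dist_eq_norm, dist_eq_norm, norm_sub_rev x y] at h1
    have h2 := norm_nonneg (t - y)
    have h3 := norm_sub_norm_le x t
    linarith
  have hW := W_bound r x y ‖x‖ 3.59 (by norm_num) le_rfl hxy.le hseg
  rw [hx4, hy4] at hW
  have h6 : ‖x‖ ^ 6 = 2197 := by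
    rw [show ‖x‖ ^ 6 = (‖x‖ ^ 2) ^ 3 by ring, hnx]; norm_num
  rw [h6, ← mul_pow] at hW
  have h7 : 8 * (4 * 2197 * ‖y - x‖ ^ 2 / 3.59 ^ 4) ≤ 1 / 32 := by
    have : ‖y - x‖ ^ 2 ≤ 0.00767 ^ 2 := by gcongr
    rw [← mul_div_assoc, div_le_iff₀ (by norm_num)]
    nlinarith
  calc _ ≤ (((1 : ℝ) / 32) ^ r * 0.00767) * 32 ^ r := by
        refine mul_le_mul_of_nonneg_right (hW.trans ?_) (by positivity)
        gcongr
    _ = 0.00767 := by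
        have : ((1 : ℝ) / 32) ^ r * 32 ^ r = 1 := by rw [← mul_pow]; norm_num
        linear_combination 0.00767 * this

lemma Lq_map (r : ℕ) (A B : GaussianInt) :
    ((Lq r A B : GaussianInt) : ℂ) = Lq r (A : ℂ) (B : ℂ) := by
  unfold Lq
  simp [map_sum]

lemma one_le_norm (z : GaussianInt) (hz : z ≠ 0) : 1 ≤ ‖(z : ℂ)‖ := by
  have h1 : 0 < z.norm := GaussianInt.norm_pos.2 hz
  have h2 : (1 : ℝ) ≤ z.norm := by exact_mod_cast h1
  rw [GaussianInt.intCast_real_norm, ← Complex.sq_norm] at h2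
  nlinarith [norm_nonneg (z : ℂ)]

lemma rot (σ τ : ℂ) (hσ : σ ^ 4 = Complex.I) (hτ : τ ^ 4 = Complex.I) :
    ∃ u : GaussianInt, σ = u * τ ∧ ‖(u : ℂ)‖ = 1 := by
  have h : (σ - τ) * ((σ + τ) * ((σ - Complex.I * τ) * (σ + Complex.I * τ))) = 0 := by
    linear_combination hσ - hτ - τ ^ 2 * (σ ^ 2 - τ ^ 2) * Complex.I_sq
  rcases mul_eq_zero.1 h with h | h
  · exact ⟨1, by simp; linear_combination h, by simp⟩
  rcases mul_eq_zero.1 h with h | h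
  · exact ⟨-1, by simp; linear_combination h, by simp⟩
  rcases mul_eq_zero.1 h with h | h
  · exact ⟨⟨0, 1⟩, by simp [GaussianInt.toComplex_def]; linear_combination h, by simp [GaussianInt.toComplex_def]⟩
  · exact ⟨⟨0, -1⟩, by simp [GaussianInt.toComplex_def]; linear_combination h, by simp [GaussianInt.toComplex_def]⟩

lemma key (ξ : GaussianInt)
    (h : ‖((star ξ : GaussianInt) : ℂ) ^ 4 - Complex.I * (ξ : ℂ) ^ 4‖ ≤ 1.4143)
    (hs : 2 ^ 36 < ‖(ξ : ℂ)‖) : False := by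
  obtain ⟨τ, hτ, hL⟩ := start
  obtain ⟨σ, hσ, hΛ⟩ := near_root ((star ξ : GaussianInt) : ℂ) (ξ : ℂ)
  replace hΛ := hΛ.trans h
  obtain ⟨u, hu, hun⟩ := rot σ τ hσ hτ
  obtain ⟨r, hr1, hr2⟩ := exists_nat_pow_near (x := ‖(ξ : ℂ)‖ / 2) (y := 32) (by linarith) (by norm_num)
  have hr7 : 7 ≤ r := by
    by_contra hcon
    have h1 : (32 : ℝ) ^ (r + 1) ≤ 32 ^ 7 := pow_le_pow_right₀ (by norm_num) (by omega)
    norm_num at h1 hs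
    linarith
  let gX : GaussianInt := ⟨-120, -119⟩
  let gY : GaussianInt := ⟨-119, -120⟩
  let g0 : GaussianInt := ⟨3, 2⟩
  let g1 : GaussianInt := ⟨3, -2⟩
  have cX : (gX : ℂ) = -120 - 119 * Complex.I := by
    simp [gX, GaussianInt.toComplex_def]; ring
  have cY : (gY : ℂ) = -119 - 120 * Complex.I := by
    simp [gY, GaussianInt.toComplex_def]; ring
  have c0 : (g0 : ℂ) = 3 + 2 * Complex.I := by
    simp [g0, GaussianInt.toComplex_def]
  have c1 : (g1 : ℂ) = 3 - 2 * Complex.I := by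
    simp [g1, GaussianInt.toComplex_def]; ring
  rw [← cX, ← cY, ← c0, ← c1] at hL
  have hn0 : ‖(g0 : ℂ)‖ ≤ 3.606 := by
    have : ‖(g0 : ℂ)‖ ^ 2 = 13 := by
      rw [c0, Complex.sq_norm, Complex.normSq_apply]; norm_num
    nlinarith [norm_nonneg (g0 : ℂ)]
  have hnX : ‖(gX : ℂ)‖ ≤ 169 := by
    have : ‖(gX : ℂ)‖ ^ 2 = 169 ^ 2 := by
      rw [cX, Complex.sq_norm, Complex.normSq_apply]; norm_num
    nlinarith [norm_nonneg (gX : ℂ)]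
  have hnY : ‖(gY : ℂ)‖ ≤ 169 := by
    have : ‖(gY : ℂ)‖ ^ 2 = 169 ^ 2 := by
      rw [cY, Complex.sq_norm, Complex.normSq_apply]; norm_num
    nlinarith [norm_nonneg (gY : ℂ)]
  set s := ‖(ξ : ℂ)‖ with hsdef
  set η : ℂ := ((star ξ : GaussianInt) : ℂ) with hη
  set Λ := ‖η - σ * ξ‖ with hΛdef
  have hs0 : 0 < s := by linarith [show (0 : ℝ) < 2 ^ 36 by norm_num]
  have hΛ0 : 0 ≤ Λ := norm_nonneg _
  -- smallness of the second part
  have hΛ2 : Λ * 8192 ^ (r + 1) ≤ 0.1 := by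
    have h1 : (2 * 32 ^ r) ^ 3 ≤ s ^ 3 := by gcongr; linarith
    have h2 : (4 : ℝ) ^ 7 ≤ 4 ^ r := pow_le_pow_right₀ (by norm_num) hr7
    have h3 : ((2 : ℝ) * 32 ^ r) ^ 3 = 8 * 8192 ^ r * 4 ^ r := by
      have : (8192 : ℝ) ^ r * 4 ^ r = (32 ^ r) ^ 3 := by
        rw [← mul_pow, ← pow_mul, mul_comm r 3, pow_mul]; norm_num
      rw [mul_pow]; linear_combination -8 * this
    rw [h3] at h1
    have h4 : Λ * (8 * 8192 ^ r * 4 ^ 7) ≤ 1.4143 := by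
      refine le_trans ?_ hΛ
      gcongr
      refine le_trans ?_ h1
      gcongr
    rw [pow_succ]
    norm_num at h4 ⊢
    linarith
  have main : ∀ t, r ≤ t → t ≤ r + 1 →
      (star ξ) * g0 * Lq t gY gX - u * ξ * g1 * Lq t gX gY = 0 := by
    intro t ht1 ht2
    by_contra hne
    have hge := one_le_norm _ hne
    have e : (((star ξ) * g0 * Lq t gY gX - u * ξ * g1 * Lq t gX gY : GaussianInt) : ℂ) =
      (η - σ * ξ) * g0 * Lq t (gY : ℂ) gX -
        u * ξ * (g1 * Lq t (gX : ℂ) gY - τ * g0 * Lq t (gY : ℂ) gX) := by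
      rw [hu]
      simp only [GaussianInt.toComplex_sub, GaussianInt.toComplex_mul, Lq_map]
      rw [← hη]
      ring
    rw [e] at hge
    have hle := norm_sub_le ((η - σ * ξ) * g0 * Lq t (gY : ℂ) gX)
      (u * ξ * (g1 * Lq t (gX : ℂ) gY - τ * g0 * Lq t (gY : ℂ) gX))
    rw [norm_mul, norm_mul, norm_mul, norm_mul, hun, one_mul, ← hsdef, ← hΛdef] at hle
    have b1 : ‖Lq t (gY : ℂ) gX‖ ≤ 8192 ^ (r + 1) := by
      refine (Lq_norm_le t _ _ 169 hnY hnX).trans ?_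
      rw [← mul_pow]
      calc ((32 : ℝ) * 169) ^ t ≤ 8192 ^ t := by gcongr; norm_num
        _ ≤ _ := pow_le_pow_right₀ (by norm_num) ht2
    have b2 : Λ * ‖(g0 : ℂ)‖ * ‖Lq t (gY : ℂ) gX‖ ≤ 0.4 := by
      calc _ ≤ Λ * 3.606 * 8192 ^ (r + 1) := by gcongr
        _ = 3.606 * (Λ * 8192 ^ (r + 1)) := by ring
        _ ≤ 0.4 := by linarith
    have b3 : s * ‖(g1 : ℂ) * Lq t (gX : ℂ) gY - τ * g0 * Lq t (gY : ℂ) gX‖ ≤ 0.5 := by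
      have h1 := hL t
      set w := ‖(g1 : ℂ) * Lq t (gX : ℂ) gY - τ * g0 * Lq t (gY : ℂ) gX‖
      have hw : 0 ≤ w := norm_nonneg _
      have h2 : (32 : ℝ) ^ r ≤ 32 ^ t := pow_le_pow_right₀ (by norm_num) ht1
      calc s * w ≤ (64 * 32 ^ t) * w := by
            gcongr
            rw [pow_succ] at hr2
            linarith
        _ = 64 * (w * 32 ^ t) := by ring
        _ ≤ 0.5 := by linarith
    linarith
  have m1 := congrArg GaussianInt.toComplex (main r le_rfl (by omega))
  have m2 := congrArg GaussianInt.toComplex (main (r + 1) (by omega) le_rfl)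
  simp only [GaussianInt.toComplex_sub, GaussianInt.toComplex_mul, Lq_map, map_zero] at m1 m2
  have hY0 : (gY : ℂ) ≠ 0 := by
    rw [Ne, GaussianInt.toComplex_eq_zero]; decide
  have hXY : (gX : ℂ) ≠ gY := by
    rw [Ne, GaussianInt.toComplex_inj]; decide
  have hdet := det_ne r (gX : ℂ) gY hY0 hXY
  have h00 : (g0 : ℂ) ≠ 0 := by
    rw [Ne, GaussianInt.toComplex_eq_zero]; decide
  have hξ0 : ξ ≠ 0 := by
    rintro rfl; simp [hsdef] at hs0
  have hη0 : η ≠ 0 := by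
    rw [hη, Ne, GaussianInt.toComplex_eq_zero, star_eq_zero]; exact hξ0
  apply hdet
  have : η * g0 * (Lq r (gX : ℂ) gY * Lq (r + 1) (gY : ℂ) gX - Lq r (gY : ℂ) gX * Lq (r + 1) (gX : ℂ) gY) = 0 := by
    rw [← hη] at m1 m2
    linear_combination Lq r (gX : ℂ) gY * m2 - Lq (r + 1) (gX : ℂ) gY * m1
  rcases mul_eq_zero.1 this with h | h
  · exact absurd h (mul_ne_zero hη0 h00)
  · exact h

lemma descent (p n : ℕ) (h : p ^ 4 = 8 * n ^ 2 + 4 * n + 1) :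
    ∃ ξ : GaussianInt, ξ.norm = p ∧ ∃ e : GaussianInt, (e = 1 ∨ e = -1) ∧
      (star ξ) ^ 4 - ⟨0, 1⟩ * ξ ^ 4 = e * ⟨1, -1⟩ := by
  have hz : (p : ℤ) ^ 4 = 8 * n ^ 2 + 4 * n + 1 := by exact_mod_cast h
  set β : GaussianInt := ⟨2 * n + 1, -(2 * n)⟩ with hβ
  have hprod : β * star β = ((p : ℤ) : GaussianInt) ^ 4 := by
    rw [← Int.cast_pow, hz]
    ext
    · rw [Zsqrtd.re_intCast]; simp [hβ]; ring
    · rw [Zsqrtd.im_intCast]; simp [hβ]; ring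
  have hco : IsCoprime β (star β) := by
    refine ⟨star β - (2 * n + 1) * ⟨0, 1⟩, (2 * n + 1) * ⟨0, 1⟩, ?_⟩
    ext
    · simp [hβ]; ring
    · simp [hβ]; ring
  obtain ⟨d, u, hu⟩ := exists_associated_pow_of_mul_eq_pow' hco hprod
  have hun : (u : GaussianInt).norm = 1 :=
    (Zsqrtd.norm_eq_one_iff' (by norm_num) _).2 u.isUnit
  have hd : d.norm = p := by
    have h1 := congrArg Zsqrtd.norm hu
    have hβn : β.norm = (p : ℤ) ^ 4 := by rw [hz]; simp [hβ, Zsqrtd.norm_def]; ring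
    rw [Zsqrtd.norm_mul, hun, mul_one, hβn, show d ^ 4 = d * d * (d * d) by ring] at h1
    simp only [Zsqrtd.norm_mul] at h1
    have h2 : d.norm ^ 4 = (p : ℤ) ^ 4 := by rw [← h1]; ring
    exact (pow_left_inj₀ (GaussianInt.norm_nonneg d) (by positivity) (by norm_num)).1 h2
  refine ⟨d, hd, ?_⟩
  obtain ⟨v, hv⟩ : ∃ v : GaussianInt, v = u := ⟨_, rfl⟩
  rw [← hv] at hu hun
  rw [Zsqrtd.norm_def] at hun
  have hre := congrArg Zsqrtd.re hu
  have him4 : (d ^ 4).im = 2 * (2 * (d.re * d.im * (d.re ^ 2 - d.im ^ 2))) := by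
    rw [show d ^ 4 = d * d * (d * d) by ring]; simp; ring
  have hv0 : v.im = 0 := by
    by_contra hne
    have h1 : 0 < v.im ^ 2 := by positivity
    have h2 : v.re = 0 := by
      by_contra hne2
      have h3 : 0 < v.re ^ 2 := by positivity
      nlinarith
    simp only [Zsqrtd.re_mul, h2, him4, hβ] at hre
    have : 2 * (-(2 * (d.re * d.im * (d.re ^ 2 - d.im ^ 2))) * v.im) = 2 * (n : ℤ) + 1 := by
      linear_combination hre
    omega
  have hv1 : v = 1 ∨ v = -1 := by
    rw [hv0] at hun
    have : (v.re - 1) * (v.re + 1) = 0 := by linear_combination hun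
    rcases mul_eq_zero.1 this with h | h
    · left; ext
      · simp; linarith
      · simp [hv0]
    · right; ext
      · simp; linarith
      · simp [hv0]
  refine ⟨v, hv1, ?_⟩
  have hvv : v * v = 1 := by rcases hv1 with h | h <;> rw [h] <;> ring
  have hsv : star v = v := by rcases hv1 with h | h <;> rw [h] <;> simp
  have hd4 : d ^ 4 = v * β := by rw [← hu]; linear_combination (-d ^ 4) * hvv
  rw [← star_pow, hd4, star_mul, hsv]
  have : star β - ⟨0, 1⟩ * β = ⟨1, -1⟩ := by
    ext
    · simp [hβ]
    · simp [hβ]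
  rw [← this]; ring

/-- there are no positive integers `p`, `n` with `p^4 = 8n² + 4n + 1`. -/
theorem stmt15 : ¬ ∃ p n : ℕ, 0 < p ∧ 0 < n ∧ p ^ 4 = 8 * n ^ 2 + 4 * n + 1 := by
  rintro ⟨p, n, -, hn, h⟩
  have hp := small_p p n hn h
  obtain ⟨ξ, hξ, e, he, h4⟩ := descent p n h
  have hsq : ‖(ξ : ℂ)‖ ^ 2 = p := by
    rw [Complex.sq_norm, ← GaussianInt.intCast_real_norm, hξ]; simp
  refine key ξ ?_ ?_
  · have h5 := congrArg GaussianInt.toComplex h4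
    have hi : GaussianInt.toComplex ⟨0, 1⟩ = Complex.I := by simp [GaussianInt.toComplex_def]
    rw [map_sub, map_mul, map_mul, map_pow, map_pow, hi] at h5
    rw [h5, norm_mul]
    have h6 : ‖GaussianInt.toComplex e‖ = 1 := by rcases he with rfl | rfl <;> simp
    have h7 : ‖GaussianInt.toComplex ⟨1, -1⟩‖ ^ 2 = 2 := by
      rw [Complex.sq_norm, ← GaussianInt.intCast_real_norm]; norm_num [Zsqrtd.norm_def]
    rw [h6, one_mul]
    nlinarith [norm_nonneg (GaussianInt.toComplex ⟨1, -1⟩)]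
  · have h1 : (2 : ℝ) ^ 72 < p := by exact_mod_cast hp
    rw [← hsq] at h1
    refine lt_of_pow_lt_pow_left₀ 2 (norm_nonneg _) ?_
    rw [← pow_mul]; exact h1
end

section
/- Let π = 2 + 3i ∈ ℤ[i], so that 𝔽 = ℤ[i]/(π) is a field with 13 elements. Let C ⊆ 𝔽⁴ be an 𝔽-linear subspace that is self-dual, i.e., C = C^⊥ where C^⊥ = { x ∈ 𝔽⁴ : Σ_{j=1}^{4} x_j c_j = 0 for all c ∈ C }. Then C contains a nonzero codeword of Mannheim weight at most 5; that is, the minimum Mannheim distance of C satisfies d_π(C) ≤ 5. -/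
open scoped Classical

noncomputable section

/-- The Euclidean dual of a linear code `C ⊆ R^n`. -/
def dualCode {R : Type*} [CommRing R] {n : ℕ} (C : Submodule R (Fin n → R)) :
    Submodule R (Fin n → R) where
  carrier := { x | ∀ c ∈ C, ∑ j, x j * c j = 0 }
  add_mem' := by
    intro x y hx hy c hc
    have : (∑ j, (x + y) j * c j) = (∑ j, x j * c j) + ∑ j, y j * c j := by
      rw [← Finset.sum_add_distrib]
      exact Finset.sum_congr rfl fun j _ => by simp [add_mul]
    simp only [Set.mem_setOf_eq] at *
    rw [this, hx c hc, hy c hc, add_zero]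
  zero_mem' := by
    intro c hc
    simp
  smul_mem' := by
    intro r x hx c hc
    have : (∑ j, (r • x) j * c j) = r * ∑ j, x j * c j := by
      rw [Finset.mul_sum]
      exact Finset.sum_congr rfl fun j _ => by simp [mul_assoc]
    simp only [Set.mem_setOf_eq] at *
    rw [this, hx c hc, mul_zero]


abbrev P0 : GaussianInt := ⟨2, 3⟩

lemma gmk_eq (z w q : GaussianInt) (h : z - w = P0 * q) : gmk P0 z = gmk P0 w := by
  unfold gmk
  rw [Ideal.Quotient.eq, Ideal.mem_span_singleton]
  exact ⟨q, h⟩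

lemma mWt_le_s17 (z : GaussianInt) : mWt P0 (gmk P0 z) ≤ z.re.natAbs + z.im.natAbs :=
  Nat.sInf_le ⟨z, rfl, rfl⟩

lemma mWt_zero : mWt P0 0 = 0 := by
  have := mWt_le_s17 0
  simpa using this

lemma mWt_one : mWt P0 1 ≤ 1 := by
  have := mWt_le_s17 1
  simpa using this

lemma one_ne : (1 : GQuot P0) ≠ 0 := by
  intro h
  have h1 : gmk P0 1 = 0 := by rw [map_one, h]
  unfold gmk at h1
  rw [Ideal.Quotient.eq_zero_iff_mem, Ideal.mem_span_singleton] at h1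
  obtain ⟨⟨a, b⟩, h⟩ := h1
  have h2 := congrArg Zsqrtd.re h
  have h3 := congrArg Zsqrtd.im h
  simp at h2 h3
  omega

lemma rep (α : GQuot P0) : ∃ k : ℕ, k < 13 ∧ α = gmk P0 ⟨k, 0⟩ := by
  obtain ⟨⟨a, b⟩, rfl⟩ := Ideal.Quotient.mk_surjective α
  refine ⟨((a + 8 * b) % 13).toNat, by omega, ?_⟩
  have e : (((a + 8 * b) % 13).toNat : ℤ) = (a + 8 * b) - 13 * ((a + 8 * b) / 13) := by omega
  rw [e]
  generalize (a + 8 * b) / 13 = t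
  refine gmk_eq _ _ (⟨-b, 2 * b⟩ + ⟨2 * t, -3 * t⟩) ?_
  ext <;> simp <;> ring

lemma wt_inv (α : GQuot P0) : mWt P0 α ≤ 2 ∧ (α ≠ 0 → ∃ β, β * α = 1) := by
  obtain ⟨k, hk, rfl⟩ := rep α
  have key : ∀ (w : GaussianInt) (n : ℕ) (t : ℤ), gmk P0 ⟨k, 0⟩ = gmk P0 w →
      w.re.natAbs + w.im.natAbs ≤ 2 → (n : ℤ) * k - 1 = 13 * t →
      mWt P0 (gmk P0 ⟨k, 0⟩) ≤ 2 ∧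
        (gmk P0 ⟨k, 0⟩ ≠ 0 → ∃ β, β * gmk P0 ⟨k, 0⟩ = 1) := by
    intro w n t h1 h2 h3
    constructor
    · rw [h1]; exact (mWt_le_s17 w).trans h2
    · intro _
      refine ⟨gmk P0 ⟨n, 0⟩, ?_⟩
      rw [← map_mul, ← map_one (gmk P0)]
      refine gmk_eq _ _ ⟨2 * t, -3 * t⟩ ?_
      ext
      · simp; linarith
      · simp; ring
  interval_cases k
  · have : gmk P0 ⟨((0 : ℕ) : ℤ), 0⟩ = 0 := map_zero _
    rw [this]
    exact ⟨by rw [mWt_zero]; omega, fun h => absurd rfl h⟩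
  · exact key ⟨1, 0⟩ 1 0 (gmk_eq _ _ ⟨0, 0⟩ (by ext <;> simp)) (by decide) (by norm_num)
  · exact key ⟨2, 0⟩ 7 1 (gmk_eq _ _ ⟨0, 0⟩ (by ext <;> simp)) (by decide) (by norm_num)
  · exact key ⟨0, 2⟩ 9 2 (gmk_eq _ _ ⟨0, -1⟩ (by ext <;> simp)) (by decide) (by norm_num)
  · exact key ⟨-1, -1⟩ 10 3 (gmk_eq _ _ ⟨1, -1⟩ (by ext <;> simp)) (by decide) (by norm_num)
  · exact key ⟨0, -1⟩ 8 3 (gmk_eq _ _ ⟨1, -1⟩ (by ext <;> simp)) (by decide) (by norm_num)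
  · exact key ⟨1, -1⟩ 11 5 (gmk_eq _ _ ⟨1, -1⟩ (by ext <;> simp)) (by decide) (by norm_num)
  · exact key ⟨-1, 1⟩ 2 1 (gmk_eq _ _ ⟨1, -2⟩ (by ext <;> simp)) (by decide) (by norm_num)
  · exact key ⟨0, 1⟩ 5 3 (gmk_eq _ _ ⟨1, -2⟩ (by ext <;> simp)) (by decide) (by norm_num)
  · exact key ⟨1, 1⟩ 3 2 (gmk_eq _ _ ⟨1, -2⟩ (by ext <;> simp)) (by decide) (by norm_num)
  · exact key ⟨0, -2⟩ 4 3 (gmk_eq _ _ ⟨2, -2⟩ (by ext <;> simp)) (by decide) (by norm_num)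
  · exact key ⟨-2, 0⟩ 6 5 (gmk_eq _ _ ⟨2, -3⟩ (by ext <;> simp)) (by decide) (by norm_num)
  · exact key ⟨-1, 0⟩ 12 11 (gmk_eq _ _ ⟨2, -3⟩ (by ext <;> simp)) (by decide) (by norm_num)

theorem exists_zero (C : Submodule (GQuot P0) (Fin 4 → GQuot P0)) (hsd : C = dualCode C) :
    ∃ c ∈ C, c ≠ 0 ∧ c 0 = 0 := by
  by_contra! H
  have hm : ∀ x, (∀ c ∈ C, ∑ j, x j * c j = 0) → x ∈ C := by
    intro x hx
    rw [hsd]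
    exact hx
  have e1 : (![0, 1, 0, 0] : Fin 4 → GQuot P0) ≠ 0 := fun h => one_ne (congrFun h 1)
  by_cases hC : ∃ c ∈ C, c ≠ 0
  · obtain ⟨c, hc, hc0⟩ := hC
    obtain ⟨β, hβ⟩ := (wt_inv (c 0)).2 (H c hc hc0)
    have hsp : ∀ d ∈ C, d = (d 0 * β) • c := by
      intro d hd
      have h1 : d - (d 0 * β) • c ∈ C := C.sub_mem hd (C.smul_mem _ hc)
      by_contra hne
      refine H _ h1 (sub_ne_zero.mpr hne) ?_
      simp [mul_assoc, hβ]
    have hm2 : ∀ x, (∑ j, x j * c j = 0) → x ∈ C := by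
      intro x hx
      apply hm
      intro d hd
      rw [hsp d hd]
      have : ∑ j, x j * ((d 0 * β) • c) j = (d 0 * β) * ∑ j, x j * c j := by
        rw [Finset.mul_sum]
        exact Finset.sum_congr rfl fun j _ => by simp; ring
      rw [this, hx, mul_zero]
    by_cases hx : (![0, c 2, -c 1, 0] : Fin 4 → GQuot P0) = 0
    · have h1 : c 1 = 0 := by simpa using congrFun hx 2
      exact H _ (hm2 ![0, 1, 0, 0] (by simp [Fin.sum_univ_four, h1])) e1 rfl
    · exact H _ (hm2 _ (by simp [Fin.sum_univ_four]; ring)) hx rfl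
  · push Not at hC
    refine H _ (hm ![0, 1, 0, 0] ?_) e1 rfl
    intro c hc
    simp [hC c hc]

/-- a self-dual code `C ⊆ 𝔽⁴`, `𝔽 = ℤ[i]/(2+3i) ≅ 𝔽₁₃`, contains a nonzero
codeword of Mannheim weight at most 5, i.e. `d_π(C) ≤ 5`. -/
theorem stmt17 (C : Submodule (GQuot (⟨2, 3⟩ : GaussianInt))
      (Fin 4 → GQuot (⟨2, 3⟩ : GaussianInt)))
    (hsd : C = dualCode C) :
    ∃ c ∈ C, c ≠ 0 ∧ mWtVec (⟨2, 3⟩ : GaussianInt) c ≤ 5 := by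
  obtain ⟨c, hc, hne, h0⟩ := exists_zero C hsd
  obtain ⟨j, hj⟩ : ∃ j, c j ≠ 0 := by
    by_contra! h
    exact hne (funext h)
  obtain ⟨β, hβ⟩ := (wt_inv (c j)).2 hj
  refine ⟨β • c, C.smul_mem _ hc, ?_, ?_⟩
  · intro h
    have := congrFun h j
    simp only [Pi.smul_apply, smul_eq_mul, Pi.zero_apply] at this
    rw [hβ] at this
    exact one_ne this
  · have w0 : mWt P0 ((β • c) 0) = 0 := by
      simp only [Pi.smul_apply, smul_eq_mul, h0, mul_zero]
      exact mWt_zero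
    have wj : mWt P0 ((β • c) j) ≤ 1 := by
      simp only [Pi.smul_apply, smul_eq_mul, hβ]
      exact mWt_one
    have w1 := (wt_inv ((β • c) 1)).1
    have w2 := (wt_inv ((β • c) 2)).1
    have w3 := (wt_inv ((β • c) 3)).1
    change mWtVec P0 (β • c) ≤ 5
    unfold mWtVec
    rw [Fin.sum_univ_four]
    have hj' : j = 0 ∨ j = 1 ∨ j = 2 ∨ j = 3 := by
      omega
    rcases hj' with rfl | rfl | rfl | rfl
    · exact absurd h0 hj
    all_goals omega
end
end

section
/- Let π = 1 + 4i ∈ ℤ[i], so that 𝔽 = ℤ[i]/(π) is a field with 17 elements. Let C ⊆ 𝔽⁶ be an 𝔽-linear subspace that is self-dual, i.e., C = C^⊥ where C^⊥ = { x ∈ 𝔽⁶ : Σ_{j=1}^{6} x_j c_j = 0 for all c ∈ C }. Then C contains a nonzero codeword of Mannheim weight at most 6; that is, the minimum Mannheim distance of C satisfies d_π(C) ≤ 6. -/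
open scoped Classical

noncomputable section

/-- Weight table of `ℤ[i]/(1+4i)`, indexed by residues mod 17, packed in base 4. -/
def wN (n : ℕ) : ℕ := (7096433060 / 4 ^ (n % 17)) % 4

def isoChk (a b c : ℕ) : Bool :=
  (! Nat.beq ((a*a+b*b+c*c) % 17) 0) || Nat.beq (a+b+c) 0 ||
    (List.range 17).any fun k =>
      Nat.ble 1 (wN (k*a) + wN (k*b) + wN (k*c)) && Nat.ble (wN (k*a) + wN (k*b) + wN (k*c)) 6

theorem isoAll : ((List.range 17).all fun a => (List.range 17).all fun b =>
    (List.range 17).all fun c => isoChk a b c) = true := by decide +kernel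

def cand (a b c : ℕ) : Bool :=
  Nat.beq ((a*a+b*b+c*c) % 17) 16 && Nat.ble 6 (wN a + wN b + wN c)

def candL : List (ℕ × ℕ × ℕ) :=
  (List.range 17).flatMap fun a => (List.range 17).flatMap fun b =>
    ((List.range 17).filter fun c => cand a b c).map fun c => (a, b, c)

def pairW (s t : ℕ) (r q : ℕ × ℕ × ℕ) : ℕ :=
  wN s + wN t + wN (s*r.1+t*q.1) + wN (s*r.2.1+t*q.2.1) + wN (s*r.2.2+t*q.2.2)

def pairChk (r q : ℕ × ℕ × ℕ) : Bool :=
  (! Nat.beq ((r.1*q.1+r.2.1*q.2.1+r.2.2*q.2.2) % 17) 0) ||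
    [1,2,3,6].any fun s => (List.range 17).any fun t =>
      Nat.ble 1 (pairW s t r q) && Nat.ble (pairW s t r q) 6

theorem pairAll : (candL.all fun r => candL.all fun q => pairChk r q) = true := by
  decide +kernel

theorem mem_candL {a b c : ℕ} (ha : a < 17) (hb : b < 17) (hc : c < 17)
    (h : cand a b c = true) : (a, b, c) ∈ candL := by
  simp only [candL, List.mem_flatMap, List.mem_map, List.mem_filter, List.mem_range]
  exact ⟨a, ha, b, hb, c, ⟨hc, h⟩, rfl⟩

theorem iso_spec {a b c : ℕ} (ha : a < 17) (hb : b < 17) (hc : c < 17)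
    (h : (a*a+b*b+c*c) % 17 = 0) (h0 : a + b + c ≠ 0) :
    ∃ k, 1 ≤ wN (k*a) + wN (k*b) + wN (k*c) ∧ wN (k*a) + wN (k*b) + wN (k*c) ≤ 6 := by
  have h1 := isoAll
  rw [List.all_eq_true] at h1
  have h2 := h1 a (List.mem_range.2 ha)
  rw [List.all_eq_true] at h2
  have h3 := h2 b (List.mem_range.2 hb)
  rw [List.all_eq_true] at h3
  have h4 := h3 c (List.mem_range.2 hc)
  unfold isoChk at h4
  rw [Bool.or_eq_true, Bool.or_eq_true, List.any_eq_true] at h4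
  rcases h4 with (h4 | h4) | ⟨k, -, h4⟩
  · rw [h] at h4; exact absurd h4 (by decide)
  · exact absurd (Nat.eq_of_beq_eq_true h4) h0
  · rw [Bool.and_eq_true] at h4
    exact ⟨k, Nat.le_of_ble_eq_true h4.1, Nat.le_of_ble_eq_true h4.2⟩

theorem pair_spec {r q : ℕ × ℕ × ℕ} (hr : r ∈ candL) (hq : q ∈ candL)
    (h : (r.1*q.1+r.2.1*q.2.1+r.2.2*q.2.2) % 17 = 0) :
    ∃ s t, 1 ≤ pairW s t r q ∧ pairW s t r q ≤ 6 := by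
  have h1 := pairAll
  rw [List.all_eq_true] at h1
  have h2 := h1 r hr
  rw [List.all_eq_true] at h2
  have h4 := h2 q hq
  unfold pairChk at h4
  rw [Bool.or_eq_true, List.any_eq_true] at h4
  rcases h4 with h4 | ⟨s, -, h4⟩
  · rw [h] at h4; exact absurd h4 (by decide)
  · rw [List.any_eq_true] at h4
    obtain ⟨t, -, h4⟩ := h4
    rw [Bool.and_eq_true] at h4
    exact ⟨s, t, Nat.le_of_ble_eq_true h4.1, Nat.le_of_ble_eq_true h4.2⟩

abbrev P4 : GaussianInt := ⟨1, 4⟩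

theorem gmk_eq_s19 (a b : ℤ) : gmk P4 ⟨a, b⟩ = ((a + 4 * b : ℤ) : GQuot P4) := by
  rw [← map_intCast (gmk P4)]
  unfold gmk
  rw [Ideal.Quotient.eq, Ideal.mem_span_singleton]
  refine ⟨⟨0, b⟩, ?_⟩
  ext <;> simp [P4]

theorem nat_zero_iff (n : ℕ) : (n : GQuot P4) = 0 ↔ n % 17 = 0 := by
  rw [← map_natCast (gmk P4)]
  unfold gmk
  rw [Ideal.Quotient.eq_zero_iff_mem, Ideal.mem_span_singleton]
  constructor
  · rintro ⟨⟨a, b⟩, h⟩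
    have h1 := congrArg Zsqrtd.re h
    have h2 := congrArg Zsqrtd.im h
    simp [P4] at h1 h2
    omega
  · intro h
    refine ⟨⟨(n / 17 : ℕ), -4 * (n / 17 : ℕ)⟩, ?_⟩
    ext
    · simp [P4]; omega
    · simp [P4]

theorem nat_mod (n : ℕ) : ((n % 17 : ℕ) : GQuot P4) = n := by
  have h17 : ((17 : ℕ) : GQuot P4) = 0 := (nat_zero_iff 17).2 rfl
  conv_rhs => rw [← Nat.mod_add_div n 17]
  rw [Nat.cast_add, Nat.cast_mul, h17, zero_mul, add_zero]

theorem exists_nat (α : GQuot P4) : ∃ n : ℕ, n < 17 ∧ (n : GQuot P4) = α := by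
  obtain ⟨⟨a, b⟩, rfl⟩ := Ideal.Quotient.mk_surjective α
  have h := gmk_eq_s19 a b
  unfold gmk at h
  rw [h]
  have h17 : ((17 : ℤ) : GQuot P4) = 0 := by
    have := (nat_zero_iff 17).2 rfl
    exact_mod_cast this
  refine ⟨((a + 4 * b) % 17).toNat, by omega, ?_⟩
  have h2 : (((((a + 4 * b) % 17).toNat : ℕ) : ℤ) : GQuot P4) = ((a + 4 * b : ℤ) : GQuot P4) := by
    rw [Int.toNat_of_nonneg (by omega)]
    conv_rhs => rw [← Int.emod_add_mul_ediv (a + 4 * b) 17]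
    rw [Int.cast_add, Int.cast_mul, h17, zero_mul, add_zero]
  rw [← h2, Int.cast_natCast]

theorem wN_mod (n : ℕ) : wN (n % 17) = wN n := by unfold wN; rw [Nat.mod_mod]

theorem mWt_le_aux (n : ℕ) (a b : ℤ) (h : (17 : ℤ) ∣ a + 4 * b - n) :
    mWt P4 (n : GQuot P4) ≤ a.natAbs + b.natAbs := by
  refine Nat.sInf_le ⟨⟨a, b⟩, ?_, rfl⟩
  rw [gmk_eq_s19, ← sub_eq_zero]
  obtain ⟨k, hk⟩ := h
  have h17 : ((17 : ℤ) : GQuot P4) = 0 := by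
    have := (nat_zero_iff 17).2 rfl
    exact_mod_cast this
  have : ((a + 4 * b : ℤ) : GQuot P4) - (n : GQuot P4) = ((a + 4 * b - n : ℤ) : GQuot P4) := by
    push_cast; ring
  rw [this, hk, Int.cast_mul, h17, zero_mul]

def tabA : List ℤ := [0, 1, 2, -1, 0, 1, 2, -1, 0, 0, 1, -2, -1, 0, 1, -2, -1]
def tabB : List ℤ := [0, 0, 0, 1, 1, 1, 1, 2, 2, -2, -2, -1, -1, -1, -1, 0, 0]

theorem mWt_le_s19 (n : ℕ) : mWt P4 (n : GQuot P4) ≤ wN n := by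
  rw [← nat_mod, ← wN_mod]
  have hlt : n % 17 < 17 := Nat.mod_lt _ (by norm_num)
  generalize n % 17 = r at hlt
  have key : ∀ r < 17, (17 : ℤ) ∣ tabA.getD r 0 + 4 * tabB.getD r 0 - (r : ℤ) ∧
      (tabA.getD r 0).natAbs + (tabB.getD r 0).natAbs ≤ wN r := by
    intro r hr
    interval_cases r <;> simp [tabA, tabB, wN]
  exact (mWt_le_aux r _ _ (key r hlt).1).trans (key r hlt).2

theorem wN_pos {n : ℕ} (h : 1 ≤ wN n) : (n : GQuot P4) ≠ 0 := by
  intro h0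
  rw [nat_zero_iff] at h0
  unfold wN at h
  rw [h0] at h
  norm_num at h

theorem isMax : (Ideal.span {P4}).IsMaximal := by
  apply Ideal.Quotient.maximal_of_isField
  refine ⟨⟨0, 1, ?_⟩, mul_comm, ?_⟩
  · intro h
    have := (nat_zero_iff 1).1 (by rw [Nat.cast_one]; exact h.symm)
    omega
  · intro α hα
    obtain ⟨n, hn, rfl⟩ := exists_nat α
    have hn0 : n ≠ 0 := by rintro rfl; exact hα Nat.cast_zero
    have key : ∀ n < 17, n ≠ 0 → ∃ m < 17, (n * m) % 17 = 1 := by decide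
    obtain ⟨m, -, hm⟩ := key n hn hn0
    refine ⟨(m : GQuot P4), ?_⟩
    rw [← Nat.cast_mul, ← nat_mod, hm, Nat.cast_one]

theorem finish {C : Submodule (GQuot P4) (Fin 6 → GQuot P4)} (N : Fin 6 → ℕ)
    (hN : (fun j => (N j : GQuot P4)) ∈ C) (h1 : 1 ≤ ∑ j, wN (N j)) (h6 : ∑ j, wN (N j) ≤ 6) :
    ∃ c ∈ C, c ≠ 0 ∧ mWtVec P4 c ≤ 6 := by
  refine ⟨_, hN, ?_, ?_⟩
  · intro h0
    obtain ⟨j, -, hj⟩ : ∃ j ∈ Finset.univ, wN (N j) ≠ 0 := by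
      by_contra! h
      rw [Finset.sum_eq_zero h] at h1
      omega
    exact wN_pos (Nat.one_le_iff_ne_zero.2 hj) (congrFun h0 j)
  · exact (Finset.sum_le_sum fun j _ => mWt_le_s19 (N j)).trans h6

theorem exists_functional (p : Submodule (GQuot P4) (Fin 3 → GQuot P4)) (hp : p ≠ ⊤) :
    ∃ s : Fin 3 → GQuot P4, s ≠ 0 ∧ ∀ v ∈ p, ∑ i, s i * v i = 0 := by
  have := isMax
  letI : Field (GQuot P4) := Ideal.Quotient.field _
  obtain ⟨f, hf, hle⟩ := Submodule.exists_le_ker_of_lt_top p (lt_top_iff_ne_top.2 hp)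
  have hfs : ∀ v, f v = ∑ i, f (fun j => if i = j then 1 else 0) * v i := by
    intro v
    rw [LinearMap.pi_apply_eq_sum_univ f v]
    exact Finset.sum_congr rfl fun i _ => by rw [smul_eq_mul, mul_comm]
  refine ⟨fun i => f (fun j => if i = j then 1 else 0), ?_, ?_⟩
  · intro h
    apply hf
    refine LinearMap.ext fun v => ?_
    rw [hfs]
    exact Finset.sum_eq_zero fun i _ => by
      have := congrFun h i
      simp only [Pi.zero_apply] at this
      rw [this, zero_mul]
  · intro v hv
    have := hle hv
    rw [LinearMap.mem_ker, hfs] at this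
    exact this

/-- a self-dual code `C ⊆ 𝔽⁶`, `𝔽 = ℤ[i]/(1+4i) ≅ 𝔽₁₇`, contains a nonzero
codeword of Mannheim weight at most 6, i.e. `d_π(C) ≤ 6`. -/
theorem stmt19 (C : Submodule (GQuot (⟨1, 4⟩ : GaussianInt))
      (Fin 6 → GQuot (⟨1, 4⟩ : GaussianInt)))
    (hsd : C = dualCode C) :
    ∃ c ∈ C, c ≠ 0 ∧ mWtVec (⟨1, 4⟩ : GaussianInt) c ≤ 6 := by
  classical
  change ∃ c ∈ C, c ≠ 0 ∧ mWtVec P4 c ≤ 6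
  have horth : ∀ x ∈ C, ∀ y ∈ C, ∑ j, x j * y j = 0 := by
    intro x hx y hy
    rw [hsd] at hx
    exact hx y hy
  let T : (Fin 6 → GQuot P4) →ₗ[GQuot P4] (Fin 3 → GQuot P4) :=
    LinearMap.funLeft _ _ ![(0 : Fin 6), 1, 2]
  by_cases htop : C.map T = ⊤
  · have hex : ∀ v : Fin 3 → GQuot P4, ∃ a b c : ℕ, a < 17 ∧ b < 17 ∧ c < 17 ∧
        ![v 0, v 1, v 2, (a : GQuot P4), (b : GQuot P4), (c : GQuot P4)] ∈ C := by
      intro v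
      have hv : v ∈ C.map T := by rw [htop]; trivial
      obtain ⟨x, hx, rfl⟩ := hv
      obtain ⟨a, ha, ha'⟩ := exists_nat (x 3)
      obtain ⟨b, hb, hb'⟩ := exists_nat (x 4)
      obtain ⟨c, hc, hc'⟩ := exists_nat (x 5)
      refine ⟨a, b, c, ha, hb, hc, ?_⟩
      rw [ha', hb', hc']
      have hxe : ![T x 0, T x 1, T x 2, x 3, x 4, x 5] = x := by
        ext j
        fin_cases j <;> rfl
      rw [hxe]
      exact hx
    obtain ⟨a, b, c, ha, hb, hc, hx⟩ := hex ![1, 0, 0]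
    obtain ⟨a', b', c', ha', hb', hc', hy⟩ := hex ![0, 1, 0]
    have hxx := horth _ hx _ hx
    have hyy := horth _ hy _ hy
    have hxy := horth _ hx _ hy
    simp [Fin.sum_univ_six] at hxx hyy hxy
    have nxx : (1 + (a*a+b*b+c*c)) % 17 = 0 := by
      rw [← nat_zero_iff]; push_cast; rw [← hxx]; ring
    have nyy : (1 + (a'*a'+b'*b'+c'*c')) % 17 = 0 := by
      rw [← nat_zero_iff]; push_cast; rw [← hyy]; ring
    have nxy : (a*a'+b*b'+c*c') % 17 = 0 := by
      rw [← nat_zero_iff]; push_cast; rw [← hxy]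
    have w0 : wN 0 = 0 := by norm_num [wN]
    have w1 : wN 1 = 1 := by norm_num [wN]
    by_cases h1 : 6 ≤ wN a + wN b + wN c
    swap
    · refine finish ![1, 0, 0, a, b, c] ?_ ?_ ?_
      · convert hx using 1
        ext j
        fin_cases j <;> simp
      · simp [Fin.sum_univ_six, w0, w1]
        omega
      · simp [Fin.sum_univ_six, w0, w1]
        omega
    by_cases h2 : 6 ≤ wN a' + wN b' + wN c'
    swap
    · refine finish ![0, 1, 0, a', b', c'] ?_ ?_ ?_
      · convert hy using 1
        ext j
        fin_cases j <;> simp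
      · simp [Fin.sum_univ_six, w0, w1]
        omega
      · simp [Fin.sum_univ_six, w0, w1]
        omega
    have hcand : ∀ a b c : ℕ, (1 + (a*a+b*b+c*c)) % 17 = 0 → 6 ≤ wN a + wN b + wN c →
        cand a b c = true := by
      intro a b c h h'
      unfold cand
      rw [Bool.and_eq_true]
      refine ⟨?_, Nat.ble_eq_true_of_le h'⟩
      have : (a*a+b*b+c*c) % 17 = 16 := by omega
      rw [this]
      rfl
    obtain ⟨s, t, hst1, hst6⟩ := pair_spec (mem_candL ha hb hc (hcand _ _ _ nxx h1))
      (mem_candL ha' hb' hc' (hcand _ _ _ nyy h2)) nxy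
    simp only [pairW] at hst1 hst6
    refine finish ![s, t, 0, s*a+t*a', s*b+t*b', s*c+t*c'] ?_ ?_ ?_
    · convert C.add_mem (C.smul_mem (s : GQuot P4) hx) (C.smul_mem (t : GQuot P4) hy) using 1
      ext j
      fin_cases j <;> simp
    · simp [Fin.sum_univ_six, w0]
      omega
    · simp [Fin.sum_univ_six, w0]
      omega
  · obtain ⟨s, hs0, hs⟩ := exists_functional _ htop
    obtain ⟨a, ha, ha'⟩ := exists_nat (s 0)
    obtain ⟨b, hb, hb'⟩ := exists_nat (s 1)
    obtain ⟨c, hc, hc'⟩ := exists_nat (s 2)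
    have hx : ![(a : GQuot P4), (b : GQuot P4), (c : GQuot P4), 0, 0, 0] ∈ C := by
      rw [hsd]
      intro y hy
      have := hs (T y) ⟨y, hy, rfl⟩
      rw [Fin.sum_univ_three, ← ha', ← hb', ← hc'] at this
      simpa [Fin.sum_univ_six, T, LinearMap.funLeft_apply] using this
    have hxx := horth _ hx _ hx
    simp [Fin.sum_univ_six] at hxx
    have nxx : (a*a+b*b+c*c) % 17 = 0 := by
      rw [← nat_zero_iff]; push_cast; rw [← hxx]
    have hne : a + b + c ≠ 0 := by
      intro h
      obtain ⟨rfl, rfl, rfl⟩ : a = 0 ∧ b = 0 ∧ c = 0 := by omega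
      apply hs0
      rw [Nat.cast_zero] at ha' hb' hc'
      ext j
      fin_cases j
      · exact ha'.symm
      · exact hb'.symm
      · exact hc'.symm
    obtain ⟨k, hk1, hk6⟩ := iso_spec ha hb hc nxx hne
    have w0 : wN 0 = 0 := by norm_num [wN]
    refine finish ![k*a, k*b, k*c, 0, 0, 0] ?_ ?_ ?_
    · convert C.smul_mem (k : GQuot P4) hx using 1
      ext j
      fin_cases j <;> simp
    · simp [Fin.sum_univ_six, w0]
      omega
    · simp [Fin.sum_univ_six, w0]
      omega
end
end
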